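/- arXiv:math/0501334 — 3 statements merged into one kernel-verified Lean document; each statement's English description precedes it below -/
import Mathlib

section
/- Let G = GL(n,k) with k algebraically closed. The differentiation map from the group of algebraic automorphisms of the derived group SL(n,k) to the group of restricted Lie algebra automorphisms of 𝔰𝔩(n,k) is bijective for all n ≥ 2 and all characteristics p. -/
open Matrix

/-- `P` is a family of polynomials (in the matrix entries) representing the map `f`
on `SL(n,k)`. -/
def Represents (n : ℕ) (k : Type*) [Field k]
    (P : Fin n × Fin n → MvPolynomial (Fin n × Fin n) k)
    (f : Matrix.SpecialLinearGroup (Fin n) k → Matrix.SpecialLinearGroup (Fin n) k) :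
    Prop :=
  ∀ g : Matrix.SpecialLinearGroup (Fin n) k, ∀ i j : Fin n,
    (f g : Matrix (Fin n) (Fin n) k) i j =
      MvPolynomial.eval (fun q : Fin n × Fin n => (g : Matrix (Fin n) (Fin n) k) q.1 q.2)
        (P (i, j))

/-- An algebraic automorphism of `SL(n,k)`: a group automorphism which, together with
its inverse, is given by polynomials in the matrix entries. -/
def IsAlgebraicAut (n : ℕ) (k : Type*) [Field k]
    (θ : Matrix.SpecialLinearGroup (Fin n) k ≃* Matrix.SpecialLinearGroup (Fin n) k) :
    Prop :=
  (∃ P, Represents n k P θ) ∧ (∃ P, Represents n k P θ.symm)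

/-- A restricted Lie algebra automorphism of `𝔰𝔩(n,k)`: a Lie algebra automorphism
commuting with the `p`-operation (the `p`-th matrix power, `p = char k`; the
condition is vacuous in characteristic 0). -/
def IsRestrictedAut (n : ℕ) (k : Type*) [Field k]
    (φ : ↥(LieAlgebra.SpecialLinear.sl (Fin n) k) ≃ₗ⁅k⁆
      ↥(LieAlgebra.SpecialLinear.sl (Fin n) k)) : Prop :=
  ∀ x y : ↥(LieAlgebra.SpecialLinear.sl (Fin n) k),
    (y : Matrix (Fin n) (Fin n) k) = (x : Matrix (Fin n) (Fin n) k) ^ (ringChar k) →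
    (φ y : Matrix (Fin n) (Fin n) k) = (φ x : Matrix (Fin n) (Fin n) k) ^ (ringChar k)

/-- `φ` is the differential of `θ` : over the dual numbers `k[ε]`, the polynomials
defining `θ` send `1 + ε x` to `1 + ε (φ x)`. -/
def IsDifferentialOf (n : ℕ) (k : Type*) [Field k]
    (θ : Matrix.SpecialLinearGroup (Fin n) k ≃* Matrix.SpecialLinearGroup (Fin n) k)
    (φ : ↥(LieAlgebra.SpecialLinear.sl (Fin n) k) ≃ₗ⁅k⁆
      ↥(LieAlgebra.SpecialLinear.sl (Fin n) k)) : Prop :=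
  ∃ P, Represents n k P θ ∧
    ∀ x : ↥(LieAlgebra.SpecialLinear.sl (Fin n) k), ∀ i j : Fin n,
      MvPolynomial.aeval
        (fun q : Fin n × Fin n =>
          algebraMap k (DualNumber k) ((1 : Matrix (Fin n) (Fin n) k) q.1 q.2) +
            DualNumber.eps *
              algebraMap k (DualNumber k) ((x : Matrix (Fin n) (Fin n) k) q.1 q.2))
        (P (i, j)) =
      algebraMap k (DualNumber k) ((1 : Matrix (Fin n) (Fin n) k) i j) +
        DualNumber.eps *
          algebraMap k (DualNumber k) ((φ x : Matrix (Fin n) (Fin n) k) i j)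

/-- The point `1 + ε x` of the matrix space over the dual numbers. -/
noncomputable def onePlusEps {n : ℕ} {k : Type*} [Field k] (x : Matrix (Fin n) (Fin n) k) :
    Matrix (Fin n) (Fin n) (DualNumber k) :=
  1 + (DualNumber.eps : DualNumber k) • x.map (algebraMap k (DualNumber k))

section Tangent

open MvPolynomial

variable {n : ℕ} {k : Type*} [Field k]

theorem onePlusEps_apply (x : Matrix (Fin n) (Fin n) k) (i j : Fin n) :
    onePlusEps x i j = algebraMap k (DualNumber k) ((1 : Matrix (Fin n) (Fin n) k) i j) +
      DualNumber.eps * algebraMap k (DualNumber k) (x i j) := by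
  simp only [onePlusEps, Matrix.add_apply, Matrix.smul_apply, Matrix.map_apply, smul_eq_mul]
  rcases eq_or_ne i j with rfl | h <;> simp [*]

theorem algebraMap_add_eps_mul_inj {a b c d : k}
    (h : algebraMap k (DualNumber k) a + DualNumber.eps * algebraMap k (DualNumber k) b =
      algebraMap k (DualNumber k) c + DualNumber.eps * algebraMap k (DualNumber k) d) :
    a = c ∧ b = d := by
  have h1 := congrArg TrivSqZeroExt.fst h
  have h2 := congrArg TrivSqZeroExt.snd h
  simp [TrivSqZeroExt.algebraMap_eq_inl] at h1 h2
  exact ⟨h1, h2⟩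

theorem map_add_eps_smul_map_inj {a b c d : Matrix (Fin n) (Fin n) k}
    (h : a.map (algebraMap k (DualNumber k)) +
        (DualNumber.eps : DualNumber k) • b.map (algebraMap k (DualNumber k)) =
      c.map (algebraMap k (DualNumber k)) +
        (DualNumber.eps : DualNumber k) • d.map (algebraMap k (DualNumber k))) :
    a = c ∧ b = d := by
  have h' (i j : Fin n) := algebraMap_add_eps_mul_inj (congrFun (congrFun h i) j)
  exact ⟨Matrix.ext fun i j => (h' i j).1, Matrix.ext fun i j => (h' i j).2⟩

theorem onePlusEps_injective : Function.Injective (onePlusEps (n := n) (k := k)) := by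
  intro x y h
  refine (map_add_eps_smul_map_inj (a := 1) (c := 1) ?_).2
  simpa [onePlusEps] using h

theorem onePlusEps_mul (x y : Matrix (Fin n) (Fin n) k) :
    onePlusEps x * onePlusEps y = onePlusEps (x + y) := by
  simp only [onePlusEps, mul_add, add_mul, one_mul, mul_one, Matrix.smul_mul, Matrix.mul_smul,
    smul_smul, DualNumber.eps_mul_eps, zero_smul, Matrix.map_add _ (map_add _), smul_add]
  abel

theorem onePlusEps_zero : onePlusEps (0 : Matrix (Fin n) (Fin n) k) = 1 := by
  simp [onePlusEps]

theorem det_onePlusEps (x : Matrix (Fin n) (Fin n) k) :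
    (onePlusEps x).det = 1 + DualNumber.eps * algebraMap k (DualNumber k) x.trace := by
  rw [onePlusEps, Matrix.det_one_add_smul, DualNumber.eps_pow_two, mul_zero, add_zero, mul_comm]
  congr 2
  simp [Matrix.trace]

theorem adjugate_onePlusEps {x : Matrix (Fin n) (Fin n) k} (hx : x.trace = 0) :
    (onePlusEps x).adjugate = onePlusEps (-x) := by
  have h1 : onePlusEps x * onePlusEps (-x) = 1 := by
    rw [onePlusEps_mul, add_neg_cancel, onePlusEps_zero]
  have h2 : (onePlusEps x).adjugate * onePlusEps x = 1 := by
    rw [Matrix.adjugate_mul, det_onePlusEps, hx]; simp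
  calc (onePlusEps x).adjugate = (onePlusEps x).adjugate * (onePlusEps x * onePlusEps (-x)) := by
        rw [h1, mul_one]
    _ = onePlusEps (-x) := by rw [← mul_assoc, h2, one_mul]

/-- Conjugating `1 + ε x` by constant matrices. -/
theorem map_mul_onePlusEps_mul_map {g h : Matrix (Fin n) (Fin n) k} (hgh : g * h = 1)
    (x : Matrix (Fin n) (Fin n) k) :
    g.map (algebraMap k (DualNumber k)) * onePlusEps x * h.map (algebraMap k (DualNumber k)) =
      onePlusEps (g * x * h) := by
  simp only [onePlusEps, mul_add, add_mul, mul_one, Matrix.smul_mul, Matrix.mul_smul,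
    ← Matrix.map_mul, hgh]
  simp

/-- Evaluation of a polynomial in the matrix entries at `1 + ε x`. -/
noncomputable def evTangent (x : Matrix (Fin n) (Fin n) k) :
    MvPolynomial (Fin n × Fin n) k →ₐ[k] DualNumber k :=
  aeval (fun q : Fin n × Fin n => onePlusEps x q.1 q.2)

/-- The derivative at the identity matrix of a polynomial in the matrix entries. -/
noncomputable def derivOne (Q : MvPolynomial (Fin n × Fin n) k) :
    Matrix (Fin n) (Fin n) k →ₗ[k] k :=
  ∑ q : Fin n × Fin n, eval (fun q => (1 : Matrix (Fin n) (Fin n) k) q.1 q.2) (pderiv q Q) •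
    Matrix.entryLinearMap k k q.1 q.2

theorem derivOne_apply (Q : MvPolynomial (Fin n × Fin n) k) (x : Matrix (Fin n) (Fin n) k) :
    derivOne Q x = ∑ q : Fin n × Fin n,
      eval (fun q => (1 : Matrix (Fin n) (Fin n) k) q.1 q.2) (pderiv q Q) * x q.1 q.2 := by
  simp [derivOne]

theorem evTangent_eq (x : Matrix (Fin n) (Fin n) k) (Q : MvPolynomial (Fin n × Fin n) k) :
    evTangent x Q = algebraMap k (DualNumber k)
        (eval (fun q => (1 : Matrix (Fin n) (Fin n) k) q.1 q.2) Q) +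
      DualNumber.eps * algebraMap k (DualNumber k) (derivOne Q x) := by
  induction Q using MvPolynomial.induction_on with
  | C a => simp [evTangent, derivOne_apply]
  | add p q hp hq =>
    rw [map_add, hp, hq]
    simp only [derivOne_apply, map_add, add_mul, Finset.sum_add_distrib, mul_add]
    ring
  | mul_X p q hp =>
    have h : derivOne (p * X q) x =
        eval (fun q => (1 : Matrix (Fin n) (Fin n) k) q.1 q.2) p * x q.1 q.2 +
        (1 : Matrix (Fin n) (Fin n) k) q.1 q.2 * derivOne p x := by
      simp only [derivOne_apply, Derivation.leibniz, pderiv_X, smul_eq_mul, map_add, map_mul,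
        eval_X, add_mul, Finset.sum_add_distrib, Finset.mul_sum, mul_assoc]
      congr 1
      rw [Finset.sum_eq_single q]
      · simp
      · intro b _ hb
        simp [Pi.single_eq_of_ne hb.symm]
      · simp
    rw [map_mul, hp, h]
    simp only [evTangent, aeval_X, onePlusEps_apply, map_mul, map_add, eval_X]
    linear_combination (algebraMap k (DualNumber k) (derivOne p x)) *
      (algebraMap k (DualNumber k) (x q.1 q.2)) * DualNumber.eps_mul_eps (R := k)

theorem mvPolynomialX_map_evTangent (x : Matrix (Fin n) (Fin n) k) :
    (Matrix.mvPolynomialX (Fin n) (Fin n) k).map (evTangent x) = onePlusEps x := by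
  ext i j : 1
  simp [evTangent]

theorem evTangent_bind₁ {x y : Matrix (Fin n) (Fin n) k}
    {Y : Matrix (Fin n) (Fin n) (MvPolynomial (Fin n × Fin n) k)}
    (h : Y.map (evTangent x) = onePlusEps y) (Q : MvPolynomial (Fin n × Fin n) k) :
    evTangent x (bind₁ (fun q => Y q.1 q.2) Q) = evTangent y Q := by
  rw [evTangent, aeval_bind₁, ← evTangent]
  simp only [evTangent] at h ⊢
  rw [← h]
  rfl

/-- The elementary matrices off the diagonal and the differences of those on the diagonal span
the matrices of trace zero. -/
theorem mem_of_single_mem {S : Submodule k (Matrix (Fin n) (Fin n) k)} (i₀ : Fin n)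
    (hoff : ∀ i j, i ≠ j → Matrix.single i j (1 : k) ∈ S)
    (hdiag : ∀ i, i ≠ i₀ → Matrix.single i i (1 : k) - Matrix.single i₀ i₀ 1 ∈ S)
    {x : Matrix (Fin n) (Fin n) k} (hx : x.trace = 0) : x ∈ S := by
  have key : x = ∑ i, ∑ j, x i j • (Matrix.single i j (1 : k) -
      if i = j then Matrix.single i₀ i₀ 1 else 0) := by
    simp only [smul_sub, Finset.sum_sub_distrib, smul_ite, smul_zero, Finset.sum_ite_eq,
      Finset.mem_univ, if_true, ← Finset.sum_smul]
    rw [show ∑ i, x i i = 0 from hx, zero_smul, sub_zero]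
    conv_lhs => rw [Matrix.matrix_eq_sum_single x]
    simp [Matrix.smul_single]
  rw [key]
  refine sum_mem fun i _ => sum_mem fun j _ => Submodule.smul_mem _ _ ?_
  rcases eq_or_ne i j with rfl | hij
  · rcases eq_or_ne i i₀ with rfl | hi
    · simp
    · simpa using hdiag i hi
  · simpa [hij] using hoff i j hij

/-- The matrices of rank at most one and trace zero span the matrices of trace zero. -/
theorem mem_span_vecMulVec_of_trace_eq_zero {x : Matrix (Fin n) (Fin n) k} (hx : x.trace = 0) :
    x ∈ Submodule.span k
      {y : Matrix (Fin n) (Fin n) k | ∃ a b : Fin n → k, b ⬝ᵥ a = 0 ∧ y = vecMulVec a b} := by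
  rcases n with _ | n
  · rw [Subsingleton.elim x 0]; exact zero_mem _
  have hoff (i j : Fin (n + 1)) (hij : i ≠ j) : Matrix.single i j (1 : k) ∈ Submodule.span k
      {y : Matrix (Fin (n + 1)) (Fin (n + 1)) k |
        ∃ a b : Fin (n + 1) → k, b ⬝ᵥ a = 0 ∧ y = vecMulVec a b} :=
    Submodule.subset_span ⟨Pi.single i 1, Pi.single j 1, by simp [hij],
      Matrix.single_eq_single_vecMulVec_single i j⟩
  refine mem_of_single_mem 0 hoff (fun i hi => ?_) hx
  have h1 : vecMulVec (Pi.single i (1 : k) + Pi.single 0 1) (Pi.single i 1 - Pi.single 0 1)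
      ∈ Submodule.span k {y : Matrix (Fin (n + 1)) (Fin (n + 1)) k |
        ∃ a b : Fin (n + 1) → k, b ⬝ᵥ a = 0 ∧ y = vecMulVec a b} := by
    refine Submodule.subset_span ⟨_, _, ?_, rfl⟩
    simp [hi, hi.symm]
  have h2 := add_mem (sub_mem h1 (hoff 0 i hi.symm)) (hoff i 0 hi)
  convert h2 using 1
  simp only [Matrix.single_eq_single_vecMulVec_single, add_vecMulVec, vecMulVec_sub]
  abel

theorem det_one_add_vecMulVec_of_dotProduct_eq_zero {R : Type*} [CommRing R] {a b : Fin n → R}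
    (h : b ⬝ᵥ a = 0) : (1 + vecMulVec a b).det = 1 := by
  rw [vecMulVec_eq Unit, Matrix.det_one_add_replicateCol_mul_replicateRow, h, add_zero]

/-- A polynomial vanishing on `SL(n,k)` vanishes at `1 + ε x` for `x ∈ 𝔰𝔩(n,k)`. -/
theorem evTangent_eq_zero [Infinite k] {Q : MvPolynomial (Fin n × Fin n) k}
    (hQ : ∀ g : Matrix.SpecialLinearGroup (Fin n) k,
      eval (fun q => (g : Matrix (Fin n) (Fin n) k) q.1 q.2) Q = 0)
    {x : Matrix (Fin n) (Fin n) k} (hx : x.trace = 0) : evTangent x Q = 0 := by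
  have h1 : eval (fun q => (1 : Matrix (Fin n) (Fin n) k) q.1 q.2) Q = 0 := hQ 1
  rw [evTangent_eq, h1]
  suffices h : derivOne Q x = 0 by simp [h]
  suffices h : Submodule.span k
      {y : Matrix (Fin n) (Fin n) k | ∃ a b : Fin n → k, b ⬝ᵥ a = 0 ∧ y = vecMulVec a b} ≤
      LinearMap.ker (derivOne Q) from h (mem_span_vecMulVec_of_trace_eq_zero hx)
  rw [Submodule.span_le]
  rintro _ ⟨a, b, hab, rfl⟩
  set y := vecMulVec a b
  let f : Polynomial k := aeval (fun q : Fin n × Fin n =>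
    Polynomial.C ((1 : Matrix (Fin n) (Fin n) k) q.1 q.2) +
      Polynomial.X * Polynomial.C (y q.1 q.2)) Q
  have hf : f = 0 := by
    refine Polynomial.funext fun t => ?_
    have hdet : ((1 : Matrix (Fin n) (Fin n) k) + vecMulVec (t • a) b).det = 1 :=
      det_one_add_vecMulVec_of_dotProduct_eq_zero (by simp [hab])
    have := hQ ⟨_, hdet⟩
    rw [Polynomial.eval_zero, ← this]
    change Polynomial.evalRingHom t (aeval _ Q) = _
    rw [aeval_def, hom_eval₂, eval, eval₂Hom]
    simp only [RingHom.coe_mk, MonoidHom.coe_mk, OneHom.coe_mk]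
    congr 1
    · ext; simp
    · funext q
      simp [y, vecMulVec_apply]
  have hy : evTangent y Q = Polynomial.aeval (DualNumber.eps : DualNumber k) f := by
    simp only [f, evTangent, ← AlgHom.comp_apply, comp_aeval]
    congr 2
    funext q
    simpa [onePlusEps_apply] using mul_comm _ _
  rw [hf, map_zero, evTangent_eq, h1] at hy
  exact (algebraMap_add_eps_mul_inj (k := k) (a := 0) (c := 0) (d := 0) (by simpa using hy)).2

end Tangent

section Differential

open MvPolynomial

variable {n : ℕ} {k : Type*} [Field k]

/-- The differential at the identity of a polynomial map between matrices. -/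
noncomputable def diffOne (P : Fin n × Fin n → MvPolynomial (Fin n × Fin n) k) :
    Matrix (Fin n) (Fin n) k →ₗ[k] Matrix (Fin n) (Fin n) k where
  toFun x := Matrix.of fun i j => derivOne (P (i, j)) x
  map_add' x y := by ext; simp
  map_smul' c x := by ext; simp

theorem diffOne_apply (P : Fin n × Fin n → MvPolynomial (Fin n × Fin n) k)
    (x : Matrix (Fin n) (Fin n) k) (i j : Fin n) :
    diffOne P x i j = derivOne (P (i, j)) x := rfl

theorem eval_bind₁_eq (v : Fin n × Fin n → k)
    (f : Fin n × Fin n → MvPolynomial (Fin n × Fin n) k) (Q : MvPolynomial (Fin n × Fin n) k) :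
    eval v (bind₁ f Q) = eval (fun q => eval v (f q)) Q := by
  induction Q using MvPolynomial.induction_on with
  | C a => simp
  | add p q hp hq => rw [map_add, map_add, map_add, hp, hq]
  | mul_X p i hp => rw [map_mul, map_mul, map_mul, hp, bind₁_X_right, eval_X]

/-- Polynomial matrix identities on `SL(n,k)` persist at `1 + ε x` for `x ∈ 𝔰𝔩(n,k)`. -/
theorem map_evTangent_eq_of_map_eval_eq [Infinite k]
    {A B : Matrix (Fin n) (Fin n) (MvPolynomial (Fin n × Fin n) k)}
    (h : ∀ g : Matrix.SpecialLinearGroup (Fin n) k,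
      A.map (eval fun q => (g : Matrix (Fin n) (Fin n) k) q.1 q.2) =
        B.map (eval fun q => (g : Matrix (Fin n) (Fin n) k) q.1 q.2))
    {x : Matrix (Fin n) (Fin n) k} (hx : x.trace = 0) :
    A.map (evTangent x) = B.map (evTangent x) := by
  ext i j : 1
  have := evTangent_eq_zero (Q := A i j - B i j) (fun g => by
    rw [map_sub, sub_eq_zero]; exact congrFun (congrFun (h g) i) j) hx
  rwa [map_sub, sub_eq_zero] at this

theorem mvPolynomialX_map_eval (g : Matrix (Fin n) (Fin n) k) :
    (Matrix.mvPolynomialX (Fin n) (Fin n) k).map (eval fun q => g q.1 q.2) = g := by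
  ext; simp

theorem map_C_map_eval (a : Matrix (Fin n) (Fin n) k) (v : Fin n × Fin n → k) :
    (a.map (C (σ := Fin n × Fin n))).map (eval v) = a := by
  ext; simp

theorem map_C_map_evTangent (a x : Matrix (Fin n) (Fin n) k) :
    (a.map (C (σ := Fin n × Fin n))).map (evTangent x) = a.map (algebraMap k (DualNumber k)) := by
  ext i j : 1
  simp [evTangent]

theorem adjugate_mvPolynomialX_map_eval (g : Matrix.SpecialLinearGroup (Fin n) k) :
    (Matrix.mvPolynomialX (Fin n) (Fin n) k).adjugate.map
      (eval fun q => (g : Matrix (Fin n) (Fin n) k) q.1 q.2) =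
      ((g⁻¹ : Matrix.SpecialLinearGroup (Fin n) k) : Matrix (Fin n) (Fin n) k) := by
  rw [Matrix.SpecialLinearGroup.coe_inv, ← RingHom.mapMatrix_apply, RingHom.map_adjugate,
    RingHom.mapMatrix_apply, mvPolynomialX_map_eval]

theorem adjugate_mvPolynomialX_map_evTangent {x : Matrix (Fin n) (Fin n) k} (hx : x.trace = 0) :
    (Matrix.mvPolynomialX (Fin n) (Fin n) k).adjugate.map (evTangent x) = onePlusEps (-x) := by
  rw [← adjugate_onePlusEps hx, ← AlgHom.mapMatrix_apply, AlgHom.map_adjugate,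
    AlgHom.mapMatrix_apply, mvPolynomialX_map_evTangent]

variable {P : Fin n × Fin n → MvPolynomial (Fin n × Fin n) k}

theorem Represents.map_eval {f : Matrix.SpecialLinearGroup (Fin n) k →
      Matrix.SpecialLinearGroup (Fin n) k} (hP : Represents n k P f)
    (g : Matrix.SpecialLinearGroup (Fin n) k) :
    (Matrix.of fun i j => P (i, j)).map
      (eval fun q => (g : Matrix (Fin n) (Fin n) k) q.1 q.2) = f g := by
  ext i j
  exact (hP g i j).symm

theorem Represents.map_evTangent {f : Matrix.SpecialLinearGroup (Fin n) k →
      Matrix.SpecialLinearGroup (Fin n) k} (hP : Represents n k P f) (hf : f 1 = 1)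
    (x : Matrix (Fin n) (Fin n) k) :
    (Matrix.of fun i j => P (i, j)).map (evTangent x) = onePlusEps (diffOne P x) := by
  ext i j : 1
  have h1 := hP 1 i j
  rw [hf, Matrix.SpecialLinearGroup.coe_one] at h1
  rw [onePlusEps_apply, diffOne_apply, h1, Matrix.map_apply, Matrix.of_apply, evTangent_eq]

theorem isDifferentialOf_iff
    {θ : Matrix.SpecialLinearGroup (Fin n) k ≃* Matrix.SpecialLinearGroup (Fin n) k}
    {φ : ↥(LieAlgebra.SpecialLinear.sl (Fin n) k) ≃ₗ⁅k⁆
      ↥(LieAlgebra.SpecialLinear.sl (Fin n) k)} :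
    IsDifferentialOf n k θ φ ↔ ∃ P, Represents n k P θ ∧
      ∀ x : ↥(LieAlgebra.SpecialLinear.sl (Fin n) k),
        diffOne P (x : Matrix (Fin n) (Fin n) k) = φ x := by
  refine exists_congr fun P => and_congr_right fun hP => forall_congr' fun x => ?_
  rw [← onePlusEps_injective.eq_iff, ← hP.map_evTangent (map_one θ), ← Matrix.ext_iff]
  simp only [← onePlusEps_apply]
  rfl

variable [Infinite k]
  {θ : Matrix.SpecialLinearGroup (Fin n) k ≃* Matrix.SpecialLinearGroup (Fin n) k}

theorem Represents.trace_diffOne (hP : Represents n k P θ) {x : Matrix (Fin n) (Fin n) k}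
    (hx : x.trace = 0) : (diffOne P x).trace = 0 := by
  have h := evTangent_eq_zero (Q := (Matrix.of fun i j => P (i, j)).det - 1) (fun g => by
    rw [map_sub, map_one, RingHom.map_det, RingHom.mapMatrix_apply, hP.map_eval,
      Matrix.SpecialLinearGroup.det_coe, sub_self]) hx
  rw [map_sub, map_one, AlgHom.map_det, AlgHom.mapMatrix_apply, hP.map_evTangent (map_one θ),
    det_onePlusEps, add_sub_cancel_left] at h
  exact (algebraMap_add_eps_mul_inj (k := k) (a := 0) (c := 0) (d := 0) (by simpa using h)).2

/-- The differential of a polynomial map on `SL(n,k)` does not depend on the polynomials. -/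
theorem Represents.diffOne_eq {P' : Fin n × Fin n → MvPolynomial (Fin n × Fin n) k}
    (hP : Represents n k P θ) (hP' : Represents n k P' θ) {x : Matrix (Fin n) (Fin n) k}
    (hx : x.trace = 0) : diffOne P x = diffOne P' x := by
  apply onePlusEps_injective
  rw [← hP.map_evTangent (map_one θ), ← hP'.map_evTangent (map_one θ)]
  exact map_evTangent_eq_of_map_eval_eq (fun g => by rw [hP.map_eval, hP'.map_eval]) hx

theorem Represents.diffOne_diffOne {P' : Fin n × Fin n → MvPolynomial (Fin n × Fin n) k}
    (hP : Represents n k P θ) (hP' : Represents n k P' θ.symm) {x : Matrix (Fin n) (Fin n) k}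
    (hx : x.trace = 0) : diffOne P' (diffOne P x) = x := by
  apply onePlusEps_injective
  rw [← hP'.map_evTangent (map_one θ.symm)]
  have h := map_evTangent_eq_of_map_eval_eq
    (A := Matrix.of fun i j => bind₁ P (P' (i, j)))
    (B := Matrix.mvPolynomialX (Fin n) (Fin n) k) (fun g => by
      rw [mvPolynomialX_map_eval]
      ext i j
      rw [Matrix.map_apply, Matrix.of_apply, eval_bind₁_eq]
      have := hP' (θ g) i j
      rw [MulEquiv.symm_apply_apply] at this
      rw [this]
      congr 2
      funext q
      exact (hP g q.1 q.2).symm) hx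
  rw [mvPolynomialX_map_evTangent] at h
  rw [← h]
  ext i j : 1
  exact (evTangent_bind₁ (Y := Matrix.of fun i j => P (i, j))
    (hP.map_evTangent (map_one θ) x) (P' (i, j))).symm

theorem Represents.diffOne_conj_mul (hP : Represents n k P θ)
    (g : Matrix.SpecialLinearGroup (Fin n) k) {x : Matrix (Fin n) (Fin n) k} (hx : x.trace = 0) :
    diffOne P ((g : Matrix (Fin n) (Fin n) k) * x * (g : Matrix (Fin n) (Fin n) k).adjugate) *
      (θ g : Matrix (Fin n) (Fin n) k) = (θ g : Matrix (Fin n) (Fin n) k) * diffOne P x := by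
  have hg : (g : Matrix (Fin n) (Fin n) k) * (g : Matrix (Fin n) (Fin n) k).adjugate = 1 := by
    simp [Matrix.mul_adjugate]
  let Y : Matrix (Fin n) (Fin n) (MvPolynomial (Fin n × Fin n) k) :=
    (g : Matrix (Fin n) (Fin n) k).map C * Matrix.mvPolynomialX (Fin n) (Fin n) k *
      (g : Matrix (Fin n) (Fin n) k).adjugate.map C
  have hY : Y.map (evTangent x) = onePlusEps ((g : Matrix (Fin n) (Fin n) k) * x *
      (g : Matrix (Fin n) (Fin n) k).adjugate) := by
    simp only [Y, Matrix.map_mul, map_C_map_evTangent, mvPolynomialX_map_evTangent]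
    exact map_mul_onePlusEps_mul_map hg x
  have h := map_evTangent_eq_of_map_eval_eq
    (A := (Matrix.of fun i j => bind₁ (fun q => Y q.1 q.2) (P (i, j))) *
      (θ g : Matrix (Fin n) (Fin n) k).map C)
    (B := (θ g : Matrix (Fin n) (Fin n) k).map C * Matrix.of fun i j => P (i, j)) (fun h => by
      have h1 : (Matrix.of fun i j => bind₁ (fun q => Y q.1 q.2) (P (i, j))).map
          (eval fun q => (h : Matrix (Fin n) (Fin n) k) q.1 q.2) = θ (g * h * g⁻¹) := by
        ext i j
        rw [Matrix.map_apply, Matrix.of_apply, eval_bind₁_eq, hP]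
        congr 2
        funext q
        have : Y.map (eval fun q => (h : Matrix (Fin n) (Fin n) k) q.1 q.2) =
            (g * h * g⁻¹ : Matrix.SpecialLinearGroup (Fin n) k) := by
          simp only [Y, Matrix.map_mul, map_C_map_eval, mvPolynomialX_map_eval,
            Matrix.SpecialLinearGroup.coe_mul, Matrix.SpecialLinearGroup.coe_inv]
        exact congrFun (congrFun this q.1) q.2
      rw [Matrix.map_mul, Matrix.map_mul, h1, map_C_map_eval, hP.map_eval,
        ← Matrix.SpecialLinearGroup.coe_mul, ← Matrix.SpecialLinearGroup.coe_mul, ← map_mul,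
        ← map_mul]
      simp) hx
  have h2 : (Matrix.of fun i j => bind₁ (fun q => Y q.1 q.2) (P (i, j))).map (evTangent x) =
      onePlusEps (diffOne P ((g : Matrix (Fin n) (Fin n) k) * x *
      (g : Matrix (Fin n) (Fin n) k).adjugate)) := by
    rw [← hP.map_evTangent (map_one θ)]
    ext i j : 1
    exact evTangent_bind₁ hY (P (i, j))
  rw [Matrix.map_mul, Matrix.map_mul, h2, map_C_map_evTangent, hP.map_evTangent (map_one θ)] at h
  refine (map_add_eps_smul_map_inj (a := (θ g : Matrix (Fin n) (Fin n) k))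
    (c := (θ g : Matrix (Fin n) (Fin n) k)) ?_).2
  simpa only [onePlusEps, add_mul, mul_add, one_mul, mul_one, Matrix.smul_mul, Matrix.mul_smul,
    ← Matrix.map_mul] using h

theorem Represents.diffOne_lie (hP : Represents n k P θ) {x y : Matrix (Fin n) (Fin n) k}
    (hx : x.trace = 0) (hy : y.trace = 0) :
    diffOne P (y * x - x * y) =
      diffOne P y * diffOne P x - diffOne P x * diffOne P y := by
  let Y : Matrix (Fin n) (Fin n) (MvPolynomial (Fin n × Fin n) k) :=
    Matrix.mvPolynomialX (Fin n) (Fin n) k * x.map C *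
      (Matrix.mvPolynomialX (Fin n) (Fin n) k).adjugate
  have hY : Y.map (evTangent y) = x.map (algebraMap k (DualNumber k)) +
      (DualNumber.eps : DualNumber k) • (y * x - x * y).map (algebraMap k (DualNumber k)) := by
    have hneg (z : Matrix (Fin n) (Fin n) k) :
        (-z).map (algebraMap k (DualNumber k)) = -z.map (algebraMap k (DualNumber k)) := by
      ext i j : 1
      simp
    simp only [Y, Matrix.map_mul, map_C_map_evTangent, mvPolynomialX_map_evTangent,
      adjugate_mvPolynomialX_map_evTangent hy]
    simp only [onePlusEps, mul_add, add_mul, one_mul, mul_one,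
      Matrix.smul_mul, Matrix.mul_smul, smul_smul, DualNumber.eps_mul_eps, zero_smul, add_zero,
      ← Matrix.map_mul, Matrix.map_sub _ (map_sub _), hneg, mul_neg,
      smul_sub, smul_neg]
    abel
  let DY : Matrix (Fin n) (Fin n) (MvPolynomial (Fin n × Fin n) k) := Matrix.of fun i j =>
    ∑ q : Fin n × Fin n, C (eval (fun q => (1 : Matrix (Fin n) (Fin n) k) q.1 q.2)
      (pderiv q (P (i, j)))) * Y q.1 q.2
  have hDY : DY.map (evTangent y) = (diffOne P x).map (algebraMap k (DualNumber k)) +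
      (DualNumber.eps : DualNumber k) •
        (diffOne P (y * x - x * y)).map (algebraMap k (DualNumber k)) := by
    ext i j : 1
    have hY' (q : Fin n × Fin n) := congrFun (congrFun hY q.1) q.2
    simp only [Matrix.map_apply, Matrix.add_apply, Matrix.smul_apply, smul_eq_mul] at hY'
    simp only [DY, Matrix.map_apply, Matrix.of_apply, map_sum, map_mul, hY', Matrix.add_apply,
      Matrix.smul_apply, diffOne_apply, derivOne_apply, smul_eq_mul, mul_add, Finset.mul_sum,
      Finset.sum_add_distrib]
    congr 1
    · simp [evTangent]
    · refine Finset.sum_congr rfl fun q _ => ?_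
      simp only [evTangent, algHom_C]
      ring
  have h := map_evTangent_eq_of_map_eval_eq
    (A := DY * Matrix.of fun i j => P (i, j))
    (B := (Matrix.of fun i j => P (i, j)) * (diffOne P x).map C) (fun g => by
      rw [Matrix.map_mul, Matrix.map_mul, hP.map_eval, map_C_map_eval,
        ← hP.diffOne_conj_mul g hx]
      congr 1
      ext i j
      have : Y.map (eval fun q => (g : Matrix (Fin n) (Fin n) k) q.1 q.2) =
          (g : Matrix (Fin n) (Fin n) k) * x * (g : Matrix (Fin n) (Fin n) k).adjugate := by
        simp only [Y, Matrix.map_mul, map_C_map_eval, mvPolynomialX_map_eval,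
          adjugate_mvPolynomialX_map_eval, Matrix.SpecialLinearGroup.coe_inv]
      simp only [DY, Matrix.map_apply, Matrix.of_apply, map_sum, map_mul, eval_C,
        diffOne_apply, derivOne_apply, ← this]) hy
  rw [Matrix.map_mul, Matrix.map_mul, hDY, map_C_map_evTangent, hP.map_evTangent (map_one θ)] at h
  have h2 := (map_add_eps_smul_map_inj (a := diffOne P x) (c := diffOne P x)
    (b := diffOne P x * diffOne P y + diffOne P (y * x - x * y))
    (d := diffOne P y * diffOne P x) (by
      simpa only [onePlusEps, mul_add, add_mul, one_mul, mul_one, Matrix.smul_mul,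
        Matrix.mul_smul, smul_smul, DualNumber.eps_mul_eps, zero_smul, add_zero, zero_add,
        ← Matrix.map_mul, Matrix.map_add _ (map_add _), smul_add, add_assoc,
        add_comm, add_left_comm] using h)).2
  rw [← h2]
  abel

end Differential

section Perfect

open Matrix.SpecialLinearGroup

variable {n : ℕ} {k : Type*} [Field k]

theorem one_submatrix_transpose_mul_one_submatrix {e : Fin 2 → Fin n}
    (he : Function.Injective e) :
    ((1 : Matrix (Fin n) (Fin n) k).submatrix id e)ᵀ *
      (1 : Matrix (Fin n) (Fin n) k).submatrix id e = 1 := by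
  rw [Matrix.transpose_submatrix, Matrix.transpose_one,
    ← Matrix.submatrix_mul _ _ e id e Function.bijective_id, mul_one, Matrix.submatrix_one _ he]

/-- The embedding of `SL(2,k)` in `SL(n,k)` acting on two of the coordinates. -/
def embedTwo {e : Fin 2 → Fin n} (he : Function.Injective e) :
    Matrix.SpecialLinearGroup (Fin 2) k →* Matrix.SpecialLinearGroup (Fin n) k :=
  MonoidHom.mk' (fun x =>
    ⟨1 + (1 : Matrix (Fin n) (Fin n) k).submatrix id e *
      ((x : Matrix (Fin 2) (Fin 2) k) - 1) *
      ((1 : Matrix (Fin n) (Fin n) k).submatrix id e)ᵀ, by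
      rw [Matrix.mul_assoc, Matrix.det_one_add_mul_comm, Matrix.mul_assoc,
        one_submatrix_transpose_mul_one_submatrix he, mul_one, add_sub_cancel, x.2]⟩)
    (fun x y => by
      apply Subtype.ext
      have h := one_submatrix_transpose_mul_one_submatrix (k := k) he
      change 1 + _ * (_ * _ - 1) * _ = (1 + _) * (1 + _)
      generalize (1 : Matrix (Fin n) (Fin n) k).submatrix id e = U at *
      have h2 : U * ((x : Matrix (Fin 2) (Fin 2) k) - 1) * Uᵀ *
          (U * ((y : Matrix (Fin 2) (Fin 2) k) - 1) * Uᵀ) =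
          U * (((x : Matrix (Fin 2) (Fin 2) k) - 1) * ((y : Matrix (Fin 2) (Fin 2) k) - 1)) *
            Uᵀ := by
        calc _ = U * ((x : Matrix (Fin 2) (Fin 2) k) - 1) * (Uᵀ * U) *
            ((y : Matrix (Fin 2) (Fin 2) k) - 1) * Uᵀ := by simp only [Matrix.mul_assoc]
          _ = _ := by rw [h, Matrix.mul_one]; simp only [Matrix.mul_assoc]
      rw [add_mul, mul_add, mul_add, h2, one_mul, one_mul, mul_one, add_assoc,
        ← add_assoc (U * _ * _), ← Matrix.add_mul, ← Matrix.mul_add, ← Matrix.add_mul, ← Matrix.mul_add]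
      congr 3
      noncomm_ring)

theorem embedTwo_coe {e : Fin 2 → Fin n} (he : Function.Injective e)
    (x : Matrix.SpecialLinearGroup (Fin 2) k) :
    (embedTwo he x : Matrix (Fin n) (Fin n) k) =
      1 + ∑ s, ∑ t, Matrix.single (e s) (e t) (((x : Matrix (Fin 2) (Fin 2) k) - 1) s t) := by
  change 1 + (1 : Matrix (Fin n) (Fin n) k).submatrix id e *
    ((x : Matrix (Fin 2) (Fin 2) k) - 1) * ((1 : Matrix (Fin n) (Fin n) k).submatrix id e)ᵀ = _
  generalize (x : Matrix (Fin 2) (Fin 2) k) - 1 = y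
  ext a b
  simp only [Matrix.add_apply, Matrix.mul_apply, Matrix.transpose_apply, Matrix.submatrix_apply,
    Fin.sum_univ_two, Matrix.single_apply]
  congr 1
  have hone (c i : Fin n) : (1 : Matrix (Fin n) (Fin n) k) c i = if i = c then 1 else 0 := by
    rw [Matrix.one_apply]
    exact if_congr eq_comm rfl rfl
  simp only [hone, ite_and, id_eq]
  split_ifs <;> ring

theorem commutator_specialLinearGroup_eq_top [Infinite k] (hn : 2 ≤ n) :
    commutator (Matrix.SpecialLinearGroup (Fin n) k) = ⊤ := by
  obtain ⟨a, ha⟩ : ∃ a : k, a ∉ ({0, 1, -1} : Set k) := (Set.toFinite _).exists_notMem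
  simp only [Set.mem_insert_iff, Set.mem_singleton_iff, not_or] at ha
  have hasq : a ^ 2 ≠ 1 := fun h => by
    rcases sq_eq_one_iff.1 h with h | h <;> tauto
  have hmem {e : Fin 2 → Fin n} (he : Function.Injective e)
      (x : Matrix.SpecialLinearGroup (Fin 2) k) :
      embedTwo he x ∈ commutator (Matrix.SpecialLinearGroup (Fin n) k) := by
    have hx : x ∈ commutator (Matrix.SpecialLinearGroup (Fin 2) k) := by
      rw [SL2.commutator_eq_top ha.1 hasq]; trivial
    have h2 := Subgroup.mem_map_of_mem (embedTwo he) hx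
    rw [commutator_def, Subgroup.map_commutator] at h2
    exact Subgroup.commutator_mono le_top le_top h2
  have hinj {i j : Fin n} (hij : i ≠ j) : Function.Injective ![i, j] := by
    intro s t
    fin_cases s <;> fin_cases t <;> simp [hij, hij.symm]
  have : Nontrivial (Fin n) := Fin.nontrivial_iff_two_le.2 hn
  rw [eq_top_iff]
  rintro x -
  refine diagonal_transvection_induction' (fun x => x ∈ commutator _) x ?_ ?_ fun _ _ => mul_mem
  · intro i j hij c hc
    convert! hmem (hinj hij) (diag2 c hc)
    apply Subtype.ext
    rw [embedTwo_coe, diag2n_coe]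
    ext s t
    have h00 : (diag2 c hc : Matrix (Fin 2) (Fin 2) k) 0 0 = c := by simp [diag2_coe]
    have h01 : (diag2 c hc : Matrix (Fin 2) (Fin 2) k) 0 1 = 0 := by simp [diag2_coe]
    have h10 : (diag2 c hc : Matrix (Fin 2) (Fin 2) k) 1 0 = 0 := by simp [diag2_coe]
    have h11 : (diag2 c hc : Matrix (Fin 2) (Fin 2) k) 1 1 = c⁻¹ := by simp [diag2_coe]
    simp only [Fin.sum_univ_two, Matrix.sub_apply, h00, h01, h10, h11, Matrix.one_apply_eq]
    rcases eq_or_ne s t with rfl | hst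
    · rcases eq_or_ne s i with rfl | hi
      · simp [hij.symm]
      · rcases eq_or_ne s j with rfl | hj
        · simp [hij, hij.symm]
        · simp [hi, hj, hi.symm, hj.symm]
    · simp [hst, Matrix.single_apply]
      grind
  · intro i j hij c
    convert! hmem (hinj hij) (SpecialLinearGroup.transvection zero_ne_one c)
    apply Subtype.ext
    rw [embedTwo_coe, transvection_coe, transvection_coe]
    ext s t
    simp [Fin.sum_univ_two, Matrix.one_apply, Matrix.single_apply]

end Perfect

section Injectivity

variable {n : ℕ} {k : Type*} [Field k]

theorem mem_sl_iff {x : Matrix (Fin n) (Fin n) k} :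
    x ∈ LieAlgebra.SpecialLinear.sl (Fin n) k ↔ x.trace = 0 := Iff.rfl

/-- Two automorphisms which agree modulo the center of a perfect group are equal. -/
theorem mulEquiv_eq_of_mem_center {G : Type*} [Group G] (hG : commutator G = ⊤) {f g : G ≃* G}
    (h : ∀ x, (g x)⁻¹ * f x ∈ Subgroup.center G) : f = g := by
  have hle : commutator G ≤ MonoidHom.eqLocus (f : G →* G) (g : G →* G) := by
    rw [commutator_def, Subgroup.commutator_le]
    intro x _ y _
    change f _ = g _
    simp only [commutatorElement_def, map_mul, map_inv]
    obtain ⟨z, hz, hx⟩ : ∃ z ∈ Subgroup.center G, f x = g x * z := ⟨_, h x, by group⟩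
    obtain ⟨w, hw, hy⟩ : ∃ z ∈ Subgroup.center G, f y = g y * z := ⟨_, h y, by group⟩
    rw [Subgroup.mem_center_iff] at hz hw
    rw [hx, hy]
    have e1 : g x * z * (g y * w) = g x * g y * (z * w) := by
      rw [mul_assoc, mul_assoc, ← mul_assoc z, ← hz, mul_assoc]
    have e2 : g y * w * (g x * z) = g y * g x * (z * w) := by
      rw [mul_assoc, mul_assoc, ← mul_assoc w, ← hw, mul_assoc, hz w]
    rw [mul_assoc, ← _root_.mul_inv_rev, e1, e2]
    group
  ext x
  exact hle (hG ▸ Subgroup.mem_top x)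

theorem eq_of_isDifferentialOf [Infinite k] (hn : 2 ≤ n)
    {θ₁ θ₂ : Matrix.SpecialLinearGroup (Fin n) k ≃* Matrix.SpecialLinearGroup (Fin n) k}
    {φ : ↥(LieAlgebra.SpecialLinear.sl (Fin n) k) ≃ₗ⁅k⁆
      ↥(LieAlgebra.SpecialLinear.sl (Fin n) k)}
    (h₁ : IsDifferentialOf n k θ₁ φ) (h₂ : IsDifferentialOf n k θ₂ φ) : θ₁ = θ₂ := by
  obtain ⟨P, hP, hPφ⟩ := isDifferentialOf_iff.1 h₁
  obtain ⟨Q, hQ, hQφ⟩ := isDifferentialOf_iff.1 h₂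
  refine mulEquiv_eq_of_mem_center (commutator_specialLinearGroup_eq_top hn) fun g => ?_
  have hcomm (x : Matrix (Fin n) (Fin n) k) (hx : x.trace = 0) :
      Commute x (((θ₂ g)⁻¹ * θ₁ g : Matrix.SpecialLinearGroup (Fin n) k) :
        Matrix (Fin n) (Fin n) k) := by
    obtain ⟨y, hy⟩ := φ.surjective ⟨x, (mem_sl_iff).2 hx⟩
    have hy0 : (y : Matrix (Fin n) (Fin n) k).trace = 0 := (mem_sl_iff).1 y.2
    have hz0 : ((g : Matrix (Fin n) (Fin n) k) * y *
        (g : Matrix (Fin n) (Fin n) k).adjugate).trace = 0 := by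
      rw [Matrix.trace_mul_comm, ← Matrix.mul_assoc, Matrix.adjugate_mul]
      simp [hy0]
    have e1 := hP.diffOne_conj_mul g hy0
    have e2 := hQ.diffOne_conj_mul g hy0
    have hyx : (φ y : Matrix (Fin n) (Fin n) k) = x := congrArg Subtype.val hy
    have hPQ := (hPφ ⟨_, (mem_sl_iff).2 hz0⟩).trans
      (hQφ ⟨_, (mem_sl_iff).2 hz0⟩).symm
    rw [hPφ, hyx] at e1
    rw [hQφ, hyx] at e2
    simp only at hPQ
    rw [hPQ] at e1
    generalize diffOne Q _ = D at e1 e2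
    have hinv : ((θ₂ g)⁻¹ : Matrix.SpecialLinearGroup (Fin n) k) * (θ₂ g : Matrix (Fin n) (Fin n) k)
        = 1 := by
      rw [← Matrix.SpecialLinearGroup.coe_mul, inv_mul_cancel, Matrix.SpecialLinearGroup.coe_one]
    have hinv' : (θ₂ g : Matrix (Fin n) (Fin n) k) *
        ((θ₂ g)⁻¹ : Matrix.SpecialLinearGroup (Fin n) k) = 1 := by
      rw [← Matrix.SpecialLinearGroup.coe_mul, mul_inv_cancel, Matrix.SpecialLinearGroup.coe_one]
    rw [Matrix.SpecialLinearGroup.coe_mul, commute_iff_eq]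
    set B : Matrix (Fin n) (Fin n) k := (θ₂ g : Matrix (Fin n) (Fin n) k)
    set A : Matrix (Fin n) (Fin n) k := (θ₁ g : Matrix (Fin n) (Fin n) k)
    generalize (((θ₂ g)⁻¹ : Matrix.SpecialLinearGroup (Fin n) k) : Matrix (Fin n) (Fin n) k) = B'
      at hinv hinv' ⊢
    calc x * (B' * A) = B' * B * x * B' * A := by rw [hinv]; noncomm_ring
      _ = B' * (B * x) * B' * A := by noncomm_ring
      _ = B' * D * (B * B') * A := by rw [← e2]; noncomm_ring
      _ = B' * (D * A) := by rw [hinv']; noncomm_ring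
      _ = B' * A * x := by rw [e1]; noncomm_ring
  rw [Matrix.SpecialLinearGroup.mem_center_iff]
  obtain ⟨r, hr⟩ := Matrix.mem_range_scalar_of_commute_single (M := (((θ₂ g)⁻¹ * θ₁ g :
    Matrix.SpecialLinearGroup (Fin n) k) : Matrix (Fin n) (Fin n) k)) (fun i j hij =>
      hcomm _ (by simp [hij]))
  refine ⟨r, ?_, hr⟩
  have := ((θ₂ g)⁻¹ * θ₁ g : Matrix.SpecialLinearGroup (Fin n) k).2
  rw [← hr] at this
  simpa using this

end Injectivity

section Automorphism

variable {n : ℕ} {k : Type*} [Field k]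

/-- A linear endomorphism of the space of matrices which restricts to a Lie algebra automorphism
of the trace zero matrices. -/
structure IsTracelessAut (Φ : Matrix (Fin n) (Fin n) k →ₗ[k] Matrix (Fin n) (Fin n) k) :
    Prop where
  trace_map {x : Matrix (Fin n) (Fin n) k} : x.trace = 0 → (Φ x).trace = 0
  eq_zero {x : Matrix (Fin n) (Fin n) k} : x.trace = 0 → Φ x = 0 → x = 0
  exists_map_eq {y : Matrix (Fin n) (Fin n) k} : y.trace = 0 → ∃ x, x.trace = 0 ∧ Φ x = y
  map_lie {x y : Matrix (Fin n) (Fin n) k} : x.trace = 0 → y.trace = 0 →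
    Φ (x * y - y * x) = Φ x * Φ y - Φ y * Φ x

theorem trace_single_of_ne {i j : Fin n} (hij : i ≠ j) :
    (Matrix.single i j (1 : k)).trace = 0 := by
  simp [hij]

variable {Φ : Matrix (Fin n) (Fin n) k →ₗ[k] Matrix (Fin n) (Fin n) k}

theorem IsTracelessAut.map_single_lie (hΦ : IsTracelessAut Φ) {i j l : Fin n} (hij : i ≠ j)
    (hjl : j ≠ l) (hil : i ≠ l) :
    Φ (Matrix.single i j 1) * Φ (Matrix.single j l 1) -
      Φ (Matrix.single j l 1) * Φ (Matrix.single i j 1) = Φ (Matrix.single i l 1) := by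
  rw [← hΦ.map_lie (trace_single_of_ne hij) (trace_single_of_ne hjl)]
  simp [hil.symm]

theorem IsTracelessAut.map_single_lie_symm (hΦ : IsTracelessAut Φ) {i j : Fin n} (hij : i ≠ j) :
    Φ (Matrix.single i j 1) * Φ (Matrix.single j i 1) -
      Φ (Matrix.single j i 1) * Φ (Matrix.single i j 1) =
      Φ (Matrix.single i i 1 - Matrix.single j j 1) := by
  rw [← hΦ.map_lie (trace_single_of_ne hij) (trace_single_of_ne hij.symm)]
  simp

theorem IsTracelessAut.map_single_commute (hΦ : IsTracelessAut Φ) {i j l m : Fin n} (hij : i ≠ j)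
    (hlm : l ≠ m) (hjl : j ≠ l) (him : i ≠ m) :
    Φ (Matrix.single i j 1) * Φ (Matrix.single l m 1) =
      Φ (Matrix.single l m 1) * Φ (Matrix.single i j 1) := by
  rw [← sub_eq_zero, ← hΦ.map_lie (trace_single_of_ne hij) (trace_single_of_ne hlm)]
  simp [hjl, him.symm]

/-- A highest weight vector for the natural module exhibits an automorphism as a conjugation. -/
theorem IsTracelessAut.exists_conj_of_vector (hΦ : IsTracelessAut Φ) (i₀ : Fin n)
    {v : Fin n → k} (hv : v ≠ 0)
    (h1 : ∀ i j, i ≠ j → j ≠ i₀ → Φ (Matrix.single i j 1) *ᵥ v = 0)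
    (h2 : ∀ j, j ≠ i₀ → Φ (Matrix.single i₀ i₀ 1 - Matrix.single j j 1) *ᵥ v = v)
    (h3 : ∀ i j, i ≠ i₀ → j ≠ i₀ → Φ (Matrix.single i i₀ 1) * Φ (Matrix.single j i₀ 1) = 0) :
    ∃ g : Matrix (Fin n) (Fin n) k, g.det ≠ 0 ∧
      ∀ x : Matrix (Fin n) (Fin n) k, x.trace = 0 → Φ x * g = g * x := by
  let w (i : Fin n) : Fin n → k := if i = i₀ then v else Φ (Matrix.single i i₀ 1) *ᵥ v
  have hw₀ : w i₀ = v := if_pos rfl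
  have hw {i : Fin n} (hi : i ≠ i₀) : w i = Φ (Matrix.single i i₀ 1) *ᵥ v := if_neg hi
  have key (i j c : Fin n) (hij : i ≠ j) :
      Φ (Matrix.single i j 1) *ᵥ w c = if c = j then w i else 0 := by
    rcases eq_or_ne c i₀ with rfl | hc
    · rcases eq_or_ne j c with rfl | hj
      · rw [hw₀, hw hij, if_pos rfl]
      · rw [hw₀, if_neg hj.symm, h1 i j hij hj]
    · rcases eq_or_ne j i₀ with rfl | hj
      · rw [hw hc, if_neg hc, Matrix.mulVec_mulVec, h3 i c hij hc, Matrix.zero_mulVec]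
      · have hz : Φ (Matrix.single c i₀ 1) *ᵥ Φ (Matrix.single i j 1) *ᵥ v = 0 := by
          rw [h1 i j hij hj, Matrix.mulVec_zero]
        have hswap : Φ (Matrix.single i j 1) *ᵥ w c =
            (Φ (Matrix.single i j 1) * Φ (Matrix.single c i₀ 1) -
              Φ (Matrix.single c i₀ 1) * Φ (Matrix.single i j 1)) *ᵥ v := by
          rw [hw hc, Matrix.sub_mulVec, ← Matrix.mulVec_mulVec, ← Matrix.mulVec_mulVec, hz,
            sub_zero]
        rw [hswap]
        rcases eq_or_ne c j with rfl | hcj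
        · rw [if_pos rfl]
          rcases eq_or_ne i i₀ with rfl | hi
          · rw [hΦ.map_single_lie_symm hij, h2 c hc, hw₀]
          · rw [hΦ.map_single_lie hij hc hi, hw hi]
        · rw [if_neg hcj]
          rcases eq_or_ne i i₀ with rfl | hi
          · rw [← neg_sub, hΦ.map_single_lie hc hij hcj, Matrix.neg_mulVec, h1 c j hcj hj, neg_zero]
          · rw [hΦ.map_single_commute hij hc hcj.symm hi, sub_self, Matrix.zero_mulVec]
  let g : Matrix (Fin n) (Fin n) k := Matrix.of fun r c => w c r
  have hg (c : Fin n) : g *ᵥ Pi.single c 1 = w c := by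
    ext r
    simp [g]
  have hoff (i j : Fin n) (hij : i ≠ j) :
      Φ (Matrix.single i j 1) * g = g * Matrix.single i j 1 := by
    refine Matrix.ext_of_mulVec_single fun c => ?_
    rw [← Matrix.mulVec_mulVec, hg, key i j c hij, ← Matrix.mulVec_mulVec]
    split_ifs with h
    · subst h
      rw [← hg i]
      congr 1
      ext r
      simp [Matrix.single_apply, Pi.single_apply, eq_comm]
    · have : Matrix.single i j (1 : k) *ᵥ Pi.single c 1 = 0 := by
        ext r
        simp [Ne.symm h]
      rw [this, Matrix.mulVec_zero]
  have hgen (x : Matrix (Fin n) (Fin n) k) (hx : x.trace = 0) : Φ x * g = g * x := by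
    let S : Submodule k (Matrix (Fin n) (Fin n) k) :=
      { carrier := {x | Φ x * g = g * x}
        add_mem' := fun {x y} hx hy => by
          rw [Set.mem_ofPred_eq] at *
          rw [map_add, add_mul, mul_add, hx, hy]
        zero_mem' := by simp
        smul_mem' := fun c x hx => by
          rw [Set.mem_ofPred_eq] at *
          rw [map_smul, Matrix.smul_mul, Matrix.mul_smul, hx] }
    refine mem_of_single_mem (S := S) i₀ hoff (fun i hi => ?_) hx
    change Φ _ * g = g * _
    rw [← hΦ.map_single_lie_symm hi, sub_mul, mul_assoc, mul_assoc, hoff _ _ hi, hoff _ _ hi.symm,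
      ← mul_assoc, ← mul_assoc, hoff _ _ hi, hoff _ _ hi.symm, mul_assoc, mul_assoc, ← mul_sub]
    simp
  refine ⟨g, fun hdet => ?_, hgen⟩
  obtain ⟨u, hu, hgu⟩ := Matrix.exists_mulVec_eq_zero_iff.2 hdet
  have huj (j : Fin n) (hj : j ≠ i₀) : u j = 0 := by
    have h := congrArg (fun y => Φ (Matrix.single i₀ j 1) *ᵥ y) hgu
    simp only [Matrix.mulVec_mulVec, Matrix.mulVec_zero, hoff _ _ hj.symm] at h
    rw [← Matrix.mulVec_mulVec] at h
    have : Matrix.single i₀ j (1 : k) *ᵥ u = u j • Pi.single i₀ 1 := by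
      ext r
      simp [Matrix.single_mulVec, Pi.single_apply, Function.update_apply]
    rw [this, Matrix.mulVec_smul, hg, hw₀] at h
    exact (smul_eq_zero.1 h).resolve_right hv
  have hu' : u = u i₀ • Pi.single i₀ 1 := by
    ext r
    rcases eq_or_ne r i₀ with rfl | hr
    · simp
    · simp [huj r hr, hr]
  rw [hu', Matrix.mulVec_smul, hg, hw₀] at hgu
  refine hu ?_
  rw [hu', (smul_eq_zero.1 hgu).resolve_right hv, zero_smul]

end Automorphism

section RankOne

variable {n : ℕ} {k : Type*} [Field k]

theorem vecMulVec_mulVec_eq_smul (a b w : Fin n → k) :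
    vecMulVec a b *ᵥ w = (b ⬝ᵥ w) • a := by
  rw [Matrix.vecMulVec_mulVec, op_smul_eq_smul]

theorem exists_dotProduct_eq_one {b : Fin n → k} (hb : b ≠ 0) : ∃ w, b ⬝ᵥ w = 1 := by
  obtain ⟨i, hi⟩ := Function.ne_iff.1 hb
  exact ⟨Pi.single i (b i)⁻¹, by simpa using mul_inv_cancel₀ hi⟩

theorem dotProduct_eq_zero_of_vecMulVec_mul_self {a b : Fin n → k} (h0 : vecMulVec a b ≠ 0)
    (h : vecMulVec a b * vecMulVec a b = 0) : b ⬝ᵥ a = 0 := by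
  rw [vecMulVec_mul_vecMulVec, vecMulVec_smul] at h
  exact (smul_eq_zero.1 h).resolve_right h0

theorem mulVec_eq_zero_of_lie_vecMulVec {Y : Matrix (Fin n) (Fin n) k} {a b b' : Fin n → k}
    (ha : a ≠ 0) (hb : b ≠ 0) (hY : Y * Y = 0)
    (h : vecMulVec a b * Y - Y * vecMulVec a b = vecMulVec a b') : Y *ᵥ a = 0 := by
  obtain ⟨w, hw⟩ := exists_dotProduct_eq_one hb
  have h' := congrArg (· *ᵥ w) h
  simp only [Matrix.sub_mulVec, ← Matrix.mulVec_mulVec, vecMulVec_mulVec_eq_smul, hw,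
    one_smul] at h'
  obtain ⟨t, ht⟩ : ∃ t : k, Y *ᵥ a = t • a :=
    ⟨b ⬝ᵥ Y *ᵥ w - b' ⬝ᵥ w, by rw [sub_smul, ← h', sub_sub_cancel]⟩
  have hYY : Y *ᵥ Y *ᵥ a = 0 := by rw [Matrix.mulVec_mulVec, hY, Matrix.zero_mulVec]
  rw [ht, Matrix.mulVec_smul, ht, smul_smul] at hYY
  have : t = 0 := mul_self_eq_zero.1 ((smul_eq_zero.1 hYY).resolve_right ha)
  rw [ht, this, zero_smul]

theorem mulVec_eq_self_of_lie_vecMulVec {F H : Matrix (Fin n) (Fin n) k} {a b b' : Fin n → k}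
    (ha : a ≠ 0) (hba : b ⬝ᵥ a = 0) (hba' : b' ⬝ᵥ a = 0) (hbb' : ∀ c : k, b' ≠ c • b)
    (hH : vecMulVec a b * F - F * vecMulVec a b = H)
    (hHb : H * vecMulVec a b' - vecMulVec a b' * H = vecMulVec a b') : H *ᵥ a = a := by
  obtain ⟨w, hw⟩ := exists_dotProduct_eq_one ha
  have hHa : H *ᵥ a = (b ⬝ᵥ F *ᵥ a) • a := by
    rw [← hH, Matrix.sub_mulVec, ← Matrix.mulVec_mulVec, ← Matrix.mulVec_mulVec,
      vecMulVec_mulVec_eq_smul, vecMulVec_mulVec_eq_smul, hba, zero_smul, Matrix.mulVec_zero,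
      sub_zero]
  have hbH : b' ᵥ* H = -((b' ⬝ᵥ F *ᵥ a) • b) := by
    rw [← hH, Matrix.vecMul_sub, ← Matrix.vecMul_vecMul, ← Matrix.vecMul_vecMul,
      Matrix.vecMul_vecMulVec, Matrix.vecMul_vecMulVec, hba', zero_smul, Matrix.zero_vecMul,
      zero_sub, Matrix.dotProduct_mulVec]
  have hw' : w ⬝ᵥ a = 1 := by rw [dotProduct_comm, hw]
  have h := congrArg (w ᵥ* ·) hHb
  simp only [mul_vecMulVec, vecMulVec_mul, hHa, hbH, Matrix.vecMul_sub, Matrix.vecMul_vecMulVec,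
    dotProduct_smul, hw', one_smul, smul_eq_mul, mul_one, sub_neg_eq_add] at h
  suffices hs : b ⬝ᵥ F *ᵥ a = 1 by rw [hHa, hs, one_smul]
  by_contra hs
  have hs' : 1 - b ⬝ᵥ F *ᵥ a ≠ 0 := sub_ne_zero.2 (Ne.symm hs)
  refine hbb' ((1 - b ⬝ᵥ F *ᵥ a)⁻¹ * b' ⬝ᵥ F *ᵥ a) ?_
  rw [mul_smul, eq_inv_smul_iff₀ hs', sub_smul, one_smul, sub_eq_iff_eq_add', h]

theorem vecMulVec_mul_vecMulVec_eq_zero {a b a' b' : Fin n → k} (h : b ⬝ᵥ a = 0)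
    (hcomm : vecMulVec a b * vecMulVec a' b' = vecMulVec a' b' * vecMulVec a b) :
    vecMulVec a b * vecMulVec a' b' = 0 := by
  by_cases hba : b ⬝ᵥ a' = 0
  · rw [vecMulVec_mul_vecMulVec, hba, zero_smul, vecMulVec_zero]
  · have hb := congrArg (b ᵥ* ·) hcomm
    simp only [vecMulVec_mul_vecMulVec, Matrix.vecMul_vecMulVec, h, zero_smul] at hb
    rw [hcomm, vecMulVec_mul_vecMulVec, (smul_eq_zero.1 hb.symm).resolve_left hba, vecMulVec_zero]

variable {Φ : Matrix (Fin n) (Fin n) k →ₗ[k] Matrix (Fin n) (Fin n) k}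

theorem IsTracelessAut.map_single_ne_zero (hΦ : IsTracelessAut Φ) {i j : Fin n} (hij : i ≠ j) :
    Φ (Matrix.single i j 1) ≠ 0 := fun h => by
  have := hΦ.eq_zero (trace_single_of_ne hij) h
  simpa using congrFun (congrFun this i) j

theorem IsTracelessAut.exists_conj_of_common_column (hΦ : IsTracelessAut Φ) (hn : 3 ≤ n)
    (hrank : ∀ i j, i ≠ j → ∃ a b, Φ (Matrix.single i j 1) = vecMulVec a b)
    (hsq : ∀ i j, i ≠ j → Φ (Matrix.single i j 1) * Φ (Matrix.single i j 1) = 0)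
    (i₀ : Fin n) {a : Fin n → k} (b : Fin n → Fin n → k)
    (hab : ∀ j, j ≠ i₀ → Φ (Matrix.single i₀ j 1) = vecMulVec a (b j)) :
    ∃ g : Matrix (Fin n) (Fin n) k, g.det ≠ 0 ∧
      ∀ x : Matrix (Fin n) (Fin n) k, x.trace = 0 → Φ x * g = g * x := by
  have hne (j : Fin n) (hj : j ≠ i₀) : vecMulVec a (b j) ≠ 0 := by
    rw [← hab j hj]
    exact hΦ.map_single_ne_zero hj.symm
  have ha' (j : Fin n) (hj : j ≠ i₀) : a ≠ 0 := fun h => hne j hj (by rw [h, zero_vecMulVec])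
  have hb (j : Fin n) (hj : j ≠ i₀) : b j ≠ 0 := fun h => hne j hj (by rw [h, vecMulVec_zero])
  have hba (j : Fin n) (hj : j ≠ i₀) : b j ⬝ᵥ a = 0 := by
    refine dotProduct_eq_zero_of_vecMulVec_mul_self (hne j hj) ?_
    rw [← hab j hj, hsq _ _ hj.symm]
  have hthird (i j : Fin n) : ∃ l, l ≠ i ∧ l ≠ j := by
    have : ({i, j} : Finset (Fin n)).card < Fintype.card (Fin n) := by
      rw [Fintype.card_fin]
      exact Finset.card_le_two.trans_lt hn
    obtain ⟨l, hl⟩ := Finset.exists_mem_notMem_of_card_lt_card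
      (this.trans_eq Finset.card_univ.symm)
    exact ⟨l, by simpa using hl⟩
  have ha : a ≠ 0 := by
    obtain ⟨j, hj, -⟩ := hthird i₀ i₀
    exact ha' j hj
  refine hΦ.exists_conj_of_vector i₀ ha (fun i j hij hj => ?_) (fun j hj => ?_)
    (fun i j hi hj => ?_)
  · rcases eq_or_ne i i₀ with rfl | hi
    · rw [hab j hj, vecMulVec_mulVec_eq_smul, hba j hj, zero_smul]
    · refine mulVec_eq_zero_of_lie_vecMulVec ha (hb i hi) (hsq i j hij) (b' := b j) ?_
      rw [← hab i hi, ← hab j hj, hΦ.map_single_lie hi.symm hij hj.symm]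
  · obtain ⟨l, hl, hlj⟩ := hthird i₀ j
    refine mulVec_eq_self_of_lie_vecMulVec (F := Φ (Matrix.single j i₀ 1)) ha (hba j hj) (hba l hl)
      (fun c hc => ?_) ?_ ?_
    · have := hΦ.eq_zero (x := Matrix.single i₀ l 1 - c • Matrix.single i₀ j 1)
        (by simp [hl.symm, hj.symm])
        (by rw [map_sub, map_smul, hab l hl, hab j hj, hc, vecMulVec_smul, sub_self])
      simpa [hlj, hlj.symm, Matrix.single_apply] using congrFun (congrFun this i₀) l
    · rw [← hab j hj, hΦ.map_single_lie_symm hj.symm]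
    · rw [← hab l hl, ← hΦ.map_lie (by simp) (trace_single_of_ne hl.symm)]
      simp [sub_mul, mul_sub, hl, hj, hlj]
  · rcases eq_or_ne i j with rfl | hij
    · exact hsq i i₀ hi
    · obtain ⟨c, d, hcd⟩ := hrank i i₀ hi
      obtain ⟨c', d', hcd'⟩ := hrank j i₀ hj
      have hcomm := hΦ.map_single_commute hi hj hj.symm hi
      have hs := hsq i i₀ hi
      have h0 := hΦ.map_single_ne_zero hi
      rw [hcd] at hs h0 hcomm ⊢
      rw [hcd'] at hcomm ⊢
      exact vecMulVec_mul_vecMulVec_eq_zero (dotProduct_eq_zero_of_vecMulVec_mul_self h0 hs) hcomm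

theorem exists_dotProduct_eq_zero_of_not_parallel {b d : Fin n → k} (hb : b ≠ 0)
    (h : ¬∃ t : k, d = t • b) : ∃ w, b ⬝ᵥ w = 0 ∧ d ⬝ᵥ w ≠ 0 := by
  by_contra! hw
  obtain ⟨u, hu⟩ := exists_dotProduct_eq_one hb
  refine h ⟨d ⬝ᵥ u, dotProduct_eq _ _ fun w => ?_⟩
  have := hw (w - (b ⬝ᵥ w) • u) (by simp [dotProduct_sub, hu])
  rw [dotProduct_sub, dotProduct_smul, sub_eq_zero] at this
  rw [this, smul_dotProduct, smul_eq_mul, smul_eq_mul, mul_comm]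

theorem parallel_or_parallel_of_lie_vecMulVec {a b c d e f : Fin n → k} (hb : b ≠ 0)
    (h : vecMulVec a b * vecMulVec e f - vecMulVec e f * vecMulVec a b = vecMulVec c d) :
    (∃ t : k, c = t • a) ∨ ∃ t : k, d = t • b := by
  by_contra! hcd
  obtain ⟨w, hbw, hdw⟩ := exists_dotProduct_eq_zero_of_not_parallel hb (not_exists.2 hcd.2)
  have hw := congrArg (· *ᵥ w) h
  simp only [Matrix.sub_mulVec, ← Matrix.mulVec_mulVec, vecMulVec_mulVec_eq_smul, hbw, zero_smul,
    Matrix.mulVec_zero, sub_zero] at hw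
  refine hcd.1 ((d ⬝ᵥ w)⁻¹ * b ⬝ᵥ (f ⬝ᵥ w) • e) ?_
  rw [mul_smul, hw, inv_smul_smul₀ hdw]

theorem forall_parallel_or_forall_parallel {ι V : Type*} [AddCommGroup V] [Module k V]
    {a b : ι → V} (ha : ∀ i, a i ≠ 0)
    (h : ∀ i j, i ≠ j → (∃ t : k, a j = t • a i) ∨ ∃ t : k, b j = t • b i) (i : ι) :
    (∀ j, ∃ t : k, a j = t • a i) ∨ ∀ j, ∃ t : k, b j = t • b i := by
  by_contra! hab
  obtain ⟨⟨j, hj⟩, l, hl⟩ := hab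
  have hne {m : ι} (hm : m = i) : (∃ t : k, a m = t • a i) ∧ ∃ t : k, b m = t • b i :=
    ⟨⟨1, by rw [hm, one_smul]⟩, 1, by rw [hm, one_smul]⟩
  have hij : i ≠ j := fun h' => not_exists.2 hj (hne h'.symm).1
  have hil : i ≠ l := fun h' => not_exists.2 hl (hne h'.symm).2
  obtain ⟨s, hs⟩ := (h i j hij).resolve_left (not_exists.2 hj)
  obtain ⟨t, ht⟩ := (h i l hil).resolve_right (not_exists.2 hl)
  have hjl : j ≠ l := fun h' => hl s (h' ▸ hs)
  obtain ⟨u, hu⟩ | ⟨u, hu⟩ := h j l hjl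
  · have hu0 : u ≠ 0 := fun h' => ha l (by rw [hu, h', zero_smul])
    exact hj (u⁻¹ * t) (by rw [mul_smul, ← ht, hu, inv_smul_smul₀ hu0])
  · exact hl (u * s) (by rw [hu, hs, mul_smul])

theorem IsTracelessAut.neg_transpose (hΦ : IsTracelessAut Φ) :
    IsTracelessAut (-((Matrix.transposeLinearEquiv (Fin n) (Fin n) k k).toLinearMap ∘ₗ Φ)) where
  trace_map hx := by simp [hΦ.trace_map hx]
  eq_zero hx h := hΦ.eq_zero hx (by simpa using h)
  exists_map_eq {y} hy := by
    obtain ⟨x, hx, hxy⟩ := hΦ.exists_map_eq (y := -yᵀ) (by simp [hy])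
    exact ⟨x, hx, by simp [hxy]⟩
  map_lie hx hy := by
    simp [hΦ.map_lie hx hy]

/-- If all off-diagonal matrix units are sent to square zero matrices of rank one, then the
automorphism is a conjugation, possibly composed with the negative transpose. -/
theorem IsTracelessAut.exists_conj_or_of_rank_one (hΦ : IsTracelessAut Φ) (hn : 3 ≤ n)
    (hrank : ∀ i j, i ≠ j → ∃ a b, Φ (Matrix.single i j 1) = vecMulVec a b)
    (hsq : ∀ i j, i ≠ j → Φ (Matrix.single i j 1) * Φ (Matrix.single i j 1) = 0) :
    ∃ g : Matrix (Fin n) (Fin n) k, g.det ≠ 0 ∧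
      ((∀ x : Matrix (Fin n) (Fin n) k, x.trace = 0 → Φ x * g = g * x) ∨
        ∀ x : Matrix (Fin n) (Fin n) k, x.trace = 0 → Φ x * g = -(g * xᵀ)) := by
  let i₀ : Fin n := ⟨0, by omega⟩
  let j₀ : Fin n := ⟨1, by omega⟩
  have hj₀ : j₀ ≠ i₀ := by simp [i₀, j₀]
  choose a b hab using fun j : {j : Fin n // j ≠ i₀} => hrank i₀ j j.2.symm
  have hne (j : {j : Fin n // j ≠ i₀}) : vecMulVec (a j) (b j) ≠ 0 := by
    rw [← hab j]
    exact hΦ.map_single_ne_zero j.2.symm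
  have ha (j) : a j ≠ 0 := fun h => hne j (by rw [h, zero_vecMulVec])
  have hb (j) : b j ≠ 0 := fun h => hne j (by rw [h, vecMulVec_zero])
  have hpar (i j) (hij : i ≠ j) : (∃ t : k, a j = t • a i) ∨ ∃ t : k, b j = t • b i := by
    obtain ⟨e, f, hef⟩ := hrank i j (fun h => hij (Subtype.ext h))
    refine parallel_or_parallel_of_lie_vecMulVec (hb i) (e := e) (f := f) ?_
    rw [← hab, ← hab, ← hef, hΦ.map_single_lie i.2.symm (fun h => hij (Subtype.ext h)) j.2.symm]
  rcases forall_parallel_or_forall_parallel ha hpar ⟨j₀, hj₀⟩ with h | h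
  · choose t ht using h
    obtain ⟨g, hg, hΦg⟩ := hΦ.exists_conj_of_common_column hn hrank hsq i₀ (a := a ⟨j₀, hj₀⟩)
      (fun j => if hj : j ≠ i₀ then t ⟨j, hj⟩ • b ⟨j, hj⟩ else 0) (fun j hj => by
        rw [dif_pos hj, hab ⟨j, hj⟩, ht ⟨j, hj⟩, vecMulVec_smul, smul_vecMulVec])
    exact ⟨g, hg, Or.inl hΦg⟩
  · choose t ht using h
    obtain ⟨g, hg, hΦg⟩ := hΦ.neg_transpose.exists_conj_of_common_column hn
      (fun i j hij => by
        obtain ⟨a, b, h⟩ := hrank i j hij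
        exact ⟨-b, a, by simp [h, transpose_vecMulVec]⟩)
      (fun i j hij => by
        simp [← transpose_mul, hsq i j hij]) i₀ (a := b ⟨j₀, hj₀⟩)
      (fun j => if hj : j ≠ i₀ then -(t ⟨j, hj⟩ • a ⟨j, hj⟩) else 0) (fun j hj => by
        have hj' := hab ⟨j, hj⟩
        rw [ht ⟨j, hj⟩] at hj'
        simp [hj, hj', transpose_vecMulVec, vecMulVec_smul])
    refine ⟨(gᵀ)⁻¹, ?_, Or.inr fun x hx => ?_⟩
    · rw [det_nonsing_inv, det_transpose, Ring.inverse_eq_inv']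
      exact inv_ne_zero hg
    · have hu : IsUnit (gᵀ).det := by rw [det_transpose]; exact hg.isUnit
      have h : -(gᵀ * Φ x) = xᵀ * gᵀ := by
        simpa using congrArg Matrix.transpose (hΦg x hx)
      have h' : Φ x = -((gᵀ)⁻¹ * (xᵀ * gᵀ)) := by
        rw [← h, mul_neg, neg_neg, nonsing_inv_mul_cancel_left _ _ hu]
      rw [h', neg_mul, mul_assoc, mul_assoc, mul_nonsing_inv _ hu, mul_one]

end RankOne

section Centralizer

variable {k V : Type*} [Field k] [AddCommGroup V] [Module k V]

/-- The linear subspace of endomorphisms commuting with `f`. -/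
def commutingSubmodule (f : Module.End k V) : Submodule k (Module.End k V) :=
  LinearMap.ker (LinearMap.mulLeft k f - LinearMap.mulRight k f)

theorem mem_commutingSubmodule {f z : Module.End k V} :
    z ∈ commutingSubmodule f ↔ f * z = z * f := by
  simp [commutingSubmodule, sub_eq_zero]

theorem apply_comm_of_mem_commutingSubmodule {f z : Module.End k V}
    (hz : z ∈ commutingSubmodule f) (v : V) : z (f v) = f (z v) :=
  (LinearMap.congr_fun (mem_commutingSubmodule.1 hz) v).symm

theorem commutingSubmodule_sub_smul_one (f : Module.End k V) (c : k) :
    commutingSubmodule (f - c • 1) = commutingSubmodule f := by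
  ext z
  simp [mem_commutingSubmodule, sub_mul, mul_sub]

variable [FiniteDimensional k V]

theorem finrank_commutingSubmodule_le (f : Module.End k V) {ι κ : Type*} [Fintype ι] [Fintype κ]
    (u : ι → V) (w : κ → V) (hw : LinearIndependent k w)
    (hcard : Fintype.card ι + 2 ≤ Fintype.card κ)
    (h : ∀ z ∈ commutingSubmodule f, (∀ i, z (u i) = 0) → ∀ j, z (w j) = 0) :
    Module.finrank k (commutingSubmodule f) ≤
      (Module.finrank k V - 2) * Module.finrank k V := by
  let S := Submodule.span k (Set.range u)
  let T := Submodule.span k (Set.range w)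
  have hS : Module.finrank k S ≤ Fintype.card ι := finrank_range_le_card u
  have hT : Module.finrank k T = Fintype.card κ := finrank_span_eq_card hw
  obtain ⟨Q, hQ⟩ := Submodule.exists_isCompl T
  have hTQ := Submodule.finrank_add_eq_of_isCompl hQ
  have hSQ := Submodule.finrank_add_le_finrank_add_finrank S Q
  let F : commutingSubmodule f →ₗ[k] (↥(S ⊔ Q) →ₗ[k] V) :=
    (LinearMap.lcomp k V (S ⊔ Q).subtype) ∘ₗ (commutingSubmodule f).subtype
  have hF : Function.Injective F := by
    rw [injective_iff_map_eq_zero]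
    intro z hz
    have hz' (v : V) (hv : v ∈ S ⊔ Q) : z.1 v = 0 := LinearMap.congr_fun hz ⟨v, hv⟩
    have hzT : T ≤ LinearMap.ker z.1 := by
      rw [Submodule.span_le]
      rintro _ ⟨j, rfl⟩
      exact h z.1 z.2 (fun i => hz' _ (Submodule.mem_sup_left (Submodule.subset_span ⟨i, rfl⟩))) j
    have hzQ : Q ≤ LinearMap.ker z.1 := fun v hv => hz' v (Submodule.mem_sup_right hv)
    have htop := sup_le hzT hzQ
    rw [hQ.sup_eq_top, top_le_iff, LinearMap.ker_eq_top] at htop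
    exact Subtype.ext htop
  refine (LinearMap.finrank_le_finrank_of_injective hF).trans ?_
  rw [Module.finrank_linearMap]
  exact Nat.mul_le_mul_right _ (by omega)

variable {f : Module.End k V}

theorem apply_apply_mem_span_of_lt_finrank_commutingSubmodule
    (hf : (Module.finrank k V - 2) * Module.finrank k V < Module.finrank k (commutingSubmodule f))
    {v : V} (hv : LinearIndependent k ![v, f v]) :
    f (f v) ∈ Submodule.span k (Set.range ![v, f v]) := by
  by_contra h
  refine hf.not_ge (finrank_commutingSubmodule_le f ![v] (Fin.cons (f (f v)) ![v, f v])
    (linearIndependent_finCons.2 ⟨hv, h⟩) (by simp) fun z hz h0 j => ?_)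
  have hz0 : z v = 0 := h0 0
  have hz1 : z (f v) = 0 := by rw [apply_comm_of_mem_commutingSubmodule hz, hz0, map_zero]
  have hz2 : z (f (f v)) = 0 := by rw [apply_comm_of_mem_commutingSubmodule hz, hz1, map_zero]
  fin_cases j
  exacts [hz2, hz0, hz1]

theorem not_linearIndependent_mk_of_lt_finrank_commutingSubmodule
    (hf : (Module.finrank k V - 2) * Module.finrank k V < Module.finrank k (commutingSubmodule f))
    {v : V} (hv : LinearIndependent k ![v, f v]) (u : V) :
    ¬LinearIndependent k ![(Submodule.span k (Set.range ![v, f v])).mkQ u,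
      (Submodule.span k (Set.range ![v, f v])).mkQ (f u)] := by
  intro hu
  have hvW := linearIndependent_span hv
  have huW : LinearIndependent k
      ((Submodule.span k (Set.range ![v, f v])).mkQ ∘ ![u, f u]) := by
    convert hu using 1
    ext i
    fin_cases i <;> rfl
  refine hf.not_ge (finrank_commutingSubmodule_le f ![v, u] _
    (LinearIndependent.sumElim_of_quotient hvW ![u, f u] huW) (by simp) fun z hz h0 j => ?_)
  have hz0 : z v = 0 := h0 0
  have hz1 : z (f v) = 0 := by rw [apply_comm_of_mem_commutingSubmodule hz, hz0, map_zero]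
  have hz0' : z u = 0 := h0 1
  have hz_one : z (f u) = 0 := by rw [apply_comm_of_mem_commutingSubmodule hz, hz0', map_zero]
  rcases j with j | j <;> fin_cases j
  exacts [hz0, hz1, hz0', hz_one]

/-- An endomorphism with a large centralizer differs from a scalar by an endomorphism of rank at
most one. -/
theorem exists_finrank_range_sub_smul_le_one (hV : 3 ≤ Module.finrank k V)
    (hf : (Module.finrank k V - 2) * Module.finrank k V < Module.finrank k (commutingSubmodule f)) :
    ∃ c : k, Module.finrank k (LinearMap.range (f - c • 1)) ≤ 1 := by
  by_cases hfs : ∀ v, ¬LinearIndependent k ![v, f v]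
  · obtain ⟨c, hc⟩ := LinearMap.exists_eq_smul_id_of_forall_notLinearIndependent hfs
    refine ⟨c, ?_⟩
    rw [sub_eq_zero.2 hc, LinearMap.range_zero, finrank_bot]
    exact zero_le_one
  push Not at hfs
  obtain ⟨v, hv⟩ := hfs
  set W := Submodule.span k (Set.range ![v, f v]) with hWdef
  have hvW : v ∈ W := Submodule.subset_span ⟨0, rfl⟩
  have hfvW : f v ∈ W := Submodule.subset_span ⟨1, rfl⟩
  have hWf : W ≤ W.comap f := by
    conv_lhs => rw [hWdef]
    rw [Submodule.span_le]
    rintro _ ⟨i, rfl⟩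
    fin_cases i
    exacts [hfvW, apply_apply_mem_span_of_lt_finrank_commutingSubmodule hf hv]
  obtain ⟨c, hc⟩ := LinearMap.exists_eq_smul_id_of_forall_notLinearIndependent
    (f := W.mapQ W f hWf) (fun q => by
      obtain ⟨u, rfl⟩ := W.mkQ_surjective q
      exact not_linearIndependent_mk_of_lt_finrank_commutingSubmodule hf hv u)
  refine ⟨c, ?_⟩
  set N := f - c • 1 with hN
  have hNW (u : V) : N u ∈ W := by
    have := LinearMap.congr_fun hc (W.mkQ u)
    rw [← W.ker_mkQ, LinearMap.mem_ker, hN]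
    simpa [sub_eq_zero] using this
  have hvN : LinearIndependent k ![v, N v] := by
    have := (LinearIndependent.pair_add_smul_right_iff (R := k) (x := v) (y := f v) (c := -c)).2 hv
    simpa [hN, sub_eq_neg_add] using this
  have hfN := hf
  rw [← commutingSubmodule_sub_smul_one f c, ← hN] at hfN
  have hWfin : Module.finrank k W = 2 := by simpa using finrank_span_eq_card hv
  have hcoord {x : V} (hx : x ∈ W) : ∃ α β : k, x = α • v + β • N v := by
    obtain ⟨b, a, hab⟩ := Submodule.mem_span_pair.1 (by simpa [hWdef] using hx)
    refine ⟨a + b * c, b, ?_⟩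
    rw [← hab, hN, LinearMap.sub_apply, LinearMap.smul_apply, Module.End.one_apply]
    module
  have hzero {α β : k} (h : α • v + β • N v = 0) : α = 0 ∧ β = 0 :=
    LinearIndependent.pair_iff.1 hvN α β h
  by_contra! hrank
  have hrange : LinearMap.range N = W := by
    refine Submodule.eq_of_le_of_finrank_le ?_ (by omega)
    rintro _ ⟨u, rfl⟩
    exact hNW u
  obtain ⟨u, hu⟩ : v ∈ LinearMap.range N := hrange ▸ hvW
  have hker : LinearMap.ker N ≠ ⊥ := by
    have := LinearMap.finrank_range_add_finrank_ker N
    rw [hrange, hWfin] at this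
    exact Submodule.one_le_finrank_iff.1 (by omega)
  obtain ⟨q, hqN, hq⟩ := Submodule.exists_mem_ne_zero_of_ne_bot hker
  rw [LinearMap.mem_ker] at hqN
  obtain ⟨u', hu'W, hu'⟩ : ∃ u' ∉ W, N u' = v := by
    by_cases huW : u ∈ W
    · refine ⟨u + q, fun huq => ?_, by rw [map_add, hu, hqN, add_zero]⟩
      obtain ⟨a, b, hab⟩ := hcoord huW
      obtain ⟨r, s, hrs⟩ := hcoord ((Submodule.add_mem_iff_right W huW).1 huq)
      obtain ⟨m, l, hml⟩ := hcoord (hNW (N v))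
      have h1 : (b * m - 1) • v + (a + b * l) • N v = 0 := by
        have := congrArg N hab
        rw [hu, map_add, map_smul, map_smul, hml] at this
        linear_combination (norm := module) -this
      have h2 : (s * m) • v + (r + s * l) • N v = 0 := by
        have := congrArg N hrs
        rw [hqN, map_add, map_smul, map_smul, hml] at this
        linear_combination (norm := module) -this
      have hbm := (hzero h1).1
      have hm : m ≠ 0 := by
        rintro rfl
        simp at hbm
      obtain ⟨hs, hr⟩ := hzero h2
      have hs0 : s = 0 := (mul_eq_zero.1 hs).resolve_right hm
      have hr0 : r = 0 := by simpa [hs0] using hr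
      exact hq (by rw [hrs, hr0, hs0, zero_smul, zero_smul, add_zero])
    · exact ⟨u, huW, hu⟩
  have hv0 : v ≠ 0 := hv.ne_zero 0
  have hli : LinearIndependent k ![u', N u'] := by
    rw [hu', LinearIndependent.pair_symm_iff, LinearIndependent.pair_iff' hv0]
    rintro a rfl
    exact hu'W (W.smul_mem a hvW)
  have hmem := apply_apply_mem_span_of_lt_finrank_commutingSubmodule hfN hli
  rw [hu'] at hmem
  obtain ⟨b, a, hab⟩ := Submodule.mem_span_pair.1 (by simpa using hmem)
  by_cases ha : a = 0
  · rw [ha, zero_smul, add_zero] at hab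
    have := (hzero (α := b) (β := -1) (by rw [hab]; module)).2
    simp at this
  · refine hu'W ?_
    rw [← W.smul_mem_iff ha, eq_sub_of_add_eq' hab]
    exact W.sub_mem (hNW v) (W.smul_mem b hvW)

end Centralizer

section MatrixUnits

variable {n : ℕ} {k : Type*} [Field k]

theorem exists_eq_smul_one_add_vecMulVec (hn : 3 ≤ n) {y : Matrix (Fin n) (Fin n) k}
    (hy : (n - 2) * n < Module.finrank k (commutingSubmodule (Matrix.toLin' y))) :
    ∃ (c : k) (a b : Fin n → k), y = c • 1 + vecMulVec a b := by
  obtain ⟨c, hc⟩ := exists_finrank_range_sub_smul_le_one (f := Matrix.toLin' y)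
    (by simpa using hn) (by simpa using hy)
  obtain ⟨⟨a, _⟩, ha⟩ := finrank_le_one_iff.1 hc
  choose b hb using fun j => ha ⟨_, LinearMap.mem_range_self _ (Pi.single j 1)⟩
  refine ⟨c, a, b, ?_⟩
  ext i j
  have := congrFun (congrArg Subtype.val (hb j)) i
  simp only [SetLike.mk_smul_mk, Pi.smul_apply, smul_eq_mul, LinearMap.sub_apply,
    Matrix.toLin'_apply, LinearMap.smul_apply, Module.End.one_apply, Pi.sub_apply] at this
  rw [Matrix.add_apply, vecMulVec_apply, mul_comm (a i), this]
  simp [Matrix.one_apply, Pi.single_apply]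

theorem le_finrank_traceless_commuting_single {i j : Fin n} (hij : i ≠ j)
    (S : Submodule k (Matrix (Fin n) (Fin n) k))
    (hS : ∀ z : Matrix (Fin n) (Fin n) k, z.trace = 0 →
      Matrix.single i j 1 * z = z * Matrix.single i j 1 → z ∈ S) :
    n * n ≤ Module.finrank k S + (n + (n - 1)) := by
  let L : Matrix (Fin n) (Fin n) k →ₗ[k] (Fin n → k) × ({c : Fin n // c ≠ j} → k) :=
    { toFun := fun z => (fun r => z r i - if r = i then z j j else 0,
        fun c => if c.1 = i then z.trace else z j c)
      map_add' := fun z z' => by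
        ext c
        · by_cases h : c = i
          · simp only [h, if_true, Matrix.add_apply, Prod.fst_add, Pi.add_apply]
            ring
          · simp [h]
        · by_cases h : c.1 = i <;> simp [h]
      map_smul' := fun t z => by
        ext c
        · by_cases h : c = i
          · simp [h, mul_sub]
          · simp [h]
        · by_cases h : c.1 = i <;> simp [h] }
  have hL : LinearMap.ker L ≤ S := by
    intro z hz
    rw [LinearMap.mem_ker] at hz
    have h1 (r : Fin n) : z r i - (if r = i then z j j else 0) = 0 :=
      congrFun (congrArg Prod.fst hz) r
    have h2 (c : {c : Fin n // c ≠ j}) : (if c.1 = i then z.trace else z j c) = 0 :=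
      congrFun (congrArg Prod.snd hz) c
    refine hS z (by simpa using h2 ⟨i, hij⟩) ?_
    have hcol (r : Fin n) : z r i = if r = i then z j j else 0 := sub_eq_zero.1 (h1 r)
    have hrow (c : Fin n) : z j c = if c = j then z j j else 0 := by
      rcases eq_or_ne c j with rfl | hc
      · simp
      · rcases eq_or_ne c i with rfl | hci
        · rw [hcol, if_neg hij.symm, if_neg hij]
        · simpa [hc, hci] using h2 ⟨c, hc⟩
    generalize z j j = d at hcol hrow
    ext r c
    by_cases hr : r = i <;> by_cases hc : c = j <;> simp [hr, hc, hcol, hrow]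
  have hdim := LinearMap.finrank_range_add_finrank_ker L
  have hrange : Module.finrank k (LinearMap.range L) ≤ n + (n - 1) := by
    refine (Submodule.finrank_le _).trans_eq ?_
    simp
  have := Submodule.finrank_mono hL
  simp only [Module.finrank_matrix, Fintype.card_fin, Module.finrank_self, mul_one] at hdim
  omega

theorem exists_ne_zero_dotProduct_pair_eq_zero (hn : 3 ≤ n) (b b' : Fin n → k) :
    ∃ w, w ≠ 0 ∧ b ⬝ᵥ w = 0 ∧ b' ⬝ᵥ w = 0 := by
  obtain ⟨w, hw, hw0⟩ := Submodule.exists_mem_ne_zero_of_ne_bot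
    (LinearMap.ker_ne_bot_of_finrank_lt (f := Matrix.mulVecLin (Matrix.of ![b, b']))
      (by simpa using Nat.lt_of_succ_le hn))
  refine ⟨w, hw0, ?_, ?_⟩
  · simpa using congrFun hw 0
  · simpa using congrFun hw 1

variable {Φ : Matrix (Fin n) (Fin n) k →ₗ[k] Matrix (Fin n) (Fin n) k}

theorem IsTracelessAut.lt_finrank_commutingSubmodule (hΦ : IsTracelessAut Φ) (hn : 3 ≤ n)
    {i j : Fin n} (hij : i ≠ j) :
    (n - 2) * n <
      Module.finrank k (commutingSubmodule (Matrix.toLin' (Φ (Matrix.single i j 1)))) := by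
  let S : Submodule k (Matrix (Fin n) (Fin n) k) :=
    LinearMap.ker (Matrix.traceLinearMap (Fin n) k k) ⊓
      (commutingSubmodule (Matrix.toLin' (Φ (Matrix.single i j 1)))).comap
        ((Matrix.toLin' (R := k)).toLinearMap ∘ₗ Φ)
  have hS := le_finrank_traceless_commuting_single hij S fun z hz hcomm => by
    refine ⟨hz, ?_⟩
    change Matrix.toLin' (Φ z) ∈ commutingSubmodule _
    rw [mem_commutingSubmodule, Module.End.mul_eq_comp, Module.End.mul_eq_comp,
      ← Matrix.toLin'_mul, ← Matrix.toLin'_mul]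
    congr 1
    rw [← sub_eq_zero, ← hΦ.map_lie (trace_single_of_ne hij) hz, hcomm, sub_self, map_zero]
  let F : S →ₗ[k] commutingSubmodule (Matrix.toLin' (Φ (Matrix.single i j 1))) :=
    ((Matrix.toLin' (R := k)).toLinearMap ∘ₗ Φ).restrict fun z hz => hz.2
  have hF : Function.Injective F := by
    rw [injective_iff_map_eq_zero]
    intro z hz
    have : Matrix.toLin' (Φ z.1) = 0 := congrArg Subtype.val hz
    exact Subtype.ext (hΦ.eq_zero z.2.1 (Matrix.toLin'.map_eq_zero_iff.1 this))
  have := LinearMap.finrank_le_finrank_of_injective hF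
  obtain ⟨m, rfl⟩ := Nat.exists_eq_add_of_le' hn
  have h1 : (m + 3 - 2) * (m + 3) = m * m + 4 * m + 3 := by
    rw [show m + 3 - 2 = m + 1 by omega]
    ring
  have h2 : (m + 3) * (m + 3) = m * m + 6 * m + 9 := by ring
  omega

theorem IsTracelessAut.exists_map_single_eq_vecMulVec (hΦ : IsTracelessAut Φ) (hn : 3 ≤ n)
    {i j : Fin n} (hij : i ≠ j) :
    ∃ a b, Φ (Matrix.single i j 1) = vecMulVec a b := by
  obtain ⟨c, a, b, h⟩ := exists_eq_smul_one_add_vecMulVec hn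
    (hΦ.lt_finrank_commutingSubmodule hn hij)
  obtain ⟨l, hl⟩ : ∃ l, l ∉ ({i, j} : Finset (Fin n)) := by
    by_contra! hl
    have := Finset.card_le_card (fun l _ => hl l : Finset.univ ⊆ ({i, j} : Finset (Fin n)))
    rw [Finset.card_univ, Fintype.card_fin] at this
    exact absurd (this.trans Finset.card_le_two) (by omega)
  simp only [Finset.mem_insert, Finset.mem_singleton, not_or] at hl
  obtain ⟨hli, hlj⟩ := hl
  have hlie := hΦ.map_lie (x := Matrix.single i i 1 - Matrix.single l l 1) (by simp)
    (trace_single_of_ne hij)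
  rw [show (Matrix.single i i 1 - Matrix.single l l 1) * Matrix.single i j (1 : k) -
      Matrix.single i j 1 * (Matrix.single i i 1 - Matrix.single l l 1) = Matrix.single i j 1 by
    simp [sub_mul, mul_sub, hij.symm, hli, Ne.symm hlj], h] at hlie
  set Z := Φ (Matrix.single i i 1 - Matrix.single l l 1)
  obtain ⟨w, hw, hbw, hZw⟩ := exists_ne_zero_dotProduct_pair_eq_zero hn b (b ᵥ* Z)
  have hc := congrArg (· *ᵥ w) hlie
  simp only [add_mul, mul_add, Matrix.sub_mulVec, Matrix.add_mulVec, ← Matrix.mulVec_mulVec,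
    vecMulVec_mulVec_eq_smul, hbw, zero_smul, Matrix.mulVec_zero, add_zero, Matrix.smul_mulVec,
    Matrix.one_mulVec, Matrix.mulVec_smul, Matrix.dotProduct_mulVec, hZw, sub_self] at hc
  have hc0 : c = 0 := (smul_eq_zero.1 hc).resolve_right hw
  exact ⟨a, b, by rw [h, hc0, zero_smul, zero_add]⟩

theorem IsTracelessAut.exists_conj_or_of_three_le (hΦ : IsTracelessAut Φ) (hn : 3 ≤ n) :
    ∃ g : Matrix (Fin n) (Fin n) k, g.det ≠ 0 ∧
      ((∀ x : Matrix (Fin n) (Fin n) k, x.trace = 0 → Φ x * g = g * x) ∨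
        ∀ x : Matrix (Fin n) (Fin n) k, x.trace = 0 → Φ x * g = -(g * xᵀ)) := by
  refine hΦ.exists_conj_or_of_rank_one hn
    (fun i j hij => hΦ.exists_map_single_eq_vecMulVec hn hij) (fun i j hij => ?_)
  obtain ⟨a, b, h⟩ := hΦ.exists_map_single_eq_vecMulVec hn hij
  have htr := hΦ.trace_map (trace_single_of_ne hij)
  rw [h, trace_vecMulVec, dotProduct_comm] at htr
  rw [h, vecMulVec_mul_vecMulVec, htr, zero_smul, vecMulVec_zero]

end MatrixUnits

section TwoByTwo

variable {k : Type*} [Field k]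

theorem exists_eq_vecMulVec_of_det_eq_zero {A : Matrix (Fin 2) (Fin 2) k} (hA : A.det = 0) :
    ∃ a b, A = vecMulVec a b := by
  rw [Matrix.det_fin_two] at hA
  by_cases h00 : A 0 0 = 0
  · by_cases h01 : A 0 1 = 0
    · refine ⟨![0, 1], A 1, ?_⟩
      ext i j
      fin_cases i <;> fin_cases j <;> simp [vecMulVec_apply, h00, h01]
    · have h10 : A 1 0 = 0 := by simpa [h00, h01] using hA
      refine ⟨![1, A 1 1 / A 0 1], A 0, ?_⟩
      ext i j
      fin_cases i <;> fin_cases j <;> simp [vecMulVec_apply, h00, h10, h01]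
  · refine ⟨![1, A 1 0 / A 0 0], A 0, ?_⟩
    ext i j
    fin_cases i <;> fin_cases j <;> simp [vecMulVec_apply, h00]
    field_simp
    linear_combination hA

theorem mul_self_eq_smul_one_of_trace_eq_zero {A : Matrix (Fin 2) (Fin 2) k} (hA : A.trace = 0) :
    A * A = (-A.det) • 1 := by
  rw [Matrix.trace_fin_two] at hA
  ext i j
  fin_cases i <;> fin_cases j <;>
    simp only [Matrix.mul_apply, Fin.sum_univ_two, Matrix.det_fin_two, Matrix.smul_apply,
      Fin.zero_eta, Fin.mk_one, Matrix.one_apply_eq, Fin.isValue, smul_eq_mul, ne_eq, zero_ne_one,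
      one_ne_zero, not_false_eq_true, Matrix.one_apply_ne]
  · linear_combination A 0 0 * hA
  · linear_combination A 0 1 * hA
  · linear_combination A 1 0 * hA
  · linear_combination A 1 1 * hA

theorem mul_self_eq_zero_of_lie_eq_smul {A H : Matrix (Fin 2) (Fin 2) k} (hA : A.trace = 0) {c : k}
    (hc : 2 * c ≠ 0) (h : H * A - A * H = c • A) : A * A = 0 := by
  have hs := mul_self_eq_smul_one_of_trace_eq_zero hA
  have h1 : (2 * c) • (A * A) = H * (A * A) - (A * A) * H := by
    have : (2 * c) • (A * A) = (c • A) * A + A * (c • A) := by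
      rw [Matrix.smul_mul, Matrix.mul_smul, ← two_smul k (c • (A * A)), smul_smul]
    rw [this, ← h]
    noncomm_ring
  rw [hs, Matrix.smul_mul, Matrix.mul_smul, mul_one, one_mul, sub_self] at h1
  rw [hs]
  exact (smul_eq_zero.1 h1).resolve_left hc

variable {Φ : Matrix (Fin 2) (Fin 2) k →ₗ[k] Matrix (Fin 2) (Fin 2) k}

theorem IsTracelessAut.exists_conj_two (hΦ : IsTracelessAut Φ)
    (hsq : (2 : k) = 0 → ∀ x ∈ ({Matrix.single 0 1 1, Matrix.single 1 0 1, !![1, -1; 1, -1]} :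
      Set (Matrix (Fin 2) (Fin 2) k)), Φ x * Φ x = 0) :
    ∃ g : Matrix (Fin 2) (Fin 2) k, g.det ≠ 0 ∧
      ∀ x : Matrix (Fin 2) (Fin 2) k, x.trace = 0 → Φ x * g = g * x := by
  have h01 : (0 : Fin 2) ≠ 1 := by decide
  have hHdef := hΦ.map_single_lie_symm h01
  have hHA := hΦ.map_lie (x := Matrix.single 0 0 1 - Matrix.single 1 1 1) (by simp)
    (trace_single_of_ne h01)
  have hHB := hΦ.map_lie (x := Matrix.single 0 0 1 - Matrix.single 1 1 1) (by simp)
    (trace_single_of_ne h01.symm)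
  rw [show (Matrix.single 0 0 1 - Matrix.single 1 1 1) *
      Matrix.single (0 : Fin 2) (1 : Fin 2) (1 : k) -
        Matrix.single 0 1 1 * (Matrix.single 0 0 1 - Matrix.single 1 1 1) =
        (2 : k) • Matrix.single 0 1 1 by simp [sub_mul, mul_sub, two_smul], map_smul] at hHA
  rw [show (Matrix.single 0 0 1 - Matrix.single 1 1 1) *
      Matrix.single (1 : Fin 2) (0 : Fin 2) (1 : k) -
        Matrix.single 1 0 1 * (Matrix.single 0 0 1 - Matrix.single 1 1 1) =
        (-2 : k) • Matrix.single 1 0 1 by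
    simp [sub_mul, mul_sub, two_smul, neg_smul, ← sub_eq_add_neg], map_smul] at hHB
  have hA0 := hΦ.map_single_ne_zero h01
  have hAtr := hΦ.trace_map (trace_single_of_ne h01)
  have hBtr := hΦ.trace_map (trace_single_of_ne h01.symm)
  have hAB : Φ (Matrix.single 0 1 1) * Φ (Matrix.single 0 1 1) = 0 ∧
      Φ (Matrix.single 1 0 1) * Φ (Matrix.single 1 0 1) = 0 := by
    by_cases h2 : (2 : k) = 0
    · exact ⟨hsq h2 _ (by simp), hsq h2 _ (by simp)⟩
    · exact ⟨mul_self_eq_zero_of_lie_eq_smul hAtr (mul_ne_zero h2 h2) hHA.symm,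
        mul_self_eq_zero_of_lie_eq_smul hBtr (mul_ne_zero h2 (neg_ne_zero.2 h2)) hHB.symm⟩
  obtain ⟨a, b, hab⟩ := exists_eq_vecMulVec_of_det_eq_zero (A := Φ (Matrix.single 0 1 1)) (by
    have := congrArg Matrix.det hAB.1
    rw [Matrix.det_mul] at this
    simpa using this)
  have hba : b ⬝ᵥ a = 0 :=
    dotProduct_eq_zero_of_vecMulVec_mul_self (hab ▸ hA0) (hab ▸ hAB.1)
  have ha : a ≠ 0 := by
    rintro rfl
    exact hA0 (by rw [hab, zero_vecMulVec])
  set A := Φ (Matrix.single 0 1 1)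
  set B := Φ (Matrix.single 1 0 1)
  set H := Φ (Matrix.single 0 0 1 - Matrix.single 1 1 1)
  have hAa : A *ᵥ a = 0 := by rw [hab, vecMulVec_mulVec_eq_smul, hba, zero_smul]
  have hHa : H *ᵥ a = a := by
    by_cases h2 : (2 : k) = 0
    · have hone : Matrix.single 0 0 1 - Matrix.single 1 1 1 = (1 : Matrix (Fin 2) (Fin 2) k) := by
        ext i j
        fin_cases i <;> fin_cases j <;> simp
        linear_combination -h2
      have hcomm (y : Matrix (Fin 2) (Fin 2) k) (hy : y.trace = 0) : H * y = y * H := by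
        obtain ⟨x, hx, rfl⟩ := hΦ.exists_map_eq hy
        rw [← sub_eq_zero, ← hΦ.map_lie (by simp) hx, hone]
        simp
      have hHs : H = H 0 0 • 1 := by
        have e1 := hcomm _ (trace_single_of_ne h01)
        have e2 := hcomm _ (trace_single_of_ne h01.symm)
        have e3 := congrFun (congrFun e1 0) 1
        have e4 := congrFun (congrFun e1 1) 1
        have e5 := congrFun (congrFun e2 0) 0
        simp at e3 e4 e5
        ext i j
        fin_cases i <;> fin_cases j <;> simp [e3, e4, e5]
      have hs0 : H 0 0 ≠ 0 := by
        intro h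
        rw [h, zero_smul] at hHs
        have := hΦ.eq_zero (by simp) hHs
        rw [hone] at this
        exact one_ne_zero this
      have hE : Φ !![1, -1; 1, -1] = H + B - A := by
        rw [← map_add, ← map_sub]
        congr 1
        ext i j
        fin_cases i <;> fin_cases j <;> simp
      have hE2 := hsq h2 !![1, -1; 1, -1] (by simp)
      generalize H 0 0 = s at hHs hs0
      have hss : (s * s - s) • (1 : Matrix (Fin 2) (Fin 2) k) = 0 := by
        have : (H + B - A) * (H + B - A) = H * H - H + (H * B + B * H) - (H * A + A * H) -
            (B * A + B * A) + A * A + B * B := by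
          conv_rhs => rw [← hHdef]
          conv_lhs => rw [← hHdef]
          noncomm_ring
        have h2' (M : Matrix (Fin 2) (Fin 2) k) : M + M = 0 := by rw [← two_smul k, h2, zero_smul]
        rw [hE, this, hAB.1, hAB.2, hHs] at hE2
        simpa [h2', sub_smul, mul_smul] using hE2
      have hs1 : s = 1 := by
        have := (smul_eq_zero.1 hss).resolve_right one_ne_zero
        exact mul_left_cancel₀ hs0 (by linear_combination this)
      rw [hHs, hs1, one_smul, Matrix.one_mulVec]
    · have hHa : H *ᵥ a = (b ⬝ᵥ B *ᵥ a) • a := by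
        rw [← hHdef, Matrix.sub_mulVec, ← Matrix.mulVec_mulVec, ← Matrix.mulVec_mulVec, hAa,
          Matrix.mulVec_zero, sub_zero, hab, vecMulVec_mulVec_eq_smul]
      have hbH : b ᵥ* H = -((b ⬝ᵥ B *ᵥ a) • b) := by
        rw [← hHdef, hab, Matrix.vecMul_sub, ← Matrix.vecMul_vecMul, ← Matrix.vecMul_vecMul,
          Matrix.vecMul_vecMulVec, Matrix.vecMul_vecMulVec, hba, zero_smul, Matrix.zero_vecMul,
          zero_sub, Matrix.dotProduct_mulVec]
      have hs : ((2 : k) * (b ⬝ᵥ B *ᵥ a - 1)) • A = 0 := by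
        have : H * A - A * H = (2 * (b ⬝ᵥ B *ᵥ a)) • A := by
          rw [hab, mul_vecMulVec, vecMulVec_mul, hHa, hbH, smul_vecMulVec, vecMulVec_neg,
            vecMulVec_smul, sub_neg_eq_add, ← two_smul k, smul_smul]
        rw [mul_sub, mul_one, sub_smul, ← this, ← hHA, sub_self]
      have hs1 := (mul_eq_zero.1 ((smul_eq_zero.1 hs).resolve_right hA0)).resolve_left h2
      rw [hHa, sub_eq_zero.1 hs1, one_smul]
  refine hΦ.exists_conj_of_vector 0 ha (fun i j hij hj => ?_) (fun j hj => ?_) fun i j hi hj => ?_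
  · obtain rfl : j = 1 := by omega
    obtain rfl : i = 0 := by omega
    exact hAa
  · obtain rfl : j = 1 := by omega
    exact hHa
  · obtain rfl : j = 1 := by omega
    obtain rfl : i = 1 := by omega
    exact hAB.2

end TwoByTwo

section Classification

variable {n : ℕ} {k : Type*} [Field k]
  {Φ : Matrix (Fin n) (Fin n) k →ₗ[k] Matrix (Fin n) (Fin n) k}

/-- Automorphisms of the traceless matrices are conjugations, possibly composed with the negative
transpose; for `n = 2` in characteristic two, they have to preserve the square zero matrices. -/
theorem IsTracelessAut.exists_conj_or (hΦ : IsTracelessAut Φ) (hn : 2 ≤ n)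
    (hsq : n = 2 → (2 : k) = 0 → ∀ x : Matrix (Fin n) (Fin n) k,
      x.trace = 0 → x * x = 0 → Φ x * Φ x = 0) :
    ∃ g : Matrix (Fin n) (Fin n) k, g.det ≠ 0 ∧
      ((∀ x : Matrix (Fin n) (Fin n) k, x.trace = 0 → Φ x * g = g * x) ∨
        ∀ x : Matrix (Fin n) (Fin n) k, x.trace = 0 → Φ x * g = -(g * xᵀ)) := by
  rcases hn.eq_or_lt with rfl | hn3
  · obtain ⟨g, hg, h⟩ := hΦ.exists_conj_two fun h2 x hx => by
      refine hsq rfl h2 x ?_ ?_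
      · rcases hx with rfl | rfl | rfl <;> simp [Matrix.trace_fin_two]
      · rcases hx with rfl | rfl | rfl <;> ext i j <;> fin_cases i <;> fin_cases j <;> simp
    exact ⟨g, hg, Or.inl h⟩
  · exact hΦ.exists_conj_or_of_three_le hn3

theorem neg_pow_of_two_eq_zero_or_odd {R : Type*} [Ring R] {p : ℕ} (hp : (2 : R) = 0 ∨ Odd p)
    (x : R) : (-x) ^ p = -x ^ p := by
  rcases hp with h2 | hp
  · have h (y : R) : -y = y := by rw [neg_eq_iff_add_eq_zero, ← two_mul, h2, zero_mul]
    rw [h, h]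
  · exact hp.neg_pow x

theorem map_pow_ringChar_of_conj_or (hn : 2 ≤ n) {g : Matrix (Fin n) (Fin n) k} (hg : g.det ≠ 0)
    (h : (∀ x : Matrix (Fin n) (Fin n) k, x.trace = 0 → Φ x * g = g * x) ∨
        ∀ x : Matrix (Fin n) (Fin n) k, x.trace = 0 → Φ x * g = -(g * xᵀ))
    {x : Matrix (Fin n) (Fin n) k} (hx : x.trace = 0) (hxp : (x ^ ringChar k).trace = 0) :
    Φ (x ^ ringChar k) = Φ x ^ ringChar k := by
  have hgu : IsUnit g := (Matrix.isUnit_iff_isUnit_det g).2 hg.isUnit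
  refine hgu.mul_right_cancel ?_
  rcases h with h | h
  · rw [h _ hxp]
    exact SemiconjBy.pow_right (h x hx).symm _
  · have hp : (2 : Matrix (Fin n) (Fin n) k) = 0 ∨ Odd (ringChar k) := by
      rcases CharP.char_is_prime_or_zero k (ringChar k) with hp | hp
      · rcases hp.eq_two_or_odd' with h2 | h2
        · have : (2 : k) = 0 := by
            have := CharP.cast_eq_zero k (ringChar k)
            rwa [h2] at this
          left
          rw [← one_add_one_eq_two, ← two_smul k, this, zero_smul]
        · exact Or.inr h2
      · rw [hp, pow_zero, Matrix.trace_one, Fintype.card_fin] at hxp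
        have := (CharP.cast_eq_zero_iff k (ringChar k) n).1 hxp
        rw [hp, zero_dvd_iff] at this
        omega
    have hs : SemiconjBy g (-xᵀ) (Φ x) := by
      rw [SemiconjBy, h x hx, mul_neg]
    have hs' := hs.pow_right (ringChar k)
    rw [neg_pow_of_two_eq_zero_or_odd hp, ← Matrix.transpose_pow, SemiconjBy, mul_neg] at hs'
    rw [h _ hxp, hs']

theorem exists_isTracelessAut_of_lieEquiv (φ : ↥(LieAlgebra.SpecialLinear.sl (Fin n) k) ≃ₗ⁅k⁆
      ↥(LieAlgebra.SpecialLinear.sl (Fin n) k)) :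
    ∃ Φ : Matrix (Fin n) (Fin n) k →ₗ[k] Matrix (Fin n) (Fin n) k, IsTracelessAut Φ ∧
      ∀ x : ↥(LieAlgebra.SpecialLinear.sl (Fin n) k),
        Φ x = (φ x : Matrix (Fin n) (Fin n) k) := by
  obtain ⟨Φ, hΦ⟩ := LinearMap.exists_extend
    (p := LinearMap.ker (Matrix.traceLinearMap (Fin n) k k))
    { toFun := fun x => (φ ⟨x, x.2⟩ : Matrix (Fin n) (Fin n) k)
      map_add' := fun x y => congrArg Subtype.val (map_add φ ⟨x, x.2⟩ ⟨y, y.2⟩)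
      map_smul' := fun c x => congrArg Subtype.val (map_smul φ c ⟨x, x.2⟩) }
  have hΦ' (x : ↥(LieAlgebra.SpecialLinear.sl (Fin n) k)) :
      Φ x = (φ x : Matrix (Fin n) (Fin n) k) := LinearMap.congr_fun hΦ ⟨x, x.2⟩
  have hΦx {x : Matrix (Fin n) (Fin n) k} (hx : x.trace = 0) :
      Φ x = (φ ⟨x, mem_sl_iff.2 hx⟩ : Matrix (Fin n) (Fin n) k) := hΦ' ⟨x, mem_sl_iff.2 hx⟩
  refine ⟨Φ, ⟨fun hx => ?_, fun {x} hx h0 => ?_, fun {y} hy => ?_, fun {x y} hx hy => ?_⟩, hΦ'⟩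
  · rw [hΦx hx]
    exact mem_sl_iff.1 (φ _).2
  · rw [hΦx hx] at h0
    have := φ.injective (a₁ := ⟨x, mem_sl_iff.2 hx⟩) (a₂ := 0) (by
      rw [map_zero]; exact Subtype.ext h0)
    exact congrArg Subtype.val this
  · refine ⟨φ.symm ⟨y, mem_sl_iff.2 hy⟩, mem_sl_iff.1 (φ.symm _).2, ?_⟩
    rw [hΦ', LieEquiv.apply_symm_apply]
  · rw [hΦx hx, hΦx hy]
    exact (hΦ' ⁅⟨x, mem_sl_iff.2 hx⟩, ⟨y, mem_sl_iff.2 hy⟩⁆).trans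
      (congrArg Subtype.val (φ.toLieHom.map_lie _ _))

/-- A Lie algebra automorphism of `𝔰𝔩(n,k)` preserving, if `n = 2` in characteristic two, the
square zero matrices is restricted. -/
theorem IsTracelessAut.isRestrictedAut (hΦ : IsTracelessAut Φ) (hn : 2 ≤ n)
    (hsq : n = 2 → (2 : k) = 0 → ∀ x : Matrix (Fin n) (Fin n) k,
      x.trace = 0 → x * x = 0 → Φ x * Φ x = 0)
    {φ : ↥(LieAlgebra.SpecialLinear.sl (Fin n) k) ≃ₗ⁅k⁆
      ↥(LieAlgebra.SpecialLinear.sl (Fin n) k)}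
    (hφ : ∀ x : ↥(LieAlgebra.SpecialLinear.sl (Fin n) k),
      Φ x = (φ x : Matrix (Fin n) (Fin n) k)) : IsRestrictedAut n k φ := by
  obtain ⟨g, hg, h⟩ := hΦ.exists_conj_or hn hsq
  intro x y hxy
  rw [← hφ, ← hφ, hxy]
  exact map_pow_ringChar_of_conj_or hn hg h (mem_sl_iff.1 x.2) (hxy ▸ mem_sl_iff.1 y.2)

theorem IsRestrictedAut.map_mul_self_eq_zero
    {φ : ↥(LieAlgebra.SpecialLinear.sl (Fin n) k) ≃ₗ⁅k⁆
      ↥(LieAlgebra.SpecialLinear.sl (Fin n) k)} (hφ : IsRestrictedAut n k φ) (h2 : (2 : k) = 0)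
    {x : ↥(LieAlgebra.SpecialLinear.sl (Fin n) k)}
    (hx : (x : Matrix (Fin n) (Fin n) k) * (x : Matrix (Fin n) (Fin n) k) = 0) :
    (φ x : Matrix (Fin n) (Fin n) k) * (φ x : Matrix (Fin n) (Fin n) k) = 0 := by
  have hp : ringChar k = 2 := by
    have := CharTwo.of_one_ne_zero_of_two_eq_zero one_ne_zero h2
    exact ringChar.eq k 2
  have := hφ x 0
  rw [hp, pow_two, pow_two, hx, map_zero] at this
  exact (this rfl).symm

theorem Represents.isTracelessAut_diffOne [Infinite k]
    {θ : Matrix.SpecialLinearGroup (Fin n) k ≃* Matrix.SpecialLinearGroup (Fin n) k}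
    {P P' : Fin n × Fin n → MvPolynomial (Fin n × Fin n) k} (hP : Represents n k P θ)
    (hP' : Represents n k P' θ.symm) : IsTracelessAut (diffOne P) where
  trace_map hx := hP.trace_diffOne hx
  eq_zero {x} hx h := by
    rw [← hP.diffOne_diffOne hP' hx, h, map_zero]
  exists_map_eq {y} hy := ⟨diffOne P' y, hP'.trace_diffOne hy,
    hP'.diffOne_diffOne (θ := θ.symm) hP hy⟩
  map_lie hx hy := hP.diffOne_lie hy hx

theorem Represents.diffOne_mul_self_eq_zero [Infinite k]
    {θ : Matrix.SpecialLinearGroup (Fin 2) k ≃* Matrix.SpecialLinearGroup (Fin 2) k}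
    {P : Fin 2 × Fin 2 → MvPolynomial (Fin 2 × Fin 2) k} (hP : Represents 2 k P θ)
    {x : Matrix (Fin 2) (Fin 2) k} (hx : x.trace = 0) (hxx : x * x = 0) :
    diffOne P x * diffOne P x = 0 := by
  rcases eq_or_ne x 0 with rfl | hx0
  · simp
  obtain ⟨a, b, rfl⟩ := exists_eq_vecMulVec_of_det_eq_zero (A := x) (by
    have := congrArg Matrix.det hxx
    rw [Matrix.det_mul] at this
    simpa using this)
  have hba := dotProduct_eq_zero_of_vecMulVec_mul_self hx0 hxx
  obtain ⟨u, hu⟩ := exists_dotProduct_eq_one (b := a) (by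
    rintro rfl
    exact hx0 (zero_vecMulVec _))
  rw [dotProduct_comm] at hu
  classical
  obtain ⟨t, ht⟩ := Infinite.exists_notMem_finset (insert 0 (Polynomial.nthRootsFinset 4 (1 : k)))
  rw [Finset.mem_insert, Polynomial.mem_nthRootsFinset four_pos, not_or] at ht
  obtain ⟨ht0, ht4⟩ := ht
  let g : Matrix (Fin 2) (Fin 2) k := t⁻¹ • 1 + (t - t⁻¹) • vecMulVec a u
  have hg : g.det = 1 := by
    rw [dotProduct, Fin.sum_univ_two] at hu
    simp [g, Matrix.det_fin_two, vecMulVec_apply]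
    field_simp
    linear_combination (t ^ 2 - 1) * hu
  have hgx : g * vecMulVec a b = t • vecMulVec a b := by
    simp only [g, add_mul, Matrix.smul_mul, one_mul, vecMulVec_mul_vecMulVec, hu, one_smul]
    module
  have hxg : vecMulVec a b * g = t⁻¹ • vecMulVec a b := by
    simp [g, mul_add, vecMulVec_mul_vecMulVec, hba]
  have hgg : g * g.adjugate = 1 := by rw [Matrix.mul_adjugate, hg, one_smul]
  have hconj : g * vecMulVec a b * g.adjugate = (t ^ 2) • vecMulVec a b := by
    have : g * vecMulVec a b = (t ^ 2) • (vecMulVec a b * g) := by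
      rw [hgx, hxg, smul_smul]
      congr 1
      field_simp
    rw [this, Matrix.smul_mul, mul_assoc, hgg, mul_one]
  have h := hP.diffOne_conj_mul ⟨g, hg⟩ hx
  rw [show ((⟨g, hg⟩ : Matrix.SpecialLinearGroup (Fin 2) k) :
    Matrix (Fin 2) (Fin 2) k) = g from rfl, hconj, map_smul] at h
  have hdet := congrArg Matrix.det h
  rw [Matrix.det_mul, Matrix.det_mul, Matrix.det_smul, Matrix.SpecialLinearGroup.det_coe, one_mul,
    mul_one, Fintype.card_fin] at hdet
  have hd0 : (diffOne P (vecMulVec a b)).det = 0 := by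
    by_contra hd
    exact ht4 (mul_right_cancel₀ hd (by linear_combination hdet))
  rw [mul_self_eq_smul_one_of_trace_eq_zero (hP.trace_diffOne hx), hd0, neg_zero, zero_smul]

end Classification

section Surjectivity

variable {n : ℕ} {k : Type*} [Field k]

theorem represents_of_map_eval
    {Y : Matrix (Fin n) (Fin n) (MvPolynomial (Fin n × Fin n) k)}
    {f : Matrix.SpecialLinearGroup (Fin n) k → Matrix.SpecialLinearGroup (Fin n) k}
    (h : ∀ g : Matrix.SpecialLinearGroup (Fin n) k,
      Y.map (MvPolynomial.eval fun q => (g : Matrix (Fin n) (Fin n) k) q.1 q.2) = f g) :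
    Represents n k (fun q => Y q.1 q.2) f :=
  fun g i j => (congrFun (congrFun (h g) i) j).symm

theorem Represents.diffOne_eq_of_map_evTangent
    {Y : Matrix (Fin n) (Fin n) (MvPolynomial (Fin n × Fin n) k)}
    {f : Matrix.SpecialLinearGroup (Fin n) k → Matrix.SpecialLinearGroup (Fin n) k}
    (hY : Represents n k (fun q => Y q.1 q.2) f) (hf : f 1 = 1) {x y : Matrix (Fin n) (Fin n) k}
    (h : Y.map (evTangent x) = onePlusEps y) : diffOne (fun q => Y q.1 q.2) x = y :=
  onePlusEps_injective ((hY.map_evTangent hf x).symm.trans h)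

/-- Conjugation by an invertible matrix, as an automorphism of `SL(n,k)`. -/
def conjEquiv (g h : Matrix (Fin n) (Fin n) k) (hgh : g * h = 1) (hhg : h * g = 1) :
    Matrix.SpecialLinearGroup (Fin n) k ≃* Matrix.SpecialLinearGroup (Fin n) k where
  toFun x := ⟨g * x * h, by rw [Matrix.det_mul_comm, ← mul_assoc, hhg, one_mul, x.2]⟩
  invFun x := ⟨h * x * g, by rw [Matrix.det_mul_comm, ← mul_assoc, hgh, one_mul, x.2]⟩
  left_inv x := Subtype.ext (by
    change h * (g * x * h) * g = x
    rw [← mul_assoc, ← mul_assoc, hhg, one_mul, mul_assoc, hhg, mul_one])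
  right_inv x := Subtype.ext (by
    change g * (h * x * g) * h = x
    rw [← mul_assoc, ← mul_assoc, hgh, one_mul, mul_assoc, hgh, mul_one])
  map_mul' x y := Subtype.ext (by
    change g * (x * y) * h = g * x * h * (g * y * h)
    rw [mul_assoc g y h, ← mul_assoc (g * x * h), mul_assoc (g * x) h g, hhg, mul_one]
    simp only [mul_assoc])

/-- The inverse transpose, as an automorphism of `SL(n,k)`. -/
def invTransposeEquiv :
    Matrix.SpecialLinearGroup (Fin n) k ≃* Matrix.SpecialLinearGroup (Fin n) k where
  toFun x := x⁻¹.transpose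
  invFun x := x.transpose⁻¹
  left_inv x := by
    refine inv_eq_iff_eq_inv.2 ?_
    exact Subtype.ext (Matrix.transpose_transpose _)
  right_inv x := by
    change (x.transpose⁻¹)⁻¹.transpose = x
    rw [inv_inv]
    exact Subtype.ext (Matrix.transpose_transpose _)
  map_mul' x y := by
    rw [_root_.mul_inv_rev]
    exact Subtype.ext (Matrix.transpose_mul _ _)

/-- The inverse transpose followed by conjugation by an invertible matrix, as an automorphism of
`SL(n,k)`. -/
def conjInvTransposeEquiv (g h : Matrix (Fin n) (Fin n) k) (hgh : g * h = 1) (hhg : h * g = 1) :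
    Matrix.SpecialLinearGroup (Fin n) k ≃* Matrix.SpecialLinearGroup (Fin n) k :=
  invTransposeEquiv.trans (conjEquiv g h hgh hhg)

/-- Conjugation of a matrix of polynomials by constant matrices. -/
noncomputable def conjPoly (g h : Matrix (Fin n) (Fin n) k)
    (Y : Matrix (Fin n) (Fin n) (MvPolynomial (Fin n × Fin n) k)) :
    Matrix (Fin n) (Fin n) (MvPolynomial (Fin n × Fin n) k) :=
  g.map MvPolynomial.C * Y * h.map MvPolynomial.C

theorem conjPoly_map_eval (g h : Matrix (Fin n) (Fin n) k)
    (Y : Matrix (Fin n) (Fin n) (MvPolynomial (Fin n × Fin n) k)) (v : Fin n × Fin n → k) :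
    (conjPoly g h Y).map (MvPolynomial.eval v) = g * Y.map (MvPolynomial.eval v) * h := by
  rw [conjPoly, Matrix.map_mul, Matrix.map_mul, map_C_map_eval, map_C_map_eval]

theorem conjPoly_map_evTangent {g h : Matrix (Fin n) (Fin n) k} (hgh : g * h = 1)
    {Y : Matrix (Fin n) (Fin n) (MvPolynomial (Fin n × Fin n) k)} {x y : Matrix (Fin n) (Fin n) k}
    (hY : Y.map (evTangent x) = onePlusEps y) :
    (conjPoly g h Y).map (evTangent x) = onePlusEps (g * y * h) := by
  rw [conjPoly, Matrix.map_mul, Matrix.map_mul, map_C_map_evTangent, map_C_map_evTangent, hY,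
    map_mul_onePlusEps_mul_map hgh]

theorem represents_conjEquiv {g h : Matrix (Fin n) (Fin n) k} (hgh : g * h = 1) (hhg : h * g = 1) :
    Represents n k (fun q => conjPoly g h (Matrix.mvPolynomialX (Fin n) (Fin n) k) q.1 q.2)
      (conjEquiv g h hgh hhg) :=
  represents_of_map_eval fun x => by
    rw [conjPoly_map_eval, mvPolynomialX_map_eval]
    rfl

theorem isAlgebraicAut_conjEquiv {g h : Matrix (Fin n) (Fin n) k} (hgh : g * h = 1)
    (hhg : h * g = 1) : IsAlgebraicAut n k (conjEquiv g h hgh hhg) :=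
  ⟨⟨_, represents_conjEquiv hgh hhg⟩, ⟨_, represents_conjEquiv hhg hgh⟩⟩

theorem isDifferentialOf_conjEquiv {g h : Matrix (Fin n) (Fin n) k} (hgh : g * h = 1)
    (hhg : h * g = 1) {φ : ↥(LieAlgebra.SpecialLinear.sl (Fin n) k) ≃ₗ⁅k⁆
      ↥(LieAlgebra.SpecialLinear.sl (Fin n) k)}
    (hφ : ∀ x : ↥(LieAlgebra.SpecialLinear.sl (Fin n) k),
      (φ x : Matrix (Fin n) (Fin n) k) = g * x * h) :
    IsDifferentialOf n k (conjEquiv g h hgh hhg) φ := by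
  have hP := represents_conjEquiv hgh hhg
  refine isDifferentialOf_iff.2 ⟨_, hP, fun x => ?_⟩
  refine hP.diffOne_eq_of_map_evTangent (map_one _) ?_
  rw [conjPoly_map_evTangent hgh (mvPolynomialX_map_evTangent _), hφ]

theorem onePlusEps_transpose (x : Matrix (Fin n) (Fin n) k) :
    (onePlusEps x)ᵀ = onePlusEps xᵀ := by
  simp [onePlusEps, Matrix.transpose_map]

theorem represents_conjInvTransposeEquiv {g h : Matrix (Fin n) (Fin n) k} (hgh : g * h = 1)
    (hhg : h * g = 1) :
    Represents n k (fun q => conjPoly g h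
      (Matrix.mvPolynomialX (Fin n) (Fin n) k).adjugateᵀ q.1 q.2)
      (conjInvTransposeEquiv g h hgh hhg) :=
  represents_of_map_eval fun x => by
    rw [conjPoly_map_eval, Matrix.transpose_map, adjugate_mvPolynomialX_map_eval]
    rfl

theorem represents_conjInvTransposeEquiv_symm {g h : Matrix (Fin n) (Fin n) k} (hgh : g * h = 1)
    (hhg : h * g = 1) :
    Represents n k (fun q => conjPoly gᵀ hᵀ
      (Matrix.mvPolynomialX (Fin n) (Fin n) k).adjugateᵀ q.1 q.2)
      (conjInvTransposeEquiv g h hgh hhg).symm :=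
  represents_of_map_eval fun x => by
    rw [conjPoly_map_eval, Matrix.transpose_map, adjugate_mvPolynomialX_map_eval]
    change _ = Matrix.adjugate (h * (x : Matrix (Fin n) (Fin n) k) * g)ᵀ
    rw [← Matrix.adjugate_transpose]
    have := congrArg (fun y : Matrix.SpecialLinearGroup (Fin n) k =>
      (y : Matrix (Fin n) (Fin n) k)ᵀ) (map_inv (conjEquiv h g hhg hgh) x)
    refine Eq.trans ?_ this
    change _ = (h * _ * g)ᵀ
    rw [Matrix.transpose_mul, Matrix.transpose_mul, mul_assoc]

theorem isAlgebraicAut_conjInvTransposeEquiv {g h : Matrix (Fin n) (Fin n) k} (hgh : g * h = 1)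
    (hhg : h * g = 1) : IsAlgebraicAut n k (conjInvTransposeEquiv g h hgh hhg) :=
  ⟨⟨_, represents_conjInvTransposeEquiv hgh hhg⟩,
    ⟨_, represents_conjInvTransposeEquiv_symm hgh hhg⟩⟩

theorem isDifferentialOf_conjInvTransposeEquiv {g h : Matrix (Fin n) (Fin n) k} (hgh : g * h = 1)
    (hhg : h * g = 1) {φ : ↥(LieAlgebra.SpecialLinear.sl (Fin n) k) ≃ₗ⁅k⁆
      ↥(LieAlgebra.SpecialLinear.sl (Fin n) k)}
    (hφ : ∀ x : ↥(LieAlgebra.SpecialLinear.sl (Fin n) k),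
      (φ x : Matrix (Fin n) (Fin n) k) = -(g * (x : Matrix (Fin n) (Fin n) k)ᵀ * h)) :
    IsDifferentialOf n k (conjInvTransposeEquiv g h hgh hhg) φ := by
  have hP := represents_conjInvTransposeEquiv hgh hhg
  refine isDifferentialOf_iff.2 ⟨_, hP, fun x => ?_⟩
  refine hP.diffOne_eq_of_map_evTangent (map_one _) ?_
  rw [conjPoly_map_evTangent hgh (y := -(x : Matrix (Fin n) (Fin n) k)ᵀ), hφ, mul_neg, neg_mul]
  rw [Matrix.transpose_map, adjugate_mvPolynomialX_map_evTangent (mem_sl_iff.1 x.2),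
    onePlusEps_transpose, Matrix.transpose_neg]

theorem IsRestrictedAut.exists_isDifferentialOf (hn : 2 ≤ n)
    {φ : ↥(LieAlgebra.SpecialLinear.sl (Fin n) k) ≃ₗ⁅k⁆
      ↥(LieAlgebra.SpecialLinear.sl (Fin n) k)} (hφ : IsRestrictedAut n k φ) :
    ∃ θ, IsAlgebraicAut n k θ ∧ IsDifferentialOf n k θ φ := by
  obtain ⟨Φ, hΦ, hΦφ⟩ := exists_isTracelessAut_of_lieEquiv φ
  obtain ⟨g, hg, h⟩ := hΦ.exists_conj_or hn fun _ h2 x hx hxx => by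
    have := hφ.map_mul_self_eq_zero h2 (x := ⟨x, mem_sl_iff.2 hx⟩) hxx
    rwa [← hΦφ] at this
  have hgg : g * g⁻¹ = 1 := Matrix.mul_nonsing_inv g hg.isUnit
  have hgg' : g⁻¹ * g = 1 := Matrix.nonsing_inv_mul g hg.isUnit
  rcases h with h | h
  · refine ⟨_, isAlgebraicAut_conjEquiv hgg hgg', isDifferentialOf_conjEquiv hgg hgg' fun x => ?_⟩
    rw [← h x (mem_sl_iff.1 x.2), mul_assoc, hgg, mul_one, hΦφ]
  · refine ⟨_, isAlgebraicAut_conjInvTransposeEquiv hgg hgg',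
      isDifferentialOf_conjInvTransposeEquiv hgg hgg' fun x => ?_⟩
    rw [← neg_mul, ← h x (mem_sl_iff.1 x.2), mul_assoc, hgg, mul_one, hΦφ]

theorem IsAlgebraicAut.existsUnique_isDifferentialOf [Infinite k] (hn : 2 ≤ n)
    {θ : Matrix.SpecialLinearGroup (Fin n) k ≃* Matrix.SpecialLinearGroup (Fin n) k}
    (hθ : IsAlgebraicAut n k θ) :
    ∃! φ : {φ : ↥(LieAlgebra.SpecialLinear.sl (Fin n) k) ≃ₗ⁅k⁆
        ↥(LieAlgebra.SpecialLinear.sl (Fin n) k) // IsRestrictedAut n k φ},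
      IsDifferentialOf n k θ φ.1 := by
  obtain ⟨⟨P, hP⟩, P', hP'⟩ := hθ
  let φ : ↥(LieAlgebra.SpecialLinear.sl (Fin n) k) ≃ₗ⁅k⁆
      ↥(LieAlgebra.SpecialLinear.sl (Fin n) k) :=
    { toFun := fun x => ⟨diffOne P x, mem_sl_iff.2 (hP.trace_diffOne (mem_sl_iff.1 x.2))⟩
      invFun := fun x => ⟨diffOne P' x, mem_sl_iff.2 (hP'.trace_diffOne (mem_sl_iff.1 x.2))⟩
      map_add' := fun x y => Subtype.ext (map_add (diffOne P) _ _)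
      map_smul' := fun c x => Subtype.ext (map_smul (diffOne P) c _)
      map_lie' := fun {x y} =>
        Subtype.ext (hP.diffOne_lie (mem_sl_iff.1 y.2) (mem_sl_iff.1 x.2))
      left_inv := fun x => Subtype.ext (hP.diffOne_diffOne hP' (mem_sl_iff.1 x.2))
      right_inv := fun x => Subtype.ext
        (hP'.diffOne_diffOne (θ := θ.symm) hP (mem_sl_iff.1 x.2)) }
  have hφ : IsRestrictedAut n k φ :=
    (hP.isTracelessAut_diffOne hP').isRestrictedAut hn
      (by rintro rfl _ x hx hxx; exact hP.diffOne_mul_self_eq_zero hx hxx) fun _ => rfl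
  refine ⟨⟨φ, hφ⟩, isDifferentialOf_iff.2 ⟨P, hP, fun _ => rfl⟩, fun ψ hψ => Subtype.ext ?_⟩
  obtain ⟨Q, hQ, hQψ⟩ := isDifferentialOf_iff.1 hψ
  refine LieEquiv.ext fun x => Subtype.ext ?_
  rw [← hQψ]
  exact hQ.diffOne_eq hP (mem_sl_iff.1 x.2)

end Surjectivity

/-- Let `G = GL(n,k)`, `k` algebraically closed.  The differentiation
map from the group of algebraic automorphisms of the derived group `SL(n,k)` to the
group of restricted Lie algebra automorphisms of `𝔰𝔩(n,k)` is bijective, for all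
`n ≥ 2` and all characteristics. -/
theorem stmt5 {k : Type*} [Field k] [IsAlgClosed k] {n : ℕ} (hn : 2 ≤ n) :
    -- d is well-defined and injective
    (∀ θ, IsAlgebraicAut n k θ →
      ∃! φ : {φ : ↥(LieAlgebra.SpecialLinear.sl (Fin n) k) ≃ₗ⁅k⁆
          ↥(LieAlgebra.SpecialLinear.sl (Fin n) k) // IsRestrictedAut n k φ},
        IsDifferentialOf n k θ φ.1) ∧
    (∀ θ₁ θ₂, IsAlgebraicAut n k θ₁ → IsAlgebraicAut n k θ₂ →
      ∀ φ, IsRestrictedAut n k φ →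
        IsDifferentialOf n k θ₁ φ → IsDifferentialOf n k θ₂ φ → θ₁ = θ₂) ∧
    -- d is surjective
    (∀ φ, IsRestrictedAut n k φ →
      ∃ θ, IsAlgebraicAut n k θ ∧ IsDifferentialOf n k θ φ) := by
  exact ⟨fun _ hθ => hθ.existsUnique_isDifferentialOf hn,
    fun _ _ _ _ _ _ h₁ h₂ => eq_of_isDifferentialOf hn h₁ h₂,
    fun _ hφ => hφ.exists_isDifferentialOf hn⟩
end

section
/- Let 𝔤 = 𝔤𝔩(n,k) with char k = p dividing n. Then every restricted Lie algebra automorphism of 𝔤 fixing 𝔰𝔩(n,k) pointwise has the form x ↦ x + λ·(tr x)·I for some λ ∈ 𝔽_p, and Aut(𝔤) ≅ Aut(𝔰𝔩(n,k)) × B, where B is the cyclic group of order p generated by x ↦ x + (tr x)·I. -/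
open Matrix

/-- A restricted Lie algebra automorphism of `𝔤𝔩(n,k)`: a bijective linear map
preserving commutators and the `p`-operation (`p`-th matrix power). -/
def IsRAutGl (n : ℕ) (k : Type*) [Field k] (p : ℕ)
    (f : Matrix (Fin n) (Fin n) k → Matrix (Fin n) (Fin n) k) : Prop :=
  Function.Bijective f ∧ IsLinearMap k f ∧
  (∀ x y : Matrix (Fin n) (Fin n) k, f (x * y - y * x) = f x * f y - f y * f x) ∧
  (∀ x : Matrix (Fin n) (Fin n) k, f (x ^ p) = f x ^ p)

/-- `𝔰𝔩(n,k)` as the kernel of the trace. -/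
noncomputable def slMod (n : ℕ) (k : Type*) [Field k] :
    Submodule k (Matrix (Fin n) (Fin n) k) :=
  LinearMap.ker (Matrix.traceLinearMap (Fin n) k k)

/-- A restricted Lie algebra automorphism of `𝔰𝔩(n,k)`. -/
def IsRAutSl (n : ℕ) (k : Type*) [Field k] (p : ℕ)
    (g : ↥(slMod n k) → ↥(slMod n k)) : Prop :=
  Function.Bijective g ∧ IsLinearMap k g ∧
  (∀ x y z : ↥(slMod n k),
    (z : Matrix (Fin n) (Fin n) k) =
        (x : Matrix (Fin n) (Fin n) k) * y - (y : Matrix (Fin n) (Fin n) k) * x →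
    (g z : Matrix (Fin n) (Fin n) k) =
        (g x : Matrix (Fin n) (Fin n) k) * g y - (g y : Matrix (Fin n) (Fin n) k) * g x) ∧
  (∀ x z : ↥(slMod n k),
    (z : Matrix (Fin n) (Fin n) k) = (x : Matrix (Fin n) (Fin n) k) ^ p →
    (g z : Matrix (Fin n) (Fin n) k) = (g x : Matrix (Fin n) (Fin n) k) ^ p)


section SlAut

variable {ι k : Type*} [Fintype ι] [DecidableEq ι] [Field k]

theorem Matrix.trace_pow_char [Nonempty ι] (p : ℕ) [Fact p.Prime] [CharP k p] (M : Matrix ι ι k) :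
    (M ^ p).trace = M.trace ^ p := by
  have h : (M ^ p).charpoly = M.charpoly.map (frobenius k p) := by
    apply Polynomial.expand_injective (R := k) (n := p) (Fact.out : p.Prime).pos
    rw [← Polynomial.map_expand, Polynomial.map_frobenius_expand]
    unfold Matrix.charpoly
    rw [AlgHom.map_det, ← coe_detMonoidHom,
      ← (detMonoidHom : Matrix ι ι (Polynomial k) →* Polynomial k).map_pow]
    apply congr_arg det
    refine matPolyEquiv.injective ?_
    rw [map_pow, matPolyEquiv_charmatrix, sub_pow_char_of_commute]
    · rw [← Polynomial.C_pow]
      exact matPolyEquiv_eq_X_pow_sub_C p M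
    · exact (Polynomial.C M).commute_X
  have hodd : (-1 : k) ^ p = -1 := neg_one_pow_expChar k p
  rw [Matrix.trace_eq_neg_charpoly_coeff, Matrix.trace_eq_neg_charpoly_coeff, h,
    Polynomial.coeff_map, frobenius_def, neg_pow, hodd, neg_one_mul]

/-- The trace-zero matrices are spanned by the `E_ij`, `i ≠ j`, and the `E_ii - E_oo`. -/
theorem Matrix.mem_of_trace_eq_zero (W : Submodule k (Matrix ι ι k)) (o : ι)
    (hoff : ∀ i j, i ≠ j → single i j (1 : k) ∈ W)
    (hdiag : ∀ i, single i i (1 : k) - single o o 1 ∈ W)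
    {x : Matrix ι ι k} (hx : x.trace = 0) : x ∈ W := by
  have key : x = ∑ i, ∑ j, x i j • (single i j (1 : k) - if i = j then single o o 1 else 0) := by
    have h0 : ∑ i, ∑ j, x i j • (if i = j then single o o (1 : k) else 0) = 0 := by
      simp only [smul_ite, smul_zero, Finset.sum_ite_eq, Finset.mem_univ, if_true]
      rw [← Finset.sum_smul]
      have : ∑ i, x i i = 0 := hx
      rw [this, zero_smul]
    simp only [smul_sub, Finset.sum_sub_distrib]
    rw [h0, sub_zero]
    conv_lhs => rw [matrix_eq_sum_single x]
    simp
  rw [key]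
  refine W.sum_mem fun i _ => W.sum_mem fun j _ => W.smul_mem _ ?_
  by_cases h : i = j
  · subst h
    simpa using hdiag i
  · simpa [h] using hoff i j h

theorem exists_trace_eq_one_mul_mul_eq_zero {X : Matrix ι ι k} (hX : X ≠ 0) (hXX : X * X = 0) :
    ∃ w : Matrix ι ι k, w.trace = 1 ∧ X * w * X = 0 := by
  obtain ⟨s, t, hst⟩ : ∃ s t, X s t ≠ 0 := by
    by_contra! h
    exact hX (Matrix.ext h)
  refine ⟨(X s t)⁻¹ • (X * single t s 1), ?_, ?_⟩
  · rw [trace_smul, Matrix.trace_mul_comm, Matrix.trace_single_mul]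
    simp [hst]
  · rw [Matrix.mul_smul, ← Matrix.mul_assoc, hXX]
    simp

/-- A square-zero matrix has a generalized inverse of trace zero. -/
theorem exists_trace_eq_zero_mul_mul_eq_self {X : Matrix ι ι k} (hXX : X * X = 0) :
    ∃ z : Matrix ι ι k, z.trace = 0 ∧ X * z * X = X := by
  by_cases hX : X = 0
  · exact ⟨0, by simp, by simp [hX]⟩
  obtain ⟨w, hw, hXw⟩ := exists_trace_eq_one_mul_mul_eq_zero hX hXX
  obtain ⟨z, hz⟩ : ∃ z, X * z * X = X := by
    obtain ⟨g, hg⟩ := (toLin' X).rangeRestrict.exists_rightInverse_of_surjective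
      (toLin' X).range_rangeRestrict
    obtain ⟨h, hh⟩ := LinearMap.exists_extend g
    refine ⟨LinearMap.toMatrix' h, ?_⟩
    apply toLin'.injective
    rw [toLin'_mul, toLin'_mul, toLin'_toMatrix']
    ext1 i
    have h1 : ∀ v, h (toLin' X v) = g ((toLin' X).rangeRestrict v) := fun v => by
      rw [← hh]; rfl
    have h2 : ∀ v, toLin' X (g v) = v := fun v =>
      congr_arg Subtype.val (LinearMap.congr_fun hg v)
    ext1
    simp only [LinearMap.comp_apply]
    rw [h1, h2]
    rfl
  refine ⟨z - z.trace • w, by simp [hw], ?_⟩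
  rw [mul_sub, sub_mul, hz, Matrix.mul_smul, Matrix.smul_mul, hXw, smul_zero, sub_zero]

theorem exists_eq_vecMulVec {X : Matrix ι ι k} (hX : X ≠ 0) (hXX : X * X = 0)
    (h : ∀ y : Matrix ι ι k, y.trace = 0 → ∃ c : k, X * y * X = c • X) :
    ∃ a b : ι → k, X = vecMulVec a b := by
  obtain ⟨w, hw, hXw⟩ := exists_trace_eq_one_mul_mul_eq_zero hX hXX
  have hall : ∀ y : Matrix ι ι k, ∃ c : k, X * y * X = c • X := fun y => by
    obtain ⟨c, hc⟩ := h (y - y.trace • w) (by simp [hw])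
    refine ⟨c, ?_⟩
    rwa [mul_sub, sub_mul, Matrix.mul_smul, Matrix.smul_mul, hXw, smul_zero, sub_zero] at hc
  obtain ⟨s, t, hst⟩ : ∃ s t, X s t ≠ 0 := by
    by_contra! h
    exact hX (Matrix.ext h)
  obtain ⟨c, hc⟩ := hall (single t s 1)
  have hentry : ∀ i j, X i t * X s j = c * X i j := fun i j => by
    have := congr_fun (congr_fun hc i) j
    rw [Matrix.mul_assoc, Matrix.mul_apply, Finset.sum_eq_single t] at this
    · simpa using this
    · intro b _ hb
      rw [single_mul_apply_of_ne _ _ _ _ _ hb, mul_zero]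
    · simp
  have hc0 : c ≠ 0 := by
    rintro rfl
    have := hentry s t
    simp [hst] at this
  refine ⟨fun i => c⁻¹ * X i t, fun j => X s j, ?_⟩
  ext i j
  rw [vecMulVec_apply, mul_assoc, hentry, inv_mul_cancel_left₀ hc0]

theorem vecMulVec_mul_mul_vecMulVec {ι k : Type*} [Fintype ι] [Field k] (u v : ι → k)
    (y : Matrix ι ι k) :
    vecMulVec u v * y * vecMulVec u v = (v ⬝ᵥ y *ᵥ u) • vecMulVec u v := by
  rw [Matrix.mul_assoc, mul_vecMulVec, vecMulVec_mul_vecMulVec, vecMulVec_smul]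

/-- The restriction of `G` to the trace-zero matrices is an automorphism of this space
compatible with commutators and with `p`-th powers. -/
structure IsTraceZeroAut (p : ℕ) (G : Matrix ι ι k → Matrix ι ι k) : Prop where
  trace_eq : ∀ {x}, x.trace = 0 → (G x).trace = 0
  map_add : ∀ {x y}, x.trace = 0 → y.trace = 0 → G (x + y) = G x + G y
  map_smul : ∀ (c : k) {x}, x.trace = 0 → G (c • x) = c • G x
  eq_zero : ∀ {x}, x.trace = 0 → G x = 0 → x = 0
  surj : ∀ {y}, y.trace = 0 → ∃ x, x.trace = 0 ∧ G x = y
  map_comm : ∀ {x y}, x.trace = 0 → y.trace = 0 → G (x * y - y * x) = G x * G y - G y * G x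
  map_pow : ∀ {x}, x.trace = 0 → (x ^ p).trace = 0 → G (x ^ p) = G x ^ p

theorem trace_comm {ι k : Type*} [Fintype ι] [Field k] (x y : Matrix ι ι k) :
    (x * y - y * x).trace = 0 := by
  rw [trace_sub, trace_mul_comm, sub_self]

namespace IsTraceZeroAut

variable {p : ℕ} {G : Matrix ι ι k → Matrix ι ι k}

theorem map_zero (hG : IsTraceZeroAut p G) : G 0 = 0 := by
  simpa using hG.map_smul 0 (x := 0) (by simp)

theorem map_sub (hG : IsTraceZeroAut p G) {x y : Matrix ι ι k} (hx : x.trace = 0)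
    (hy : y.trace = 0) : G (x - y) = G x - G y := by
  have h := hG.map_smul (-1) hy
  rw [sub_eq_add_neg, ← neg_one_smul k y, hG.map_add hx (by simp [hy]), h, neg_one_smul,
    sub_eq_add_neg]

theorem neg_transpose (hG : IsTraceZeroAut p G) (hp : p.Prime) [CharP k p] :
    IsTraceZeroAut p fun x => -(G x)ᵀ where
  trace_eq hx := by simp [hG.trace_eq hx]
  map_add hx hy := by rw [hG.map_add hx hy, transpose_add, neg_add]
  map_smul c x hx := by rw [hG.map_smul c hx, transpose_smul, smul_neg]
  eq_zero hx h := hG.eq_zero hx (by simpa using h)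
  surj {y} hy := by
    obtain ⟨x, hx, h⟩ := hG.surj (y := -yᵀ) (by simp [hy])
    exact ⟨x, hx, by simp [h]⟩
  map_comm hx hy := by
    rw [hG.map_comm hx hy, transpose_sub, transpose_mul, transpose_mul]
    noncomm_ring
  map_pow {x} hx hxp := by
    have : Fact p.Prime := ⟨hp⟩
    have hodd : (-1 : Matrix ι ι k) ^ p = -1 := by
      cases isEmpty_or_nonempty ι
      · exact Subsingleton.elim _ _
      · exact neg_one_pow_expChar _ p
    rw [hG.map_pow hx hxp, transpose_pow, neg_pow _ p, hodd, neg_one_mul]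

/-- The image of a nilpotent matrix of rank one is square-zero. -/
theorem map_vecMulVec_sq (hG : IsTraceZeroAut p G) (hp : p.Prime) [CharP k p] {u v : ι → k}
    (huv : v ⬝ᵥ u = 0) : G (vecMulVec u v) * G (vecMulVec u v) = 0 := by
  have hxx : vecMulVec u v * vecMulVec u v = 0 := by
    rw [vecMulVec_mul_vecMulVec, huv, zero_smul, vecMulVec_zero]
  have hx0 : (vecMulVec u v).trace = 0 := by rw [trace_vecMulVec, dotProduct_comm, huv]
  have hxp : vecMulVec u v ^ p = 0 := by
    obtain ⟨q, rfl⟩ := Nat.exists_eq_add_of_le hp.two_le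
    rw [pow_add, sq, hxx, zero_mul]
  have hXp : G (vecMulVec u v) ^ p = 0 := by
    rw [← hG.map_pow hx0 (by simp [hxp]), hxp, hG.map_zero]
  have hquad : ∀ Z : Matrix ι ι k, Z.trace = 0 → ∃ c : k,
      G (vecMulVec u v) * (G (vecMulVec u v) * Z - Z * G (vecMulVec u v))
        - (G (vecMulVec u v) * Z - Z * G (vecMulVec u v)) * G (vecMulVec u v)
        = c • G (vecMulVec u v) := by
    intro Z hZ
    obtain ⟨z, hz, rfl⟩ := hG.surj hZ
    refine ⟨-2 * (v ⬝ᵥ z *ᵥ u), ?_⟩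
    rw [← hG.map_comm hx0 hz, ← hG.map_comm hx0 (trace_comm _ _), ← hG.map_smul _ hx0, mul_smul,
      ← vecMulVec_mul_mul_vecMulVec]
    congr 1
    generalize vecMulVec u v = x at hxx
    have e : x * (x * z - z * x) - (x * z - z * x) * x
        = x * x * z + z * (x * x) + (-2 : ℤ) • (x * z * x) := by noncomm_ring
    rw [e, hxx]
    simp [← Int.cast_smul_eq_zsmul k]
  generalize G (vecMulVec u v) = X at hXp hquad
  by_contra hXX
  have hnil : ∃ m, X ^ m = 0 := ⟨p, hXp⟩
  classical
  obtain ⟨m, hm, hmin⟩ : ∃ m, X ^ (m + 3) = 0 ∧ X ^ (m + 2) ≠ 0 := by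
    have h1 := Nat.find_spec hnil
    have h2 : 2 < Nat.find hnil := by
      by_contra! hle
      apply hXX
      rw [← sq, ← Nat.add_sub_cancel' hle, pow_add, h1, zero_mul]
    obtain ⟨m, hm⟩ := Nat.exists_eq_add_of_lt h2
    refine ⟨m, ?_, ?_⟩
    · rw [hm] at h1
      rw [← h1]
      congr 1
      omega
    · exact Nat.find_min hnil (by omega)
  obtain ⟨Z, hZ, hWZ⟩ := exists_trace_eq_zero_mul_mul_eq_self (X := X ^ (m + 2)) (by
    rw [← pow_add, show m + 2 + (m + 2) = m + 3 + (m + 1) by ring, pow_add, hm, zero_mul])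
  obtain ⟨c, hc⟩ := hquad Z hZ
  have := congr_arg (fun M => X ^ (m + 2) * M * X ^ m) hc
  have e : X ^ (m + 2) * (X * (X * Z - Z * X) - (X * Z - Z * X) * X) * X ^ m
      = X ^ (m + 3) * X * Z * X ^ m - (2 : ℤ) • (X ^ (m + 3) * Z * X * X ^ m)
        + X ^ (m + 2) * Z * X ^ (m + 2) := by
    have e1 : X ^ (m + 3) = X ^ (m + 2) * X := pow_succ _ _
    have e2 : X ^ (m + 2) = X * X * X ^ m := by rw [add_comm, pow_add, sq]
    rw [e1]
    nth_rw 5 [e2]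
    noncomm_ring
  beta_reduce at this
  rw [e, hm, hWZ, Matrix.mul_smul, ← pow_succ, hm] at this
  simp at this
  exact hmin this

/-- Nilpotent matrices of rank one are mapped to nilpotent matrices of rank one. -/
theorem exists_map_vecMulVec (hG : IsTraceZeroAut p G) (hp : p.Prime) [CharP k p] {u v : ι → k}
    (hu : u ≠ 0) (hv : v ≠ 0) (huv : v ⬝ᵥ u = 0) :
    ∃ a b : ι → k, G (vecMulVec u v) = vecMulVec a b ∧ a ≠ 0 ∧ b ≠ 0 ∧ b ⬝ᵥ a = 0 := by
  have hxx : vecMulVec u v * vecMulVec u v = 0 := by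
    rw [vecMulVec_mul_vecMulVec, huv, zero_smul, vecMulVec_zero]
  have hx0 : (vecMulVec u v).trace = 0 := by rw [trace_vecMulVec, dotProduct_comm, huv]
  have hx : vecMulVec u v ≠ 0 := vecMulVec_ne_zero hu hv
  have hXX := hG.map_vecMulVec_sq hp huv
  have hX : G (vecMulVec u v) ≠ 0 := fun h => hx (hG.eq_zero hx0 h)
  have hcubic : ∀ y z : Matrix ι ι k, y.trace = 0 → z.trace = 0 →
      G (vecMulVec u v) * G y * G (vecMulVec u v) * G z * G (vecMulVec u v)
        + G (vecMulVec u v) * G z * G (vecMulVec u v) * G y * G (vecMulVec u v)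
      = (v ⬝ᵥ y *ᵥ u) • (G (vecMulVec u v) * G z * G (vecMulVec u v))
        + (v ⬝ᵥ z *ᵥ u) • (G (vecMulVec u v) * G y * G (vecMulVec u v)) := by
    intro y z hy hz
    have hsrc : vecMulVec u v * (y * (vecMulVec u v * z - z * vecMulVec u v)
          - (vecMulVec u v * z - z * vecMulVec u v) * y)
        - (y * (vecMulVec u v * z - z * vecMulVec u v)
          - (vecMulVec u v * z - z * vecMulVec u v) * y) * vecMulVec u v
        = (v ⬝ᵥ y *ᵥ u) • (vecMulVec u v * z - z * vecMulVec u v)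
          + (v ⬝ᵥ z *ᵥ u) • (vecMulVec u v * y - y * vecMulVec u v)
          + (v ⬝ᵥ (z * y - y * z) *ᵥ u) • vecMulVec u v := by
      have hs : ∀ s t : Matrix ι ι k, (v ⬝ᵥ s *ᵥ u) • (vecMulVec u v * t - t * vecMulVec u v)
          = vecMulVec u v * s * vecMulVec u v * t - t * (vecMulVec u v * s * vecMulVec u v) := by
        intro s t
        rw [vecMulVec_mul_mul_vecMulVec, Matrix.smul_mul, Matrix.mul_smul, smul_sub]
      rw [← vecMulVec_mul_mul_vecMulVec u v (z * y - y * z), hs, hs]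
      generalize vecMulVec u v = x at hxx
      have e : x * (y * (x * z - z * x) - (x * z - z * x) * y)
          - (y * (x * z - z * x) - (x * z - z * x) * y) * x
          = x * y * x * z - z * (x * y * x) + (x * z * x * y - y * (x * z * x))
            + x * (z * y - y * z) * x - x * x * z * y + y * z * (x * x) := by noncomm_ring
      rw [e, hxx]
      simp
    have himg := congr_arg G hsrc
    have t1 := trace_comm (vecMulVec u v) z
    have t2 := trace_comm y (vecMulVec u v * z - z * vecMulVec u v)
    have t3 := trace_comm (vecMulVec u v) y
    rw [hG.map_comm hx0 t2, hG.map_comm hy t1, hG.map_comm hx0 hz,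
      hG.map_add (by simp [-trace_sub, t1, t3]) (by simp [hx0]),
      hG.map_add (by rw [trace_smul, t1, smul_zero]) (by rw [trace_smul, t3, smul_zero]),
      hG.map_smul _ t1, hG.map_smul _ t3, hG.map_smul _ hx0, hG.map_comm hx0 hz,
      hG.map_comm hx0 hy] at himg
    generalize G (vecMulVec u v) = X at hXX himg
    have := congr_arg (fun M => X * M) himg
    simp only [mul_add, Matrix.mul_smul, hXX, smul_zero, add_zero] at this
    have e : X * (X * (G y * (X * G z - G z * X) - (X * G z - G z * X) * G y)
          - (G y * (X * G z - G z * X) - (X * G z - G z * X) * G y) * X)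
        = -(X * G y * X * G z * X + X * G z * X * G y * X)
          + X * X * (G y * (X * G z - G z * X) - (X * G z - G z * X) * G y)
          + X * G y * G z * (X * X) + X * X * G z * G y * X := by noncomm_ring
    rw [e, hXX] at this
    have e' : ∀ Y, X * (X * Y - Y * X) = X * X * Y - X * Y * X := fun Y => by noncomm_ring
    rw [e', e', hXX] at this
    simp only [zero_mul, mul_zero, add_zero, zero_sub, smul_neg] at this
    rw [← neg_add, neg_inj] at this
    exact this
  obtain ⟨Z, hZ, hXZ⟩ := exists_trace_eq_zero_mul_mul_eq_self hXX
  obtain ⟨z, hz, rfl⟩ := hG.surj hZ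
  have hlin : ∀ y : Matrix ι ι k, y.trace = 0 → (2 - v ⬝ᵥ z *ᵥ u) •
      (G (vecMulVec u v) * G y * G (vecMulVec u v)) = (v ⬝ᵥ y *ᵥ u) • G (vecMulVec u v) := by
    intro y hy
    have := hcubic y z hy hz
    have e : G (vecMulVec u v) * G y * G (vecMulVec u v) * G z * G (vecMulVec u v)
        = G (vecMulVec u v) * G y * (G (vecMulVec u v) * G z * G (vecMulVec u v)) := by
      noncomm_ring
    rw [e, hXZ, ← sub_eq_iff_eq_add] at this
    rw [← this, sub_smul, two_smul]
  have hne : 2 - v ⬝ᵥ z *ᵥ u ≠ 0 := by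
    intro h
    obtain ⟨y, hy, hxy⟩ := exists_trace_eq_zero_mul_mul_eq_self hxx
    have := hlin y hy
    rw [h, zero_smul, eq_comm, smul_eq_zero, or_iff_left hX] at this
    rw [vecMulVec_mul_mul_vecMulVec, this, zero_smul] at hxy
    exact hx hxy.symm
  obtain ⟨a, b, hab⟩ := exists_eq_vecMulVec hX hXX (fun Y hY => by
    obtain ⟨y, hy, rfl⟩ := hG.surj hY
    refine ⟨(2 - v ⬝ᵥ z *ᵥ u)⁻¹ * (v ⬝ᵥ y *ᵥ u), ?_⟩
    rw [mul_smul, ← hlin y hy, smul_smul, inv_mul_cancel₀ hne, one_smul])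
  rw [hab] at hX hXX
  refine ⟨a, b, hab, ?_, ?_, ?_⟩
  · rintro rfl; simp at hX
  · rintro rfl; simp at hX
  · rw [vecMulVec_mul_vecMulVec, vecMulVec_smul, smul_eq_zero, or_iff_left hX] at hXX
    exact hXX

theorem exists_map_single (hG : IsTraceZeroAut p G) (hp : p.Prime) [CharP k p] {i j : ι}
    (hij : i ≠ j) :
    ∃ a b : ι → k, G (single i j 1) = vecMulVec a b ∧ a ≠ 0 ∧ b ≠ 0 ∧ b ⬝ᵥ a = 0 := by
  rw [single_eq_single_vecMulVec_single]
  exact hG.exists_map_vecMulVec hp (by simp) (by simp) (by simp [hij.symm])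

/-- If `vecMulVec a b + vecMulVec a' b'` has rank one, then `a, a'` or `b, b'` are parallel. -/
theorem parallel_or_parallel_of_add_eq_vecMulVec {ι k : Type*} [Field k]
    {a b a' b' c d : ι → k} (ha : a' ≠ 0)
    (hb : b' ≠ 0) (h : vecMulVec a b + vecMulVec a' b' = vecMulVec c d) :
    (∃ t : k, a = t • a') ∨ ∃ t : k, b = t • b' := by
  have hpar : ∀ {x y : ι → k}, y ≠ 0 → (∀ i j, x i * y j = x j * y i) → ∃ t : k, x = t • y := by
    intro x y hy hxy
    obtain ⟨j, hj⟩ := Function.ne_iff.1 hy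
    refine ⟨x j / y j, funext fun i => ?_⟩
    rw [Pi.smul_apply, smul_eq_mul, div_mul_eq_mul_div, ← hxy i j, mul_div_cancel_right₀ _ hj]
  have hent : ∀ i j, a i * b j + a' i * b' j = c i * d j := fun i j =>
    congr_fun (congr_fun h i) j
  have hminor : ∀ i i' j j', (a i * a' i' - a i' * a' i) * (b j * b' j' - b j' * b' j) = 0 := by
    intro i i' j j'
    linear_combination (a i' * b j' + a' i' * b' j') * hent i j + c i * d j * hent i' j'
      - (a i' * b j + a' i' * b' j) * hent i j' - c i * d j' * hent i' j
  by_cases hA : ∀ i i', a i * a' i' = a i' * a' i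
  · exact Or.inl (hpar ha hA)
  · push Not at hA
    obtain ⟨i, i', hii⟩ := hA
    exact Or.inr (hpar hb fun j j' => sub_eq_zero.1
      ((mul_eq_zero.1 (hminor i i' j j')).resolve_left (sub_ne_zero.2 hii)))

/-- The images of the matrices `E_oj` share either their column space or their row space. -/
theorem exists_common_factor (hG : IsTraceZeroAut p G) (hp : p.Prime) [CharP k p] {o m : ι}
    (hm : m ≠ o) :
    (∃ (a : ι → k) (b : ι → ι → k), ∀ j, j ≠ o → G (single o j 1) = vecMulVec a (b j)) ∨
    (3 ≤ Fintype.card ι ∧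
      ∃ (a : ι → ι → k) (b : ι → k), ∀ j, j ≠ o → G (single o j 1) = vecMulVec (a j) b) := by
  have hex : ∀ j, ∃ a b : ι → k, j ≠ o →
      G (single o j 1) = vecMulVec a b ∧ a ≠ 0 ∧ b ≠ 0 := fun j => by
    by_cases hj : j = o
    · exact ⟨0, 0, fun h => absurd hj h⟩
    · obtain ⟨a, b, h, ha, hb, -⟩ := hG.exists_map_single hp (Ne.symm hj)
      exact ⟨a, b, fun _ => ⟨h, ha, hb⟩⟩
  choose a b hab using hex
  have hpair : ∀ i j, i ≠ o → j ≠ o → (∃ t : k, a i = t • a j) ∨ ∃ t : k, b i = t • b j := by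
    intro i j hi hj
    by_cases hij : i = j
    · exact Or.inl ⟨1, by rw [hij, one_smul]⟩
    obtain ⟨c, d, hcd, -⟩ := hG.exists_map_vecMulVec hp (u := Pi.single o (1 : k))
      (v := Pi.single i 1 + Pi.single j 1) (by simp)
      (fun h => by simpa [hij] using congr_fun h i) (by simp [hi, hj])
    rw [vecMulVec_add, ← single_eq_single_vecMulVec_single, ← single_eq_single_vecMulVec_single,
      hG.map_add (by simp [hi.symm]) (by simp [hj.symm]), (hab i hi).1, (hab j hj).1] at hcd
    exact parallel_or_parallel_of_add_eq_vecMulVec (hab j hj).2.1 (hab j hj).2.2 hcd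
  have hinv : ∀ {x y : ι → k} {t : k}, x ≠ 0 → x = t • y → y = t⁻¹ • x := by
    intro x y t hx h
    have ht : t ≠ 0 := by rintro rfl; simp at h; exact hx h
    rw [h, smul_smul, inv_mul_cancel₀ ht, one_smul]
  by_cases hA : ∀ i j, i ≠ o → j ≠ o → ∃ t : k, a i = t • a j
  · left
    have : ∀ i, ∃ t : k, i ≠ o → a i = t • a m := fun i => by
      by_cases hi : i = o
      · exact ⟨0, fun h => absurd hi h⟩
      · obtain ⟨t, ht⟩ := hA i m hi hm
        exact ⟨t, fun _ => ht⟩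
    choose t ht using this
    refine ⟨a m, fun j => t j • b j, fun j hj => ?_⟩
    rw [(hab j hj).1, vecMulVec_smul, ← smul_vecMulVec, ← ht j hj]
  · right
    push Not at hA
    obtain ⟨i, j, hi, hj, hij⟩ := hA
    have hne : i ≠ j := by
      rintro rfl
      exact hij 1 (one_smul _ _).symm
    refine ⟨?_, ?_⟩
    · have : ({o, i, j} : Finset ι).card = 3 := by
        rw [Finset.card_eq_three]
        exact ⟨o, i, j, hi.symm, hj.symm, hne, rfl⟩
      rw [← this]
      exact Finset.card_le_univ _
    have hB : ∀ l, ∃ t : k, l ≠ o → b l = t • b i := fun l => by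
      by_cases hl : l = o
      · exact ⟨0, fun h => absurd hl h⟩
      rcases hpair l i hl hi with ⟨s, hs⟩ | ⟨s, hs⟩
      · obtain ⟨r, hr⟩ := (hpair i j hi hj).resolve_left (fun ⟨t, ht⟩ => hij t ht)
        obtain ⟨q, hq⟩ := (hpair l j hl hj).resolve_left (fun ⟨t, ht⟩ => hij (s⁻¹ * t) (by
          rw [hinv (hab l hl).2.1 hs, ht, smul_smul]))
        exact ⟨q * r⁻¹, fun _ => by rw [hq, hinv (hab i hi).2.2 hr, smul_smul]⟩
      · exact ⟨s, fun _ => hs⟩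
    choose t ht using hB
    refine ⟨fun j => t j • a j, b i, fun j hj => ?_⟩
    rw [(hab j hj).1, smul_vecMulVec, ← vecMulVec_smul, ← ht j hj]

/-- The images of the `E_lo`, normalized so as to be dual to the images `vecMulVec a (b j)`
of the `E_oj`. -/
theorem exists_dual_factor (hG : IsTraceZeroAut p G) (hp : p.Prime) [CharP k p] {o : ι}
    {a : ι → k} {b : ι → ι → k} (hab : ∀ j, j ≠ o → G (single o j 1) = vecMulVec a (b j))
    {l : ι} (hl : l ≠ o) :
    ∃ c d : ι → k, G (single l o 1) = vecMulVec c d ∧ d ⬝ᵥ a = 1 ∧ d ⬝ᵥ c = 0 ∧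
      ∀ j, j ≠ o → b j ⬝ᵥ c = if j = l then 1 else 0 := by
  have hba : ∀ j, j ≠ o → vecMulVec a (b j) ≠ 0 ∧ b j ⬝ᵥ a = 0 := by
    intro j hj
    obtain ⟨a', b', h, ha', hb', hab'⟩ := hG.exists_map_single hp (Ne.symm hj)
    have hne : vecMulVec a (b j) ≠ 0 := by
      rw [← hab j hj, h]; exact vecMulVec_ne_zero ha' hb'
    refine ⟨hne, ?_⟩
    have hsq : vecMulVec a (b j) * vecMulVec a (b j) = 0 := by
      rw [← hab j hj, h, vecMulVec_mul_vecMulVec, hab', zero_smul, vecMulVec_zero]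
    rwa [vecMulVec_mul_vecMulVec, vecMulVec_smul, smul_eq_zero, or_iff_left hne] at hsq
  obtain ⟨c, d, hcd, -, -, hdc⟩ := hG.exists_map_single hp hl
  have tol : ∀ j, j ≠ o → (single o j (1 : k)).trace = 0 := fun j hj => by simp [Ne.symm hj]
  have tlo : (single l o (1 : k)).trace = 0 := by simp [hl]
  have hXX : ∀ i j, i ≠ o → vecMulVec a (b i) * vecMulVec a (b j) = 0 := fun i j hi => by
    rw [vecMulVec_mul_vecMulVec, (hba i hi).2, zero_smul, vecMulVec_zero]
  have hYY : vecMulVec c d * vecMulVec c d = 0 := by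
    rw [vecMulVec_mul_vecMulVec, hdc, zero_smul, vecMulVec_zero]
  have hXYX : ∀ i j, vecMulVec a (b i) * vecMulVec c d * vecMulVec a (b j)
      = ((b i ⬝ᵥ c) * (d ⬝ᵥ a)) • vecMulVec a (b j) := fun i j => by
    rw [vecMulVec_mul_vecMulVec, vecMulVec_smul, Matrix.smul_mul, vecMulVec_mul_vecMulVec,
      vecMulVec_smul, smul_smul]
  have hcomm : ∀ i, i ≠ o → vecMulVec a (b i) * (vecMulVec c d * vecMulVec a (b l)
        - vecMulVec a (b l) * vecMulVec c d)
      - (vecMulVec c d * vecMulVec a (b l) - vecMulVec a (b l) * vecMulVec c d)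
        * vecMulVec a (b i)
      = ((b i ⬝ᵥ c) * (d ⬝ᵥ a)) • vecMulVec a (b l)
        + ((b l ⬝ᵥ c) * (d ⬝ᵥ a)) • vecMulVec a (b i) := by
    intro i hi
    rw [← hXYX, ← hXYX]
    have e : ∀ x y z : Matrix ι ι k, x * (y * z - z * y) - (y * z - z * y) * x
      = x * y * z + z * y * x - x * z * y - y * (z * x) := fun x y z => by noncomm_ring
    rw [e, hXX i l hi, hXX l i hl]
    simp
  have hsrc : ∀ i, i ≠ o → ((b i ⬝ᵥ c) * (d ⬝ᵥ a)) • vecMulVec a (b l)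
        + ((b l ⬝ᵥ c) * (d ⬝ᵥ a)) • vecMulVec a (b i)
      = G (single o i 1 * (single l o 1 * single o l 1 - single o l 1 * single l o 1)
        - (single l o 1 * single o l 1 - single o l 1 * single l o 1) * single o i 1) := by
    intro i hi
    rw [hG.map_comm (tol i hi) (trace_comm _ _), hG.map_comm tlo (tol l hl), hab i hi, hab l hl,
      hcd, hcomm i hi]
  have hdiag : (b l ⬝ᵥ c) * (d ⬝ᵥ a) = 1 := by
    rcases eq_or_ne (2 : k) 0 with h2 | h2
    · have hp2 : p = 2 := by
        have := (CharP.cast_eq_zero_iff k p 2).1 (by exact_mod_cast h2)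
        rwa [Nat.prime_dvd_prime_iff_eq hp Nat.prime_two] at this
      subst hp2
      have : CharP (Matrix ι ι k) 2 := by
        have : Nonempty ι := ⟨o⟩
        infer_instance
      have hneg : ∀ x y : Matrix ι ι k, x - y = x + y := CharTwo.sub_eq_add
      set H : Matrix ι ι k := single o l 1 * single l o 1 - single l o 1 * single o l 1 with hH
      have htH : H.trace = 0 := trace_comm _ _
      have hH0 : H ≠ 0 := by
        intro h
        have := congr_fun (congr_fun h o) o
        simp [hH, hl] at this
      have hHH : H ^ 2 = H := by
        rw [sq, hH, hneg]
        simp [add_mul, mul_add, hl, hl.symm]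
      have hGH : G H = vecMulVec a (b l) * vecMulVec c d + vecMulVec c d * vecMulVec a (b l) := by
        rw [hH, hG.map_comm (tol l hl) tlo, hab l hl, hcd, hneg]
      have hGHH : G H ^ 2 = ((b l ⬝ᵥ c) * (d ⬝ᵥ a)) • G H := by
        rw [hGH, smul_add, ← Matrix.smul_mul, ← Matrix.mul_smul, ← hXYX]
        have e : ∀ x y : Matrix ι ι k, (x * y + y * x) ^ 2
          = x * y * x * y + y * (x * y * x) + x * (y * y) * x + y * (x * x) * y := fun x y => by
            noncomm_ring
        rw [e, hXX l l hl, hYY]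
        simp
      rw [← hG.map_pow htH (by rw [hHH, htH]), hHH] at hGHH
      have : (1 - (b l ⬝ᵥ c) * (d ⬝ᵥ a)) • G H = 0 := by
        rw [sub_smul, one_smul, ← hGHH, sub_self]
      rcases smul_eq_zero.1 this with h | h
      · exact (sub_eq_zero.1 h).symm
      · exact absurd (hG.eq_zero htH h) hH0
    · have h := hsrc l hl
      have e : single o l (1 : k) * (single l o 1 * single o l 1 - single o l 1 * single l o 1)
        - (single l o 1 * single o l 1 - single o l 1 * single l o 1) * single o l 1
        = (2 : k) • single o l 1 := by
        simp [mul_sub, sub_mul, hl, two_smul]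
      rw [e, hG.map_smul _ (tol l hl), hab l hl, ← add_smul, ← two_mul] at h
      have := smul_left_injective k (hba l hl).1 h
      exact mul_left_cancel₀ h2 (by simpa using this)
  have hoff : ∀ i, i ≠ o → i ≠ l → (b i ⬝ᵥ c) * (d ⬝ᵥ a) = 0 := by
    intro i hi hil
    have h := hsrc i hi
    have e : single o i (1 : k) * (single l o 1 * single o l 1 - single o l 1 * single l o 1)
      - (single l o 1 * single o l 1 - single o l 1 * single l o 1) * single o i 1
      = single o i 1 := by
      simp [mul_sub, sub_mul, hl, hi, hil]
    rw [e, hab i hi, hdiag, one_smul, add_eq_right, smul_eq_zero, or_iff_left (hba l hl).1] at h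
    exact h
  have hda : d ⬝ᵥ a ≠ 0 := right_ne_zero_of_mul_eq_one hdiag
  refine ⟨(d ⬝ᵥ a) • c, (d ⬝ᵥ a)⁻¹ • d, ?_, ?_, ?_, ?_⟩
  · rw [hcd, smul_vecMulVec, vecMulVec_smul, smul_smul, mul_inv_cancel₀ hda, one_smul]
  · rw [smul_dotProduct, smul_eq_mul, inv_mul_cancel₀ hda]
  · simp [hdc]
  · intro j hj
    rw [dotProduct_smul, smul_eq_mul, mul_comm]
    split_ifs with h
    · rw [h, hdiag]
    · exact hoff j hj h

/-- An automorphism for which the images of the `E_oj` share their column space is a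
conjugation. -/
theorem exists_conj_of_common_left (hG : IsTraceZeroAut p G) (hp : p.Prime) [CharP k p] {o m : ι}
    (hm : m ≠ o) {a : ι → k} {b : ι → ι → k}
    (hab : ∀ j, j ≠ o → G (single o j 1) = vecMulVec a (b j)) :
    ∃ Q R : Matrix ι ι k, R * Q = 1 ∧ ∀ x, x.trace = 0 → G x = Q * x * R := by
  have hex : ∀ l, ∃ c d : ι → k, l ≠ o → G (single l o 1) = vecMulVec c d ∧ d ⬝ᵥ a = 1 ∧
      d ⬝ᵥ c = 0 ∧ ∀ j, j ≠ o → b j ⬝ᵥ c = if j = l then 1 else 0 := fun l => by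
    by_cases hl : l = o
    · exact ⟨0, 0, fun h => absurd hl h⟩
    · obtain ⟨c, d, h⟩ := hG.exists_dual_factor hp hab hl
      exact ⟨c, d, fun _ => h⟩
  choose c d hcd using hex
  have hba : ∀ j, j ≠ o → b j ⬝ᵥ a = 0 := by
    intro j hj
    have h := hG.trace_eq (x := single o j 1) (by simp [Ne.symm hj])
    rwa [hab j hj, trace_vecMulVec, dotProduct_comm] at h
  have hdc : ∀ i j, i ≠ o → j ≠ o → d i ⬝ᵥ c j = 0 := by
    intro i j hi hj
    by_cases hij : i = j
    · rw [hij]; exact (hcd j hj).2.2.1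
    have h := hG.map_comm (x := single i o 1) (y := single j o 1) (by simp [hi]) (by simp [hj])
    rw [single_mul_single_of_ne _ _ _ _ (Ne.symm hj), single_mul_single_of_ne _ _ _ _ (Ne.symm hi),
      sub_self, hG.map_zero, (hcd i hi).1, (hcd j hj).1, vecMulVec_mul_vecMulVec,
      vecMulVec_mul_vecMulVec, eq_comm, sub_eq_zero] at h
    have h' := congr_arg (fun M => b i ⬝ᵥ M *ᵥ a) h
    simpa [vecMulVec_smul, smul_mulVec, vecMulVec_mulVec, (hcd i hi).2.1, (hcd j hj).2.1,
      (hcd i hi).2.2.2 i hi,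
      (hcd j hj).2.2.2 i hi, hij] using h'
  let B : Matrix ι ι k := of fun i => if i = o then d m else b i
  let C : Matrix ι ι k := of fun i => if i = o then a else c i
  have hBo : B o = d m := if_pos rfl
  have hCo : C o = a := if_pos rfl
  have hBi : ∀ i, i ≠ o → B i = b i := fun i hi => if_neg hi
  have hCi : ∀ i, i ≠ o → C i = c i := fun i hi => if_neg hi
  have hRQ : B * Cᵀ = 1 := by
    ext i j
    have e : (B * Cᵀ) i j = B i ⬝ᵥ C j := rfl
    rw [e, one_apply]
    by_cases hi : i = o <;> by_cases hj : j = o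
    · rw [hi, hj, hBo, hCo, if_pos rfl, (hcd m hm).2.1]
    · rw [hi, hBo, hCi j hj, hdc m j hm hj, if_neg (Ne.symm hj)]
    · rw [hj, hBi i hi, hCo, hba i hi, if_neg hi]
    · rw [hBi i hi, hCi j hj, (hcd j hj).2.2.2 i hi]
  have hQR : Cᵀ * B = 1 := mul_eq_one_comm.1 hRQ
  have hd : ∀ i, i ≠ o → d i = B o := by
    intro i hi
    have h : d i ᵥ* Cᵀ = B o ᵥ* Cᵀ := by
      ext j
      have e : ∀ v : ι → k, (v ᵥ* Cᵀ) j = v ⬝ᵥ C j := fun v => rfl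
      rw [e, e, hBo]
      by_cases hj : j = o
      · rw [hj, hCo, (hcd i hi).2.1, (hcd m hm).2.1]
      · rw [hCi j hj, hdc i j hi hj, hdc m j hm hj]
    have := congr_arg (fun v => v ᵥ* B) h
    simpa [vecMul_vecMul, hQR] using this
  have hrow : ∀ j, j ≠ o → G (single o j 1) = Cᵀ * single o j 1 * B := fun j hj => by
    rw [hab j hj, single_eq_single_vecMulVec_single, mul_vecMulVec, vecMulVec_mul]
    simp [hCo, hBi j hj, Matrix.row_def]
  have hcol : ∀ i, i ≠ o → G (single i o 1) = Cᵀ * single i o 1 * B := fun i hi => by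
    rw [(hcd i hi).1, hd i hi, single_eq_single_vecMulVec_single, mul_vecMulVec, vecMulVec_mul]
    simp [hCi i hi, Matrix.row_def]
  have hconj : ∀ x y : Matrix ι ι k, Cᵀ * (x * y - y * x) * B
      = Cᵀ * x * B * (Cᵀ * y * B) - Cᵀ * y * B * (Cᵀ * x * B) := by
    intro x y
    have e : ∀ z w, Cᵀ * z * B * (Cᵀ * w * B) = Cᵀ * (z * w) * B := fun z w => by
      calc Cᵀ * z * B * (Cᵀ * w * B) = Cᵀ * z * (B * Cᵀ) * w * B := by noncomm_ring
        _ = Cᵀ * (z * w) * B := by rw [hRQ, Matrix.mul_one, Matrix.mul_assoc Cᵀ z w]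
    rw [e, e, mul_sub, sub_mul]
  refine ⟨Cᵀ, B, hRQ, fun x hx => ?_⟩
  let W : Submodule k (Matrix ι ι k) :=
    { carrier := {x | x.trace = 0 ∧ G x = Cᵀ * x * B}
      add_mem' := fun {x y} hx hy => ⟨by rw [trace_add, hx.1, hy.1, add_zero], by
        rw [hG.map_add hx.1 hy.1, hx.2, hy.2, mul_add, add_mul]⟩
      zero_mem' := ⟨by simp, by simp [hG.map_zero]⟩
      smul_mem' := fun t x hx => ⟨by rw [trace_smul, hx.1, smul_zero], by
        rw [hG.map_smul t hx.1, hx.2, Matrix.mul_smul, Matrix.smul_mul]⟩ }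
  have hWcomm : ∀ {x y}, x ∈ W → y ∈ W → x * y - y * x ∈ W := fun {x y} hx hy =>
    ⟨trace_comm _ _, by rw [hG.map_comm hx.1 hy.1, hx.2, hy.2, hconj]⟩
  have hWrow : ∀ j, j ≠ o → single o j (1 : k) ∈ W := fun j hj =>
    ⟨by simp [Ne.symm hj], hrow j hj⟩
  have hWcol : ∀ j, j ≠ o → single j o (1 : k) ∈ W := fun j hj => ⟨by simp [hj], hcol j hj⟩
  have hxW : x ∈ W := by
    refine Matrix.mem_of_trace_eq_zero W o (fun i j hij => ?_) (fun i => ?_) hx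
    · by_cases hi : i = o
      · subst hi
        exact hWrow j (Ne.symm hij)
      · by_cases hj : j = o
        · subst hj
          exact hWcol i hi
        · have := hWcomm (hWcol i hi) (hWrow j hj)
          simpa [hij.symm] using this
    · by_cases hi : i = o
      · simp [hi]
      · have := hWcomm (hWcol i hi) (hWrow i hi)
        simpa using this
  exact hxW.2

/-- An automorphism of the trace-zero matrices is a conjugation or the negative of a conjugated
transposition. -/
theorem exists_conj_or_neg_transpose (hG : IsTraceZeroAut p G) (hp : p.Prime) [CharP k p]
    [Nontrivial ι] :
    ∃ Q R : Matrix ι ι k, R * Q = 1 ∧ ((∀ x, x.trace = 0 → G x = Q * x * R) ∨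
      (3 ≤ Fintype.card ι ∧ ∀ x, x.trace = 0 → G x = -(Q * xᵀ * R))) := by
  obtain ⟨m, o, hm⟩ := exists_pair_ne ι
  rcases hG.exists_common_factor hp hm with ⟨a, b, hab⟩ | ⟨h3, a, b, hab⟩
  · obtain ⟨Q, R, hRQ, h⟩ := hG.exists_conj_of_common_left hp hm hab
    exact ⟨Q, R, hRQ, Or.inl h⟩
  · obtain ⟨Q, R, hRQ, h⟩ := (hG.neg_transpose hp).exists_conj_of_common_left hp hm
      (a := b) (b := fun j => -a j) (fun j hj => by
        rw [hab j hj, transpose_vecMulVec, vecMulVec_neg])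
    refine ⟨Rᵀ, Qᵀ, by rw [← transpose_mul, hRQ, transpose_one], Or.inr ⟨h3, fun x hx => ?_⟩⟩
    rw [← transpose_transpose (G x), ← neg_neg (G x)ᵀ, h x hx]
    simp [Matrix.mul_assoc]

end IsTraceZeroAut

end SlAut

section GlAut

variable {k : Type*} [Field k] {n p : ℕ}

local notation "M" => Matrix (Fin n) (Fin n) k

theorem mem_slMod {x : M} : x ∈ slMod n k ↔ x.trace = 0 := Iff.rfl

theorem IsRAutGl.comp {f g : M → M} (hf : IsRAutGl n k p f) (hg : IsRAutGl n k p g) :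
    IsRAutGl n k p (f ∘ g) := by
  obtain ⟨f1, f2, f3, f4⟩ := hf
  obtain ⟨g1, g2, g3, g4⟩ := hg
  refine ⟨f1.comp g1, (f2.mk'.comp g2.mk').isLinear, fun x y => ?_, fun x => ?_⟩
  · simp [g3, f3]
  · simp [g4, f4]

theorem IsRAutGl.trace_eq_zero (hn : 0 < n) {f : M → M} (hf : IsRAutGl n k p f) {x : M}
    (hx : x.trace = 0) : (f x).trace = 0 := by
  obtain ⟨-, hlin, hcomm, -⟩ := hf
  have h : ∀ y z : M, y * z - z * y ∈ (slMod n k).comap hlin.mk' := fun y z => by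
    change (f (y * z - z * y)).trace = 0
    rw [hcomm, trace_comm]
  refine Matrix.mem_of_trace_eq_zero ((slMod n k).comap hlin.mk') ⟨0, hn⟩
    (fun i j hij => ?_) (fun i => ?_) hx
  · simpa [hij.symm] using h (single i i 1) (single i j 1)
  · simpa using h (single i ⟨0, hn⟩ 1) (single ⟨0, hn⟩ i 1)

theorem IsRAutGl.exists_restrict (hn : 0 < n) {f : M → M} (hf : IsRAutGl n k p f) :
    ∃ g : {g // IsRAutSl n k p g}, ∀ x : slMod n k, f x = (g.1 x : M) := by
  let F : M →ₗ[k] M := IsLinearMap.mk' f hf.2.1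
  have hmaps : ∀ x ∈ slMod n k, F x ∈ slMod n k := fun x hx => hf.trace_eq_zero hn hx
  have hinj : Function.Injective (F.restrict hmaps) := fun x y h =>
    Subtype.ext (hf.1.1 (congr_arg Subtype.val h))
  refine ⟨⟨F.restrict hmaps, ⟨hinj, LinearMap.injective_iff_surjective.1 hinj⟩,
    LinearMap.isLinear _, fun x y z h => ?_, fun x z h => ?_⟩, fun x => rfl⟩
  · change f z = f x * f y - f y * f x
    rw [h, hf.2.2.1]
  · change f z = f x ^ p
    rw [h, hf.2.2.2]

theorem IsRAutSl.exists_isTraceZeroAut {g : slMod n k → slMod n k} (hg : IsRAutSl n k p g) :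
    ∃ G : M → M, IsTraceZeroAut p G ∧ ∀ x : slMod n k, G x = g x := by
  classical
  obtain ⟨hbij, hlin, hcomm, hpow⟩ := hg
  have hG : ∀ {x : M} (hx : x.trace = 0),
      (if h : x.trace = 0 then (g ⟨x, h⟩ : M) else 0) = g ⟨x, hx⟩ := fun hx => dif_pos hx
  refine ⟨fun x => if h : x.trace = 0 then (g ⟨x, h⟩ : M) else 0, ?_, fun x => hG x.2⟩
  constructor
  · intro x hx
    rw [hG hx]
    exact (g _).2
  · intro x y hx hy
    rw [hG hx, hG hy, hG (by rw [trace_add, hx, hy, add_zero])]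
    exact congr_arg Subtype.val (hlin.map_add ⟨x, hx⟩ ⟨y, hy⟩)
  · intro c x hx
    rw [hG hx, hG (by rw [trace_smul, hx, smul_zero])]
    exact congr_arg Subtype.val (hlin.map_smul c ⟨x, hx⟩)
  · intro x hx h
    rw [hG hx] at h
    have := hbij.1 ((Subtype.ext h : g ⟨x, hx⟩ = 0).trans hlin.map_zero.symm)
    exact congr_arg Subtype.val this
  · intro y hy
    obtain ⟨x, hx⟩ := hbij.2 ⟨y, hy⟩
    exact ⟨x, x.2, by rw [hG x.2, hx]⟩
  · intro x y hx hy
    rw [hG hx, hG hy, hG (trace_comm _ _)]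
    exact hcomm ⟨x, hx⟩ ⟨y, hy⟩ ⟨x * y - y * x, mem_slMod.2 (trace_comm x y)⟩ rfl
  · intro x hx hxp
    rw [hG hx, hG hxp]
    exact hpow ⟨x, hx⟩ ⟨_, hxp⟩ rfl

/-- Conjugations and, in size at least three, negatives of conjugated transpositions. -/
def IsStandardAut (s : M → M) : Prop :=
  ∃ Q R : M, R * Q = 1 ∧ ((∀ x, s x = Q * x * R) ∨ (3 ≤ n ∧ ∀ x, s x = -(Q * xᵀ * R)))

theorem IsStandardAut.id : IsStandardAut (id : M → M) := ⟨1, 1, by simp, Or.inl (by simp)⟩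

theorem IsStandardAut.comp {s t : M → M} (hs : IsStandardAut s) (ht : IsStandardAut t) :
    IsStandardAut (s ∘ t) := by
  obtain ⟨Q, R, hRQ, hs⟩ := hs
  obtain ⟨Q', R', hRQ', ht⟩ := ht
  have hQR' : (Q'ᵀ : M) * R'ᵀ = 1 := by rw [← transpose_mul, hRQ', transpose_one]
  rcases hs with hs | ⟨h3, hs⟩
  · refine ⟨Q * Q', R' * R, by rw [Matrix.mul_assoc, ← Matrix.mul_assoc R, hRQ, one_mul, hRQ'], ?_⟩
    rcases ht with ht | ⟨h3, ht⟩
    · exact Or.inl fun x => by simp [hs, ht, Matrix.mul_assoc]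
    · exact Or.inr ⟨h3, fun x => by simp [hs, ht, Matrix.mul_assoc]⟩
  · refine ⟨Q * R'ᵀ, Q'ᵀ * R, by rw [Matrix.mul_assoc, ← Matrix.mul_assoc R, hRQ, one_mul, hQR'], ?_⟩
    rcases ht with ht | ⟨h3, ht⟩
    · exact Or.inr ⟨h3, fun x => by simp [hs, ht, Matrix.mul_assoc]⟩
    · exact Or.inl fun x => by simp [hs, ht, Matrix.mul_assoc]

theorem IsStandardAut.exists_inverse {s : M → M} (hs : IsStandardAut s) :
    ∃ t : M → M, IsStandardAut t ∧ (∀ x, t (s x) = x) ∧ ∀ x, s (t x) = x := by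
  obtain ⟨Q, R, hRQ, hs⟩ := hs
  have hQR : Q * R = 1 := mul_eq_one_comm.1 hRQ
  rcases hs with hs | ⟨h3, hs⟩
  · refine ⟨fun x => R * x * Q, ⟨R, Q, hQR, Or.inl fun x => rfl⟩, fun x => ?_, fun x => ?_⟩
    · change R * s x * Q = x
      rw [hs, show R * (Q * x * R) * Q = R * Q * x * (R * Q) by noncomm_ring, hRQ, one_mul, mul_one]
    · rw [hs, show Q * (R * x * Q) * R = Q * R * x * (Q * R) by noncomm_ring, hQR, one_mul, mul_one]
  · have hQR' : (Qᵀ : M) * Rᵀ = 1 := by rw [← transpose_mul, hRQ, transpose_one]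
    have hRQ' : (Rᵀ : M) * Qᵀ = 1 := by rw [← transpose_mul, hQR, transpose_one]
    refine ⟨fun x => -(Qᵀ * xᵀ * Rᵀ), ⟨Qᵀ, Rᵀ, hRQ', Or.inr ⟨h3, fun x => rfl⟩⟩,
      fun x => ?_, fun x => ?_⟩
    · simp only [hs, transpose_neg, transpose_mul, transpose_transpose]
      rw [show -(Qᵀ * -(Rᵀ * (x * Qᵀ)) * Rᵀ) = Qᵀ * Rᵀ * x * (Qᵀ * Rᵀ) by noncomm_ring, hQR',
        one_mul, mul_one]
    · simp only [hs, transpose_neg, transpose_mul, transpose_transpose]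
      rw [show -(Q * -(R * (x * Q)) * R) = Q * R * x * (Q * R) by noncomm_ring, hQR,
        one_mul, mul_one]

theorem IsStandardAut.isLinearMap {s : M → M} (hs : IsStandardAut s) : IsLinearMap k s := by
  obtain ⟨Q, R, -, hs | ⟨-, hs⟩⟩ := hs
  · exact ⟨fun x y => by simp [hs, mul_add, add_mul], fun c x => by simp [hs]⟩
  · exact ⟨fun x y => by simp [hs, mul_add, add_mul, add_comm], fun c x => by simp [hs]⟩

theorem IsStandardAut.isRAutGl (hp : p.Prime) [CharP k p] {s : M → M} (hs : IsStandardAut s) :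
    IsRAutGl n k p s := by
  obtain ⟨t, -, hts, hst⟩ := hs.exists_inverse
  refine ⟨⟨Function.LeftInverse.injective hts, Function.RightInverse.surjective hst⟩,
    hs.isLinearMap, ?_⟩
  obtain ⟨Q, R, hRQ, hs⟩ := hs
  have hmul : ∀ x y, Q * x * R * (Q * y * R) = Q * (x * y) * R := fun x y => by
    rw [show Q * x * R * (Q * y * R) = Q * x * (R * Q) * y * R by noncomm_ring, hRQ, mul_one,
      Matrix.mul_assoc Q x y]
  have hpow : ∀ x, ∀ m : ℕ, (Q * x * R) ^ m = Q * x ^ m * R := by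
    intro x m
    induction m with
    | zero => simp [mul_eq_one_comm.1 hRQ]
    | succ m ih => rw [pow_succ, ih, hmul, pow_succ]
  rcases hs with hs | ⟨h3, hs⟩
  · refine ⟨fun x y => ?_, fun x => ?_⟩
    · simp only [hs, hmul, mul_sub, sub_mul]
    · rw [hs, hs, hpow]
  · refine ⟨fun x y => ?_, fun x => ?_⟩
    · simp only [hs, transpose_sub, transpose_mul, neg_mul_neg, hmul, mul_sub, sub_mul, neg_sub]
    · have : Fact p.Prime := ⟨hp⟩
      have : Nonempty (Fin n) := ⟨⟨0, by omega⟩⟩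
      have hodd : (-1 : M) ^ p = -1 := neg_one_pow_expChar _ p
      rw [hs, hs, neg_pow _ p, hodd, neg_one_mul, hpow, transpose_pow]

theorem IsStandardAut.exists_scalar {s : M → M} (hs : IsStandardAut s) :
    ∃ e : k, s 1 = e • (1 : M) ∧ ∀ x, (s x).trace = e * x.trace := by
  obtain ⟨Q, R, hRQ, hs⟩ := hs
  have hQR : Q * R = 1 := mul_eq_one_comm.1 hRQ
  have htr : ∀ x : M, (Q * x * R).trace = x.trace := fun x => by
    rw [trace_mul_comm, ← Matrix.mul_assoc, hRQ, one_mul]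
  rcases hs with hs | ⟨-, hs⟩
  · exact ⟨1, by simp [hs, hQR], fun x => by rw [hs, htr, one_mul]⟩
  · exact ⟨-1, by simp [hs, hQR], fun x => by simp [hs, htr]⟩

theorem IsStandardAut.eq_self (hn : 2 ≤ n) {s : M → M} (hs : IsStandardAut s)
    (h : ∀ x : M, x.trace = 0 → s x = x) (x : M) : s x = x := by
  let i : Fin n := ⟨0, by omega⟩
  let j : Fin n := ⟨1, by omega⟩
  have hij : i ≠ j := by simp [i, j]
  have hi : s (single i i 1) = single i i 1 := by
    have hs' := hs
    obtain ⟨Q, R, hRQ, hs | ⟨h3, hs⟩⟩ := hs'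
    · have hmul : s (single i j 1 * single j i 1) = s (single i j 1) * s (single j i 1) := by
        rw [hs, hs, hs, show ∀ x y, Q * x * R * (Q * y * R) = Q * (x * (R * Q) * y) * R from
          fun x y => by noncomm_ring, hRQ, mul_one]
      rw [h (single i j 1) (by simp [hij]), h (single j i 1) (by simp [hij.symm])] at hmul
      simpa using hmul
    · exfalso
      let l : Fin n := ⟨2, by omega⟩
      have hil : i ≠ l := by simp [i, l]
      have hjl : j ≠ l := by simp [j, l]
      have hmul : s (single i j 1 * single j l 1) = -(s (single j l 1) * s (single i j 1)) := by
        simp only [hs, transpose_mul, neg_mul_neg]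
        rw [show ∀ x y, Q * x * R * (Q * y * R) = Q * (x * (R * Q) * y) * R from
          fun x y => by noncomm_ring, hRQ, mul_one]
      rw [h (single i j 1) (by simp [hij]), h (single j l 1) (by simp [hjl]),
        single_mul_single_same, h _ (by simp [hil])] at hmul
      simpa [hil.symm] using congr_fun (congr_fun hmul i) l
  have hx := h (x - x.trace • single i i 1) (by simp)
  rw [hs.isLinearMap.map_sub, hs.isLinearMap.map_smul, hi] at hx
  exact sub_left_injective hx



/-- The map `x ↦ x + lam (tr x) I`. -/
def shear (lam : k) (x : M) : M := x + (lam * x.trace) • (1 : M)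

theorem shear_of_trace_eq_zero (lam : k) {x : M} (hx : x.trace = 0) : shear lam x = x := by
  simp [shear, hx]

theorem trace_shear (hn0 : (n : k) = 0) (lam : k) (x : M) : (shear lam x).trace = x.trace := by
  simp [shear, hn0]

theorem shear_shear (hn0 : (n : k) = 0) (lam mu : k) (x : M) :
    shear lam (shear mu x) = shear (lam + mu) x := by
  rw [shear, trace_shear hn0, shear, shear, add_assoc, ← add_smul]
  ring_nf

theorem shear_zero (x : M) : shear 0 x = x := by simp [shear]

theorem add_smul_one_pow_char [Fact p.Prime] [CharP k p] (x : M) (c : k) :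
    (x + c • (1 : M)) ^ p = x ^ p + c ^ p • (1 : M) := by
  rcases isEmpty_or_nonempty (Fin n) with h | h
  · exact Subsingleton.elim _ _
  · rw [add_pow_char_of_commute _ ((Commute.one_right x).smul_right c), smul_pow, one_pow]

theorem isRAutGl_shear [Fact p.Prime] [CharP k p] (hn : 0 < n) (hn0 : (n : k) = 0) {lam : k}
    (hlam : lam ^ p = lam) : IsRAutGl n k p (shear lam) := by
  have hinv : ∀ mu nu : k, mu + nu = 0 → ∀ x : M, shear mu (shear nu x) = x := fun mu nu h x => by
    rw [shear_shear hn0, h, shear_zero]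
  refine ⟨⟨Function.LeftInverse.injective (hinv (-lam) lam (by simp)),
    Function.RightInverse.surjective (hinv lam (-lam) (by simp))⟩, ⟨fun x y => ?_, fun c x => ?_⟩,
    fun x y => ?_, fun x => ?_⟩
  · simp only [shear, trace_add, mul_add, add_smul]
    abel
  · simp only [shear, trace_smul, smul_add, smul_smul, smul_eq_mul]
    ring_nf
  · rw [shear_of_trace_eq_zero _ (trace_comm x y)]
    simp only [shear, add_mul, mul_add, smul_mul_assoc, mul_smul_comm, one_mul, mul_one, smul_add,
      smul_comm (lam * y.trace) (lam * x.trace)]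
    abel
  · have : Nonempty (Fin n) := ⟨⟨0, hn⟩⟩
    rw [shear, shear, add_smul_one_pow_char, mul_pow, hlam, Matrix.trace_pow_char]

theorem IsRAutGl.exists_eq_shear [Fact p.Prime] [CharP k p] (hn : 2 ≤ n) {f : M → M}
    (hf : IsRAutGl n k p f) (hfix : ∀ x : M, x.trace = 0 → f x = x) :
    ∃ lam : k, lam ^ p = lam ∧ ∀ x : M, f x = shear lam x := by
  obtain ⟨-, hlin, hcomm, hpow⟩ := hf
  let o : Fin n := ⟨0, by omega⟩
  let j : Fin n := ⟨1, by omega⟩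
  have hoj : o ≠ j := by simp [o, j]
  have hscalar : f (single o o 1) - single o o 1 ∈ Set.range (scalar (Fin n)) := by
    refine mem_range_scalar_of_commute_single fun i l hil => ?_
    have h := hcomm (single o o 1) (single i l 1)
    rw [hfix _ (trace_comm _ _), hfix (single i l 1) (by simp [hil])] at h
    refine sub_eq_zero.1 ?_
    rw [mul_sub, sub_mul, sub_sub_sub_comm, sub_eq_zero, ← neg_sub, ← h, neg_sub]
  obtain ⟨lam, hlam⟩ := hscalar
  have ho : f (single o o 1) = single o o 1 + lam • (1 : M) := by
    rw [← sub_eq_iff_eq_add', ← hlam, scalar_apply, smul_one_eq_diagonal]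
  refine ⟨lam, ?_, fun x => ?_⟩
  · have h := hpow (single o o 1)
    have hidem : (single o o 1 : M) ^ p = single o o 1 :=
      IsIdempotentElem.pow_eq (by simp [IsIdempotentElem]) (Nat.Prime.ne_zero Fact.out)
    rw [ho, add_smul_one_pow_char, hidem, ho] at h
    simpa [hoj] using (congr_fun (congr_fun h j) j).symm
  · have h := hfix (x - x.trace • single o o 1) (by simp)
    rw [hlin.map_sub, hlin.map_smul, ho, sub_eq_iff_eq_add] at h
    rw [h, shear, smul_add, smul_smul, mul_comm lam]
    abel

theorem IsRAutSl.exists_isStandardAut (hp : p.Prime) [CharP k p] (hn : 2 ≤ n)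
    {g : slMod n k → slMod n k} (hg : IsRAutSl n k p g) :
    ∃ s : M → M, IsStandardAut s ∧ ∀ x : slMod n k, s x = g x := by
  have : Nontrivial (Fin n) := Fin.nontrivial_iff_two_le.2 hn
  obtain ⟨G, hG, hGg⟩ := hg.exists_isTraceZeroAut
  obtain ⟨Q, R, hRQ, h | ⟨h3, h⟩⟩ := hG.exists_conj_or_neg_transpose hp
  · exact ⟨fun x => Q * x * R, ⟨Q, R, hRQ, Or.inl fun _ => rfl⟩, fun x => by
      rw [← hGg, h x x.2]⟩
  · rw [Fintype.card_fin] at h3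
    exact ⟨fun x => -(Q * xᵀ * R), ⟨Q, R, hRQ, Or.inr ⟨h3, fun _ => rfl⟩⟩, fun x => by
      rw [← hGg, h x x.2]⟩

theorem IsStandardAut.shear_apply {s : M → M} (hs : IsStandardAut s) (lam : k) (x : M) :
    shear lam (s x) = s (shear lam x) := by
  obtain ⟨e, h1, htr⟩ := hs.exists_scalar
  rw [shear, shear, hs.isLinearMap.map_add, hs.isLinearMap.map_smul, h1, htr, smul_smul]
  ring_nf

theorem IsStandardAut.ext (hn : 2 ≤ n) {s t : M → M} (hs : IsStandardAut s) (ht : IsStandardAut t)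
    (h : ∀ x : M, x.trace = 0 → s x = t x) : s = t := by
  obtain ⟨t', ht', htt, htt'⟩ := ht.exists_inverse
  funext x
  have := (ht'.comp hs).eq_self hn (fun x hx => by rw [Function.comp_apply, h x hx, htt]) x
  rw [← htt' (s x)]
  exact congr_arg t this

theorem IsStandardAut.comp_shear_inj (hn : 2 ≤ n) {s t : M → M} (hs : IsStandardAut s)
    (ht : IsStandardAut t) {lam mu : k} (h : ∀ x, s (shear lam x) = t (shear mu x)) :
    s = t ∧ lam = mu := by
  have hst : s = t := hs.ext hn ht fun x hx => by
    simpa only [shear_of_trace_eq_zero _ hx] using h x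
  subst hst
  obtain ⟨t', -, htt, -⟩ := hs.exists_inverse
  refine ⟨rfl, ?_⟩
  let o : Fin n := ⟨0, by omega⟩
  have h' := congr_arg t' (h (single o o 1))
  rw [htt, htt] at h'
  simpa [shear] using congr_fun (congr_fun h' o) o

theorem IsRAutGl.exists_decomposition (hp : p.Prime) [CharP k p] (hn : 2 ≤ n) {f : M → M}
    (hf : IsRAutGl n k p f) :
    ∃ (s : M → M) (lam : {lam : k // lam ^ p = lam}),
      IsStandardAut s ∧ ∀ x, f x = s (shear lam.1 x) := by
  have : Fact p.Prime := ⟨hp⟩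
  obtain ⟨g, hg⟩ := hf.exists_restrict (by omega)
  obtain ⟨s, hs, hsg⟩ := g.2.exists_isStandardAut hp hn
  obtain ⟨t, ht, hts, hst⟩ := hs.exists_inverse
  obtain ⟨lam, hlam, h⟩ := ((ht.isRAutGl hp).comp hf).exists_eq_shear hn fun x hx => by
    rw [Function.comp_apply, hg ⟨x, hx⟩, ← hsg, hts]
  exact ⟨s, ⟨lam, hlam⟩, hs, fun x => by rw [← h, Function.comp_apply, hst]⟩

end GlAut

/-- Let `𝔤 = 𝔤𝔩(n,k)` with `char k = p` dividing `n`.  Every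
restricted Lie algebra automorphism of `𝔤` fixing `𝔰𝔩(n,k)` pointwise has the form
`x ↦ x + λ (tr x) I` with `λ ∈ 𝔽_p`; and `Aut 𝔤 ≅ Aut 𝔰𝔩(n,k) × B`, where `B` is
the cyclic group of order `p` generated by `x ↦ x + (tr x) I`. -/
theorem stmt6 {k : Type*} [Field k] [IsAlgClosed k] {n p : ℕ} [CharP k p]
    (hp : p.Prime) (hpn : p ∣ n) (hn : 0 < n) :
    -- (a) automorphisms fixing 𝔰𝔩 pointwise
    (∀ f, IsRAutGl n k p f → (∀ x : Matrix (Fin n) (Fin n) k, x.trace = 0 → f x = x) →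
      ∃ lam : k, lam ^ p = lam ∧
        ∀ x : Matrix (Fin n) (Fin n) k, f x = x + (lam * x.trace) • (1 : Matrix (Fin n) (Fin n) k)) ∧
    -- (b) Aut 𝔤𝔩 ≅ Aut 𝔰𝔩 × B (with B ≅ 𝔽_p = {λ : λ^p = λ} additive, generated
    -- by x ↦ x + (tr x) • 1, i.e. λ = 1)
    (∃ Φ : {f // IsRAutGl n k p f} →
        {g // IsRAutSl n k p g} × {lam : k // lam ^ p = lam},
      Function.Bijective Φ ∧
      -- Φ is a homomorphism for composition
      (∀ a b c : {f // IsRAutGl n k p f}, c.1 = a.1 ∘ b.1 →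
        ((Φ c).1.1 = (Φ a).1.1 ∘ (Φ b).1.1 ∧
          ((Φ c).2 : k) = ((Φ a).2 : k) + ((Φ b).2 : k))) ∧
      -- the first component of Φ is restriction to 𝔰𝔩
      (∀ a : {f // IsRAutGl n k p f}, ∀ x : ↥(slMod n k),
        a.1 (x : Matrix (Fin n) (Fin n) k) = ((Φ a).1.1 x : Matrix (Fin n) (Fin n) k)) ∧
      -- the generator of B corresponds to λ = 1
      (∀ c : {f // IsRAutGl n k p f},
        c.1 = (fun X : Matrix (Fin n) (Fin n) k =>
          X + X.trace • (1 : Matrix (Fin n) (Fin n) k)) → ((Φ c).2 : k) = 1)) := by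
  have : Fact p.Prime := ⟨hp⟩
  have hn2 : 2 ≤ n := hp.two_le.trans (Nat.le_of_dvd hn hpn)
  have hn0 : (n : k) = 0 := (CharP.cast_eq_zero_iff k p n).2 hpn
  refine ⟨fun f hf hfix => hf.exists_eq_shear hn2 hfix, ?_⟩
  choose res hres using fun f : {f // IsRAutGl n k p f} => f.2.exists_restrict hn
  choose s lam hs hdec using fun f : {f // IsRAutGl n k p f} => f.2.exists_decomposition hp hn2
  have hsres : ∀ f (x : slMod n k), s f x = (res f).1 x := fun f x => by
    rw [← hres, hdec, shear_of_trace_eq_zero _ x.2]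
  refine ⟨fun f => (res f, lam f), ⟨fun f f' h => ?_, fun ⟨g, mu⟩ => ?_⟩, fun a b c h => ⟨?_, ?_⟩,
    hres, fun c hc => ?_⟩
  · obtain ⟨h1, h2⟩ := Prod.mk.inj h
    have hss : s f = s f' := (hs f).ext hn2 (hs f') fun x hx => by
      rw [hsres f ⟨x, hx⟩, hsres f' ⟨x, hx⟩, h1]
    exact Subtype.ext (funext fun x => by rw [hdec, hdec, hss, h2])
  · obtain ⟨t, ht, htg⟩ := g.2.exists_isStandardAut hp hn2
    let f : {f // IsRAutGl n k p f} :=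
      ⟨t ∘ shear mu.1, (ht.isRAutGl hp).comp (isRAutGl_shear hn hn0 mu.2)⟩
    obtain ⟨h1, h2⟩ := (hs f).comp_shear_inj hn2 ht fun x => (hdec f x).symm
    refine ⟨f, Prod.ext (Subtype.ext (funext fun x => Subtype.ext ?_)) (Subtype.ext h2)⟩
    rw [← hsres, h1, htg]
  · funext x
    refine Subtype.ext ?_
    rw [← hres, h, Function.comp_apply, hres, hres, Function.comp_apply]
  · refine ((hs c).comp_shear_inj hn2 ((hs a).comp (hs b)) fun x => ?_).2
    rw [← hdec, h, Function.comp_apply, hdec, hdec, (hs b).shear_apply, shear_shear hn0,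
      Function.comp_apply]
  · refine ((hs c).comp_shear_inj hn2 IsStandardAut.id fun x => ?_).2
    rw [← hdec, hc, id, shear, one_mul]
end

section
/- Suppose 𝔤 carries a non-degenerate G-invariant symmetric bilinear form κ that is also dθ-equivariant (so κ(𝔨,𝔭) = 0). Then for every x ∈ 𝔭, dim z_𝔨(x) − dim z_𝔭(x) = dim 𝔨 − dim 𝔭. -/
/-- The `c`-eigenspace of a Lie algebra automorphism `σ`. -/
def eigA {k L : Type*} [Field k] [LieRing L] [LieAlgebra k L]
    (σ : L ≃ₗ⁅k⁆ L) (c : k) : Submodule k L :=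
  LinearMap.ker (σ.toLinearEquiv.toLinearMap - c • LinearMap.id)

open Module

theorem LinearMap.finrank_range_flip {k V W : Type*} [Field k] [AddCommGroup V] [Module k V]
    [AddCommGroup W] [Module k W] [FiniteDimensional k W]
    (B : V →ₗ[k] W →ₗ[k] k) : finrank k (range B.flip) = finrank k (range B) := by
  have h : B.flip = B.dualMap ∘ₗ Dual.eval k W := by
    ext w v
    simp
  rw [h, LinearMap.range_comp_of_range_eq_top _ (erange_coe k W),
    LinearMap.finrank_range_dualMap_eq_finrank_range]

/-- The left and right kernels of a pairing have the same codimension. -/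
theorem LinearMap.finrank_ker_sub_finrank_ker_flip {k V W : Type*} [Field k]
    [AddCommGroup V] [Module k V] [FiniteDimensional k V]
    [AddCommGroup W] [Module k W] [FiniteDimensional k W] (B : V →ₗ[k] W →ₗ[k] k) :
    (finrank k (ker B) : ℤ) - finrank k (ker B.flip) = finrank k V - finrank k W := by
  have h₁ := B.finrank_range_add_finrank_ker
  have h₂ := B.flip.finrank_range_add_finrank_ker
  have h₃ := B.finrank_range_flip
  omega

theorem Submodule.finrank_comap_subtype {k V : Type*} [Field k] [AddCommGroup V] [Module k V]
    (p q : Submodule k V) :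
    finrank k (q.comap p.subtype) = finrank k ↥(p ⊓ q) := by
  rw [← Submodule.map_comap_subtype, Submodule.finrank_map_subtype_eq]

section eigA

variable {k L : Type*} [Field k] [LieRing L] [LieAlgebra k L] {σ : L ≃ₗ⁅k⁆ L}

theorem mem_eigA {c : k} {x : L} : x ∈ eigA σ c ↔ σ x = c • x := by
  simp [eigA, sub_eq_zero]

theorem lie_mem_eigA {a b : k} {x y : L} (hx : x ∈ eigA σ a) (hy : y ∈ eigA σ b) :
    ⁅x, y⁆ ∈ eigA σ (a * b) := by
  rw [mem_eigA] at *
  rw [LieEquiv.map_lie, hx, hy, smul_lie, lie_smul, smul_smul]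

theorem apply_eq_zero_of_mem_eigA {κ : L →ₗ[k] L →ₗ[k] k}
    (hκθ : ∀ x y, κ (σ x) (σ y) = κ x y) {a b : k} (hab : a * b ≠ 1) {x y : L}
    (hx : x ∈ eigA σ a) (hy : y ∈ eigA σ b) : κ x y = 0 := by
  have h := hκθ x y
  rw [mem_eigA.1 hx, mem_eigA.1 hy] at h
  simp only [map_smul, LinearMap.smul_apply, smul_eq_mul, ← mul_assoc] at h
  by_contra h₀
  exact hab (mul_right_cancel₀ h₀ (by rw [one_mul, mul_comm a b, h]))

theorem exists_eq_add_mem_eigA (hchar : (2 : k) ≠ 0) (hσ : ∀ x, σ (σ x) = x) (x : L) :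
    ∃ y ∈ eigA σ 1, ∃ z ∈ eigA σ (-1), x = y + z := by
  refine ⟨(2⁻¹ : k) • (x + σ x), ?_, (2⁻¹ : k) • (x - σ x), ?_, ?_⟩
  · simp [mem_eigA, hσ, add_comm]
  · simp [mem_eigA, hσ, ← smul_neg]
  · rw [← smul_add, add_add_sub_cancel, ← two_smul k, smul_smul, inv_mul_cancel₀ hchar, one_smul]

/-- The pairing between eigenspaces given by `(y, z) ↦ κ ⁅x, y⁆ z`. -/
def eigPairing (σ : L ≃ₗ⁅k⁆ L) (κ : L →ₗ[k] L →ₗ[k] k) (x : L) (a b : k) :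
    eigA σ a →ₗ[k] eigA σ b →ₗ[k] k :=
  (κ ∘ₗ LieAlgebra.ad k L x).domRestrict₁₂ (eigA σ a) (eigA σ b)

theorem eigPairing_apply (κ : L →ₗ[k] L →ₗ[k] k) (x : L) (a b : k)
    (y : eigA σ a) (z : eigA σ b) : eigPairing σ κ x a b y z = κ ⁅x, (y : L)⁆ z :=
  rfl

end eigA

/-- Suppose `𝔤` carries a non-degenerate invariant symmetric bilinear
form `κ` which is `dθ`-equivariant (hence `κ(𝔨,𝔭)=0`).  Then for every `x ∈ 𝔭`,
`dim z_𝔨(x) − dim z_𝔭(x) = dim 𝔨 − dim 𝔭`.  Here `𝔨`, `𝔭` are the `±1`-eigenspaces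
of the involution `σ = dθ`, and `z_𝔨(x) = 𝔨 ∩ ker (ad x)`, `z_𝔭(x) = 𝔭 ∩ ker (ad x)`. -/
theorem stmt11 {k L : Type*} [Field k] (hchar : (2 : k) ≠ 0)
    [LieRing L] [LieAlgebra k L] [FiniteDimensional k L]
    (σ : L ≃ₗ⁅k⁆ L) (hσ : ∀ x, σ (σ x) = x)
    (κ : L →ₗ[k] L →ₗ[k] k)
    (hκsymm : ∀ x y, κ x y = κ y x)
    (hκnd : ∀ x, (∀ y, κ x y = 0) → x = 0)
    (hκinv : ∀ x y z, κ ⁅x, y⁆ z = κ x ⁅y, z⁆)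
    (hκθ : ∀ x y, κ (σ x) (σ y) = κ x y) :
    ∀ x ∈ eigA σ (-1),
      (Module.finrank k ↥(eigA σ 1 ⊓ LinearMap.ker (LieAlgebra.ad k L x)) : ℤ) -
          Module.finrank k ↥(eigA σ (-1) ⊓ LinearMap.ker (LieAlgebra.ad k L x)) =
        (Module.finrank k ↥(eigA σ 1) : ℤ) - Module.finrank k ↥(eigA σ (-1)) := by
  intro x hx
  have hne : (-1 : k) ≠ 1 := fun h => hchar (by linear_combination -h)
  have hker₁ : LinearMap.ker (eigPairing σ κ x 1 (-1)) =
      (LinearMap.ker (LieAlgebra.ad k L x)).comap (eigA σ 1).subtype := by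
    ext y
    simp only [LinearMap.mem_ker, Submodule.mem_comap, Submodule.subtype_apply,
      LieAlgebra.ad_apply]
    refine ⟨fun h => hκnd _ fun w => ?_, fun h => ?_⟩
    · obtain ⟨u, hu, v, hv, rfl⟩ := exists_eq_add_mem_eigA hchar hσ w
      have hv₀ : κ ⁅x, (y : L)⁆ v = 0 := LinearMap.congr_fun h ⟨v, hv⟩
      rw [map_add, hv₀, add_zero]
      exact apply_eq_zero_of_mem_eigA hκθ (by simpa using hne) (lie_mem_eigA hx y.2) hu
    · ext z
      simp [eigPairing_apply, h]
  have hskew : ∀ y z, κ ⁅x, y⁆ z = -κ ⁅x, z⁆ y := fun y z => by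
    rw [← lie_skew, map_neg, LinearMap.neg_apply, hκinv, hκsymm]
  have hker₂ : LinearMap.ker (eigPairing σ κ x 1 (-1)).flip =
      (LinearMap.ker (LieAlgebra.ad k L x)).comap (eigA σ (-1)).subtype := by
    ext z
    simp only [LinearMap.mem_ker, Submodule.mem_comap, Submodule.subtype_apply,
      LieAlgebra.ad_apply]
    refine ⟨fun h => hκnd _ fun w => ?_, fun h => ?_⟩
    · obtain ⟨u, hu, v, hv, rfl⟩ := exists_eq_add_mem_eigA hchar hσ w
      have hu₀ : κ ⁅x, u⁆ (z : L) = 0 := LinearMap.congr_fun h ⟨u, hu⟩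
      rw [map_add, hskew _ u, hu₀, neg_zero, zero_add]
      exact apply_eq_zero_of_mem_eigA hκθ (by simpa using hne) (lie_mem_eigA hx z.2) hv
    · ext y
      simp [eigPairing_apply, hskew _ (z : L), h]
  rw [← Submodule.finrank_comap_subtype, ← Submodule.finrank_comap_subtype, ← hker₁, ← hker₂]
  exact LinearMap.finrank_ker_sub_finrank_ker_flip _
end
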